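/- Let d ≥ 2, σ ≥ 2, and set D_d(σ) = d^{2^{(d+1)↑^{d²+d−2}((d+1)^σ)}}. If I is an ideal of R generated by a homogeneous regular sequence of length at most σ whose elements have degrees at most d, then every minimal prime P of I is generated by at most D_d(σ) elements. -/

import Mathlib

open MvPolynomial

/-- Knuth's up-arrow `knuth a k b = a ↑^k b`, with `a ↑^1 b = a ^ b`,
`a ↑^(k+1) 1 = a` and `a ↑^(k+1) (b+1) = a ↑^k (a ↑^(k+1) b)`. -/
def knuth (a : ℕ) : ℕ → ℕ → ℕ
  | 0, b => a ^ b
  | 1, b => a ^ b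
  | _+2, 0 => 1
  | _+2, 1 => a
  | k+2, b+2 => knuth a (k+1) (knuth a (k+2) (b+1))
  termination_by k b => (k, b)

/-! ### Regular sequences localised at a prime -/

section LocReg
variable {A : Type*} [CommRing A]

/-- `a` is a nonzerodivisor modulo `I` after localising at `q`. -/
def LocNZD (q I : Ideal A) (a : A) : Prop := ∀ x, a * x ∈ I → ∃ s, s ∉ q ∧ s * x ∈ I

/-- `l` is a regular sequence modulo `I` after localising at `q`. -/
def LocReg (q : Ideal A) : Ideal A → List A → Prop
  | _, [] => True
  | I, a :: l => LocNZD q I a ∧ LocReg q (I ⊔ Ideal.span {a}) l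

/-- `q` is (after localisation at `q`) an associated prime of `I`. -/
def LocAss (q I : Ideal A) : Prop :=
  ∃ x, (∀ a ∈ q, ∃ s, s ∉ q ∧ s * (a * x) ∈ I) ∧ ∀ s, s ∉ q → s * x ∉ I

lemma LocReg.append_iff {q : Ideal A} {l₁ l₂ : List A} {I : Ideal A} :
    LocReg q I (l₁ ++ l₂) ↔ LocReg q I l₁ ∧ LocReg q (I ⊔ Ideal.ofList l₁) l₂ := by
  induction l₁ generalizing I with
  | nil => simp [LocReg]
  | cons a l ih => simp [LocReg, ih, and_assoc, sup_assoc]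

lemma mem_sup_span_singleton_iff {I : Ideal A} {a x : A} :
    x ∈ I ⊔ Ideal.span {a} ↔ ∃ i ∈ I, ∃ b, i + a * b = x := by
  rw [Submodule.mem_sup]
  constructor
  · rintro ⟨i, hi, y, hy, rfl⟩
    obtain ⟨b, rfl⟩ := Ideal.mem_span_singleton'.1 hy
    exact ⟨i, hi, b, by ring⟩
  · rintro ⟨i, hi, b, rfl⟩
    exact ⟨i, hi, a * b, Ideal.mem_span_singleton.2 (dvd_mul_right a b), rfl⟩

lemma mem_associatedPrimes_quotient [IsNoetherianRing A] {I p : Ideal A} :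
    p ∈ associatedPrimes A (A ⧸ I) ↔ p.IsPrime ∧ ∃ x, ∀ a, a ∈ p ↔ a * x ∈ I := by
  rw [AssociatedPrimes.mem_iff, isAssociatedPrime_iff]
  refine and_congr_right fun _ => ⟨?_, ?_⟩
  · rintro ⟨x, rfl⟩
    obtain ⟨x, rfl⟩ := Ideal.Quotient.mk_surjective x
    refine ⟨x, fun a => ?_⟩
    rw [Submodule.mem_colon_singleton, Submodule.mem_bot, ← Ideal.Quotient.eq_zero_iff_mem, map_mul]
    rfl
  · rintro ⟨x, h⟩
    refine ⟨Ideal.Quotient.mk I x, ?_⟩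
    ext a
    rw [h, Submodule.mem_colon_singleton, Submodule.mem_bot, ← Ideal.Quotient.eq_zero_iff_mem,
      map_mul]
    rfl

lemma LocReg.locNZD_getElem {q I : Ideal A} {l : List A} (hl : LocReg q I l) {k : ℕ}
    (hk : k < l.length) :
    LocNZD q (I ⊔ Ideal.ofList (l.take k)) l[k] := by
  have h2 := hl
  rw [← List.take_append_drop k l, LocReg.append_iff, ← List.cons_getElem_drop_succ (h := hk)] at h2
  exact h2.2.1

variable {q I : Ideal A} [hq : q.IsPrime]

lemma notMem_mul {s t : A} (hs : s ∉ q) (ht : t ∉ q) : s * t ∉ q := fun h =>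
  (hq.mem_or_mem h).elim hs ht

lemma LocAss.not_locNZD (h : LocAss q I) {a : A} (ha : a ∈ q) : ¬ LocNZD q I a := by
  intro hn
  obtain ⟨x, hx, hx'⟩ := h
  obtain ⟨s, hs, h1⟩ := hx a ha
  obtain ⟨t, ht, h2⟩ := hn (s * x) (by convert h1 using 1; ring)
  exact hx' (t * s) (notMem_mul ht hs) (by convert h2 using 1; ring)

lemma LocAss.exchange {x y : A} (hx : LocNZD q I x) (hy : LocNZD q I y) (hyq : y ∈ q)
    (h : LocAss q (I ⊔ Ideal.span {x})) : LocAss q (I ⊔ Ideal.span {y}) := by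
  obtain ⟨w, hw, hw'⟩ := h
  obtain ⟨s, hs, h1⟩ := hw y hyq
  obtain ⟨i, hi, w', h1⟩ := mem_sup_span_singleton_iff.1 h1
  refine ⟨w', fun a ha => ?_, fun t ht hmem => ?_⟩
  · obtain ⟨u, hu, h2⟩ := hw a ha
    obtain ⟨j, hj, v, h2⟩ := mem_sup_span_singleton_iff.1 h2
    obtain ⟨t, ht, h3⟩ := hx (u * (a * w') - s * (y * v)) (by
      have : x * (u * (a * w') - s * (y * v)) = s * y * j - u * a * i := by
        linear_combination u * a * h1 - s * y * h2
      rw [this]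
      exact I.sub_mem (I.mul_mem_left _ hj) (I.mul_mem_left _ hi))
    refine ⟨t * u, notMem_mul ht hu, mem_sup_span_singleton_iff.2
      ⟨_, h3, t * (s * v), by ring⟩⟩
  · obtain ⟨j, hj, v, h2⟩ := mem_sup_span_singleton_iff.1 hmem
    obtain ⟨u, hu, h3⟩ := hy (t * (s * w) - x * v) (by
      have : y * (t * (s * w) - x * v) = t * i + x * j := by
        linear_combination - t * h1 - x * h2
      rw [this]
      exact I.add_mem (I.mul_mem_left _ hi) (I.mul_mem_left _ hj))
    refine hw' (u * (t * s)) (notMem_mul hu (notMem_mul ht hs)) ?_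
    exact mem_sup_span_singleton_iff.2 ⟨_, h3, u * v, by ring⟩

lemma LocNZD.swap {a z : A} (hz : LocNZD q (I ⊔ Ideal.span {a}) z) (ha : LocNZD q I a) :
    LocNZD q (I ⊔ Ideal.span {z}) a := by
  intro u hu
  obtain ⟨i, hi, v, h1⟩ := mem_sup_span_singleton_iff.1 hu
  obtain ⟨s, hs, h2⟩ := hz v (mem_sup_span_singleton_iff.2 ⟨-i, I.neg_mem hi, u, by
    linear_combination -h1⟩)
  obtain ⟨j, hj, w, h2⟩ := mem_sup_span_singleton_iff.1 h2
  obtain ⟨t, ht, h3⟩ := ha (s * u - z * w) (by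
    have : a * (s * u - z * w) = s * i + z * j := by linear_combination -s * h1 - z * h2
    rw [this]
    exact I.add_mem (I.mul_mem_left _ hi) (I.mul_mem_left _ hj))
  exact ⟨t * s, notMem_mul ht hs, mem_sup_span_singleton_iff.2 ⟨_, h3, t * w, by ring⟩⟩

lemma LocReg.front {z : A} {l : List A} (hl : LocReg q I l)
    (hz : ∀ k ≤ l.length, LocNZD q (I ⊔ Ideal.ofList (l.take k)) z) :
    LocReg q (I ⊔ Ideal.span {z}) l := by
  induction l generalizing I with
  | nil => trivial
  | cons a l ih =>
    refine ⟨LocNZD.swap ?_ hl.1, ?_⟩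
    · simpa using hz 1 (by simp)
    · rw [sup_right_comm]
      refine ih hl.2 fun k hk => ?_
      have := hz (k + 1) (by simpa using hk)
      simpa [sup_assoc] using this

variable [IsNoetherianRing A]

lemma exists_associatedPrime_of_not_locNZD {z : A} (h : ¬ LocNZD q I z) :
    ∃ p ∈ associatedPrimes A (A ⧸ I), z ∈ p ∧ p ≤ q := by
  unfold LocNZD at h
  push Not at h
  obtain ⟨x, hx, h⟩ := h
  let J : Ideal A := I.colon {x}
  have hJ : J ≤ q := fun s hs => by
    by_contra hs'
    exact h s hs' (by simpa [J, Submodule.mem_colon_singleton] using hs)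
  obtain ⟨p, hp, hpq⟩ := Ideal.exists_minimalPrimes_le hJ
  let N : Submodule A (A ⧸ I) := Submodule.span A {Ideal.Quotient.mk I x}
  have hN : Module.annihilator A N = J := by
    ext s
    simp only [N, J, Submodule.mem_colon_singleton]
    rw [← Submodule.annihilator, Submodule.mem_annihilator_span_singleton]
    rw [← Ideal.Quotient.eq_zero_iff_mem, smul_eq_mul, map_mul]
    rfl
  refine ⟨p, ?_, hp.1.2 ?_, hpq⟩
  · rw [← hN] at hp
    exact associatedPrimes.subset_of_injective N.injective_subtype
      (Module.associatedPrimes.minimalPrimes_annihilator_subset_associatedPrimes A N hp)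
  · simpa [J, Submodule.mem_colon_singleton] using hx

lemma locAss_of_mem_associatedPrimes (h : q ∈ associatedPrimes A (A ⧸ I)) : LocAss q I := by
  rw [mem_associatedPrimes_quotient] at h
  obtain ⟨_, x, h⟩ := h
  refine ⟨x, fun a ha => ⟨1, fun h1 => hq.ne_top ((Ideal.eq_top_iff_one q).2 h1), ?_⟩,
    fun s hs => fun h' => hs ((h s).2 h')⟩
  simpa using (h a).1 ha

/-- Prime avoidance: simultaneous local nonzerodivisors. -/
lemma exists_locNZD {ι : Type*} (s : Finset ι) (J : ι → Ideal A)
    (h : ∀ i ∈ s, ∃ x ∈ q, LocNZD q (J i) x) : ∃ z ∈ q, ∀ i ∈ s, LocNZD q (J i) z := by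
  classical
  let T : Set (Ideal A) := (⋃ i ∈ s, associatedPrimes A (A ⧸ J i)) ∩ {p | p ≤ q}
  have hT : T.Finite := (s.finite_toSet.biUnion fun i _ =>
    associatedPrimes.finite A _).inter_of_left _
  have key : ¬ ((q : Set A) ⊆ ⋃ p ∈ T, (p : Set A)) := by
    rw [Ideal.subset_union_prime_finite hT (f := fun p => p) ⊤ ⊤]
    · rintro ⟨p, ⟨hp, hpq⟩, hqp⟩
      obtain rfl : p = q := le_antisymm hpq hqp
      simp only [Set.mem_iUnion] at hp
      obtain ⟨i, hi, hp⟩ := hp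
      obtain ⟨x, hx, hx'⟩ := h i hi
      exact (locAss_of_mem_associatedPrimes hp).not_locNZD hx hx'
    · rintro p ⟨hp, -⟩ - -
      simp only [Set.mem_iUnion] at hp
      obtain ⟨i, hi, hp⟩ := hp
      exact hp.1
  rw [Set.not_subset] at key
  obtain ⟨z, hz, hz'⟩ := key
  refine ⟨z, hz, fun i hi => ?_⟩
  by_contra hcon
  obtain ⟨p, hp, hzp, hpq⟩ := exists_associatedPrime_of_not_locNZD hcon
  exact hz' (Set.mem_biUnion (x := p) ⟨Set.mem_biUnion hi hp, hpq⟩ hzp)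

/-- Kaplansky: maximality of local regular sequences depends only on the length. -/
lemma LocAss.of_length_eq {l₁ l₂ : List A} (h1 : LocReg q I l₁) (h2 : LocReg q I l₂)
    (hm1 : ∀ a ∈ l₁, a ∈ q) (hm2 : ∀ a ∈ l₂, a ∈ q) (hlen : l₁.length = l₂.length)
    (h : LocAss q (I ⊔ Ideal.ofList l₁)) : LocAss q (I ⊔ Ideal.ofList l₂) := by
  induction hn : l₁.length generalizing I l₁ l₂ with
  | zero =>
    obtain rfl := List.length_eq_zero_iff.1 hn
    obtain rfl := List.length_eq_zero_iff.1 (hlen.symm.trans hn)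
    exact h
  | succ n ih =>
    obtain rfl | ⟨m₁, x, rfl⟩ := List.eq_nil_or_concat l₁
    · simp at hn
    obtain rfl | ⟨m₂, y, rfl⟩ := List.eq_nil_or_concat l₂
    · simp at hlen
    simp only [List.concat_eq_append] at *
    simp only [List.length_append, List.length_singleton, Nat.add_right_cancel_iff] at hn hlen
    have hex : ∀ m : List A, ∀ x, LocReg q I (m ++ [x]) → (∀ a ∈ m ++ [x], a ∈ q) → m.length = n →
        ∀ k ∈ Finset.range (n + 1), ∃ x ∈ q, LocNZD q (I ⊔ Ideal.ofList (m.take k)) x := by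
      intro m x hm hm' hmn k hk
      have hk' : k < (m ++ [x]).length := by simpa [hmn] using hk
      refine ⟨_, hm' _ (List.getElem_mem hk'), ?_⟩
      have := hm.locNZD_getElem hk'
      rwa [List.take_append_of_le_length (by simp at hk; omega)] at this
    obtain ⟨z, hz, hz'⟩ := exists_locNZD (q := q)
      ((Finset.range (n + 1)).disjSum (Finset.range (n + 1)))
      (Sum.elim (fun k => I ⊔ Ideal.ofList (m₁.take k)) (fun k => I ⊔ Ideal.ofList (m₂.take k)))
      (by
        rintro (k | k) hk
        · exact hex m₁ x h1 hm1 hn k (by simpa using hk)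
        · exact hex m₂ y h2 hm2 (hlen.symm.trans hn) k (by simpa using hk))
    have hz1 : ∀ k ≤ n, LocNZD q (I ⊔ Ideal.ofList (m₁.take k)) z := fun k hk =>
      hz' (Sum.inl k) (by simp; omega)
    have hz2 : ∀ k ≤ n, LocNZD q (I ⊔ Ideal.ofList (m₂.take k)) z := fun k hk =>
      hz' (Sum.inr k) (by simp; omega)
    rw [LocReg.append_iff] at h1 h2
    have e : ∀ (m : List A) (x : A), I ⊔ Ideal.ofList (m ++ [x]) =
        (I ⊔ Ideal.ofList m) ⊔ Ideal.span {x} := fun m x => by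
      rw [Ideal.ofList_append, Ideal.ofList_singleton, sup_assoc]
    rw [e] at h ⊢
    have hn2 : m₂.length = n := hlen.symm.trans hn
    have hz1n := hz1 n le_rfl
    have hz2n := hz2 n le_rfl
    rw [List.take_of_length_le hn.le] at hz1n
    rw [List.take_of_length_le hn2.le] at hz2n
    have s1 := h.exchange h1.2.1 hz1n hz
    rw [sup_right_comm] at s1
    have s2 := ih (h1.1.front fun k hk => hz1 k (hk.trans hn.le))
      (h2.1.front fun k hk => hz2 k (hk.trans hn2.le))
      (fun a ha => hm1 a (by simp [ha])) (fun a ha => hm2 a (by simp [ha])) hlen s1 hn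
    rw [sup_right_comm] at s2
    exact s2.exchange hz2n h2.2.1 (hm2 y (by simp))

/-- Every prime contains a local regular sequence of length at least its height. -/
def HasDepth (A : Type*) [CommRing A] : Prop :=
  ∀ q : Ideal A, q.IsPrime → ∃ l : List A, (∀ a ∈ l, a ∈ q) ∧ q.height ≤ l.length ∧ LocReg q ⊥ l

lemma HasDepth.height_le (hA : HasDepth A) {l : List A} (hl : LocReg q ⊥ l) (hm : ∀ a ∈ l, a ∈ q)
    (h : LocAss q (Ideal.ofList l)) : q.height ≤ l.length := by
  obtain ⟨m, hm', hlen, hreg⟩ := hA q hq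
  refine hlen.trans ?_
  by_contra hcon
  have hlt : l.length < m.length := by simpa using hcon
  have hreg' := hreg
  rw [← List.take_append_drop l.length m, LocReg.append_iff] at hreg'
  have := LocAss.of_length_eq hl hreg'.1 hm (fun a ha => hm' a (List.mem_of_mem_take ha))
    (by simp; omega) (by simpa using h)
  exact this.not_locNZD (hm' _ (List.getElem_mem hlt)) (hreg.locNZD_getElem hlt)

end LocReg

namespace Polynomial
variable {A : Type*} [CommRing A]

lemma exists_pow_mul_mem_map_C {I : Ideal A} {u f : A[X]} (h : u * f ∈ I.map C) :
    ∃ k, C u.leadingCoeff ^ k * f ∈ I.map C := by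
  induction hn : f.support.card using Nat.strong_induction_on generalizing f with
  | _ n ih =>
    by_cases hf : f = 0
    · exact ⟨0, by simp [hf]⟩
    have hlc : u.leadingCoeff * f.leadingCoeff ∈ I := by
      rw [← coeff_mul_degree_add_degree]
      exact Ideal.mem_map_C_iff.1 h _
    have hmon : C u.leadingCoeff * (monomial f.natDegree f.leadingCoeff) ∈ I.map C := by
      rw [C_mul_monomial, ← C_mul_X_pow_eq_monomial]
      exact Ideal.mul_mem_right _ _ (Ideal.mem_map_of_mem _ hlc)
    have he := f.eraseLead_add_monomial_natDegree_leadingCoeff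
    obtain ⟨k, hk⟩ := ih (C u.leadingCoeff * f.eraseLead).support.card (by
        rw [← hn]
        refine lt_of_le_of_lt (Finset.card_le_card ?_) (eraseLead_support_card_lt hf)
        intro i hi
        simp only [mem_support_iff, coeff_C_mul] at hi ⊢
        exact right_ne_zero_of_mul hi) (f := C u.leadingCoeff * f.eraseLead) (by
        have : u * (C u.leadingCoeff * f.eraseLead) =
          C u.leadingCoeff * (u * f) -
            u * (C u.leadingCoeff * monomial f.natDegree f.leadingCoeff) := by
          linear_combination C u.leadingCoeff * u * he
        rw [this]
        exact Ideal.sub_mem _ (Ideal.mul_mem_left _ _ h) (Ideal.mul_mem_left _ _ hmon)) rfl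
    refine ⟨k + 1, ?_⟩
    have : C u.leadingCoeff ^ (k + 1) * f = C u.leadingCoeff ^ k * (C u.leadingCoeff * f.eraseLead)
        + C u.leadingCoeff ^ k * (C u.leadingCoeff * monomial f.natDegree f.leadingCoeff) := by
      linear_combination - C u.leadingCoeff ^ (k + 1) * he
    rw [this]
    exact Ideal.add_mem _ hk (Ideal.mul_mem_left _ _ hmon)

/-- Pseudo-division. -/
lemma exists_pow_mul_sub_degree_lt (u f : A[X]) (hu : u ≠ 0) :
    ∃ (k : ℕ) (q : A[X]), (C u.leadingCoeff ^ k * f - q * u).degree < u.degree := by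
  induction hn : f.natDegree using Nat.strong_induction_on generalizing f with
  | _ n ih =>
    by_cases hlt : f.degree < u.degree
    · exact ⟨0, 0, by simpa using hlt⟩
    have hle : u.natDegree ≤ f.natDegree := natDegree_le_natDegree (not_lt.1 hlt)
    have hf0 : f ≠ 0 := by rintro rfl; exact hlt (by simpa [bot_lt_iff_ne_bot] using hu)
    set g := C u.leadingCoeff * f - C f.leadingCoeff * X ^ (f.natDegree - u.natDegree) * u with hg
    have hcoef : ∀ j, f.natDegree ≤ j → g.coeff j = 0 := by
      intro j hj
      rw [hg, coeff_sub, coeff_C_mul, mul_assoc, coeff_C_mul, mul_comm (X ^ _) u, coeff_mul_X_pow']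
      rw [if_pos (by omega)]
      rcases hj.eq_or_lt with rfl | hj
      · rw [show f.natDegree - (f.natDegree - u.natDegree) = u.natDegree by omega,
          coeff_natDegree, coeff_natDegree]; ring
      · rw [coeff_eq_zero_of_natDegree_lt hj,
          coeff_eq_zero_of_natDegree_lt (p := u) (by omega)]; simp
    by_cases hg0 : g.degree < u.degree
    · exact ⟨1, _, by simpa [hg] using hg0⟩
    have hgn : g ≠ 0 := by rintro h; exact hg0 (by simpa [h, bot_lt_iff_ne_bot] using hu)
    have hgd : g.natDegree < n := by
      by_contra hcon
      exact hgn (leadingCoeff_eq_zero.1 (hcoef _ (by omega)))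
    obtain ⟨k, q, hkq⟩ := ih _ hgd g rfl
    refine ⟨k + 1, q + C u.leadingCoeff ^ k * (C f.leadingCoeff * X ^ (f.natDegree - u.natDegree)),
      ?_⟩
    convert hkq using 2
    rw [hg]; ring

lemma _root_.LocNZD.map_C {P : Ideal A[X]} [P.IsPrime] {I : Ideal A} {a : A}
    (h : LocNZD (P.comap C) I a) : LocNZD P (I.map C) (C a) := by
  intro f hf
  have : ∀ n, ∃ s, s ∉ P.comap C ∧ s * f.coeff n ∈ I := fun n => h _ (by
    rw [← coeff_C_mul]; exact Ideal.mem_map_C_iff.1 hf n)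
  choose s hs hs' using this
  refine ⟨C (∏ i ∈ f.support, s i), fun hmem => ?_, Ideal.mem_map_C_iff.2 fun n => ?_⟩
  · have : (∏ i ∈ f.support, s i) ∈ P.comap C := hmem
    rw [Ideal.IsPrime.prod_mem_iff] at this
    obtain ⟨i, -, hi⟩ := this
    exact hs i hi
  · rw [coeff_C_mul]
    by_cases hn : n ∈ f.support
    · rw [← Finset.mul_prod_erase _ _ hn, mul_assoc, mul_left_comm]
      exact I.mul_mem_left _ (hs' n)
    · rw [notMem_support_iff.1 hn]; simp

lemma _root_.LocReg.map_C {P : Ideal A[X]} [P.IsPrime] {l : List A} {I : Ideal A}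
    (h : LocReg (P.comap C) I l) : LocReg P (I.map C) (l.map C) := by
  induction l generalizing I with
  | nil => trivial
  | cons a l ih =>
    refine ⟨h.1.map_C, ?_⟩
    have := ih h.2
    rwa [Ideal.map_sup, Ideal.map_span, Set.image_singleton] at this

lemma _root_.HasDepth.polynomial [IsNoetherianRing A] (hA : HasDepth A) : HasDepth A[X] := by
  classical
  intro P hP
  set p := P.comap C with hp
  obtain ⟨l, hl, hlen, hreg⟩ := hA p inferInstance
  obtain ⟨s, hs, hcard⟩ := p.exists_finset_card_eq_height_of_isNoetherianRing
  have hregC : LocReg P ⊥ (l.map C) := by simpa using LocReg.map_C (I := ⊥) hreg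
  have hmemC : ∀ a ∈ l.map C, a ∈ P := by
    intro a ha
    obtain ⟨b, hb, rfl⟩ := List.mem_map.1 ha
    exact hl b hb
  have hcomap : ∀ Q : Ideal A[X], Q.IsPrime → Q ≤ P → (s.image C : Set A[X]) ⊆ Q →
      Q.comap C = p := by
    intro Q hQ hQP hsQ
    refine le_antisymm (Ideal.comap_mono hQP) (hs.2 ⟨inferInstance, ?_⟩ (Ideal.comap_mono hQP))
    rw [Ideal.span_le]
    intro x hx
    exact hsQ (Finset.mem_coe.2 (Finset.mem_image_of_mem _ hx))
  have hsP : (s.image C : Set A[X]) ⊆ P := by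
    intro x hx
    simp only [Finset.coe_image, Set.mem_image, Finset.mem_coe] at hx
    obtain ⟨y, hy, rfl⟩ := hx
    exact hs.1.2 (Ideal.subset_span hy)
  have hcardle : (((s.image C).card : ℕ) : ℕ∞) ≤ l.length := by
    refine le_trans ?_ hlen
    rw [← hcard]
    exact_mod_cast Finset.card_image_le
  by_cases hex : ∃ u ∈ P, u ∉ p.map C
  · let S : Set ℕ := {n | ∃ u ∈ P, u ∉ p.map C ∧ u.natDegree = n}
    have hS : S.Nonempty := by obtain ⟨u, hu, hu'⟩ := hex; exact ⟨_, u, hu, hu', rfl⟩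
    obtain ⟨u, huP, hup, hdeg⟩ := Nat.sInf_mem hS
    have hmin : ∀ f ∈ P, f.natDegree < u.natDegree → f ∈ p.map C := by
      intro f hf hlt
      by_contra hcon
      exact absurd (Nat.sInf_le (s := S) ⟨f, hf, hcon, rfl⟩) (by omega)
    have hu0 : u ≠ 0 := by rintro rfl; exact hup (Ideal.zero_mem _)
    have hlc : u.leadingCoeff ∉ p := by
      intro hlc
      have hC : C u.leadingCoeff ∈ p.map C := Ideal.mem_map_of_mem _ hlc
      have hpP : p.map C ≤ P := Ideal.map_comap_le
      have hm : monomial u.natDegree u.leadingCoeff ∈ p.map C := by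
        rw [← C_mul_X_pow_eq_monomial]; exact Ideal.mul_mem_right _ _ hC
      by_cases h0 : u.natDegree = 0
      · apply hup
        rw [eq_C_of_natDegree_eq_zero h0]
        rw [leadingCoeff, h0] at hC
        exact hC
      · have he := u.eraseLead_add_monomial_natDegree_leadingCoeff
        have := hmin u.eraseLead (by
          rw [← add_sub_cancel_right u.eraseLead, he]
          exact P.sub_mem huP (hpP hm))
          (by have := u.eraseLead_natDegree_le; omega)
        exact hup (he ▸ Ideal.add_mem _ this hm)
    refine ⟨l.map C ++ [u], ?_, ?_, ?_⟩
    · intro a ha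
      rcases List.mem_append.1 ha with ha | ha
      · exact hmemC a ha
      · rw [List.mem_singleton.1 ha]; exact huP
    · have hPmin : P ∈
          (Ideal.span ((insert u (s.image C) : Finset A[X]) : Set A[X])).minimalPrimes := by
        refine ⟨⟨hP, ?_⟩, ?_⟩
        · rw [Ideal.span_le]
          intro x hx
          rcases Finset.mem_insert.1 hx with rfl | hx
          · exact huP
          · exact hsP hx
        · rintro Q ⟨hQ, hsQ⟩ hQP f hf
          rw [Ideal.span_le] at hsQ
          have hQp := hcomap Q hQ hQP (fun x hx => hsQ (Finset.mem_insert_of_mem hx))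
          obtain ⟨k, q, hkq⟩ := exists_pow_mul_sub_degree_lt u f hu0
          have huQ : u ∈ Q := hsQ (Finset.mem_insert_self _ _)
          have hpQ : p.map C ≤ Q := hQp ▸ Ideal.map_comap_le
          have hr : C u.leadingCoeff ^ k * f - q * u ∈ p.map C := by
            by_cases h0 : C u.leadingCoeff ^ k * f - q * u = 0
            · rw [h0]; exact Ideal.zero_mem _
            · exact hmin _ (P.sub_mem (P.mul_mem_left _ hf) (P.mul_mem_left _ huP))
                (natDegree_lt_natDegree h0 hkq)
          have h1 : C u.leadingCoeff ^ k * f ∈ Q := by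
            have := Q.add_mem (hpQ hr) (Q.mul_mem_left q huQ)
            simpa using this
          refine (hQ.mem_or_mem h1).resolve_left fun h2 => hlc ?_
          rw [← hQp]
          exact hQ.mem_of_pow_mem _ h2
      refine (Ideal.height_le_card_of_mem_minimalPrimes_span_finset hPmin).trans ?_
      rw [List.length_append, List.length_map, List.length_singleton, Nat.cast_add]
      refine le_trans (b := (((s.image C).card + 1 : ℕ) : ℕ∞)) ?_ ?_
      · exact_mod_cast Finset.card_insert_le _ _
      · push_cast; gcongr
    · rw [LocReg.append_iff]
      refine ⟨hregC, ?_, trivial⟩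
      have hI : (⊥ : Ideal A[X]) ⊔ Ideal.ofList (l.map C) = (Ideal.ofList l).map C := by
        rw [bot_sup_eq, Ideal.map_ofList]
      rw [hI]
      intro f hf
      obtain ⟨k, hk⟩ := exists_pow_mul_mem_map_C hf
      exact ⟨_, fun h => hlc (hP.mem_of_pow_mem _ h), hk⟩
  · push Not at hex
    refine ⟨l.map C, hmemC, ?_, hregC⟩
    have hPmin : P ∈ (Ideal.span ((s.image C : Finset A[X]) : Set A[X])).minimalPrimes := by
      refine ⟨⟨hP, Ideal.span_le.2 hsP⟩, ?_⟩
      rintro Q ⟨hQ, hsQ⟩ hQP f hf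
      rw [Ideal.span_le] at hsQ
      have hQp := hcomap Q hQ hQP hsQ
      exact (hQp ▸ Ideal.map_comap_le : p.map C ≤ Q) (hex f hf)
    refine (Ideal.height_le_card_of_mem_minimalPrimes_span_finset hPmin).trans ?_
    simpa using hcardle

end Polynomial

section HasDepthEquiv
variable {A : Type*} [CommRing A]

lemma LocReg.map_equiv {B : Type*} [CommRing B] (e : A ≃+* B) {q : Ideal B} {l : List A}
    {I : Ideal A} (h : LocReg (q.comap e) I l) :
    LocReg q (I.map e) (l.map e) := by
  induction l generalizing I with
  | nil => trivial
  | cons a l ih =>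
    refine ⟨fun x hx => ?_, ?_⟩
    · have key : ∀ y, y ∈ I.map e ↔ e.symm y ∈ I := fun y => by
        rw [← Ideal.comap_symm, Ideal.mem_comap]
      obtain ⟨s, hs, hs'⟩ := h.1 (e.symm x) (by rw [key] at hx; simpa using hx)
      exact ⟨e s, hs, (key _).2 (by simpa using hs')⟩
    · have := ih h.2
      rwa [Ideal.map_sup, Ideal.map_span, Set.image_singleton] at this

lemma HasDepth.of_equiv {B : Type*} [CommRing B] (e : A ≃+* B) (hA : HasDepth A) : HasDepth B := by
  intro q hq
  obtain ⟨l, hl, hlen, hreg⟩ := hA (q.comap e) inferInstance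
  refine ⟨l.map e, ?_, ?_, ?_⟩
  · intro a ha
    obtain ⟨b, hb, rfl⟩ := List.mem_map.1 ha
    exact hl b hb
  · rw [e.height_comap] at hlen
    simpa using hlen
  · simpa using LocReg.map_equiv e (I := ⊥) hreg

lemma HasDepth.of_field (K : Type*) [Field K] : HasDepth K := by
  intro q hq
  obtain rfl : q = ⊥ := (Ideal.eq_bot_or_top q).resolve_right hq.ne_top
  exact ⟨[], by simp, by simp, trivial⟩

lemma HasDepth.mvPolynomial_fin [IsNoetherianRing A] (hA : HasDepth A) (n : ℕ) :
    HasDepth (MvPolynomial (Fin n) A) := by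
  induction n with
  | zero => exact hA.of_equiv (MvPolynomial.isEmptyRingEquiv A (Fin 0)).symm
  | succ n ih => exact ih.polynomial.of_equiv (MvPolynomial.finSuccEquiv A n).symm.toRingEquiv

lemma HasDepth.mvPolynomial [IsNoetherianRing A] (hA : HasDepth A) (σ : Type*) [Finite σ] :
    HasDepth (MvPolynomial σ A) := by
  obtain ⟨n, ⟨e⟩⟩ := Finite.exists_equiv_fin σ
  exact (hA.mvPolynomial_fin n).of_equiv (MvPolynomial.renameEquiv A e).symm.toRingEquiv

end HasDepthEquiv

section Catenary
variable {A : Type*} [CommRing A]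

lemma LocNZD.mono {q q' I : Ideal A} {a : A} (h : LocNZD q I a) (hq : q' ≤ q) : LocNZD q' I a :=
  fun x hx => by
    obtain ⟨s, hs, h'⟩ := h x hx
    exact ⟨s, fun h => hs (hq h), h'⟩

lemma LocReg.mono {q q' I : Ideal A} {l : List A} (h : LocReg q I l) (hq : q' ≤ q) :
    LocReg q' I l := by
  induction l generalizing I with
  | nil => trivial
  | cons a l ih => exact ⟨h.1.mono hq, ih h.2⟩

lemma height_map_mk_add_one_le {P p p' : Ideal A} [hp : p.IsPrime] [hp' : p'.IsPrime] (hP : P ≤ p)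
    (h : p < p') : (p.map (Ideal.Quotient.mk P)).height + 1 ≤
      (p'.map (Ideal.Quotient.mk P)).height := by
  have hs : Function.Surjective (Ideal.Quotient.mk P) := Ideal.Quotient.mk_surjective
  have i1 : (p.map (Ideal.Quotient.mk P)).IsPrime :=
    Ideal.map_isPrime_of_surjective hs (by rwa [Ideal.mk_ker])
  have i2 : (p'.map (Ideal.Quotient.mk P)).IsPrime :=
    Ideal.map_isPrime_of_surjective hs (by rw [Ideal.mk_ker]; exact hP.trans h.le)
  refine Ideal.height_add_one_le_of_lt_of_isPrime (lt_of_le_of_ne (Ideal.map_mono h.le) ?_)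
  intro heq
  have := congrArg (Ideal.comap (Ideal.Quotient.mk P)) heq
  rw [Ideal.comap_map_of_surjective' _ hs, Ideal.comap_map_of_surjective' _ hs, Ideal.mk_ker,
    sup_eq_left.2 hP, sup_eq_left.2 (hP.trans h.le)] at this
  exact h.ne this

variable [IsNoetherianRing A]

lemma minimalPrimes_subset_associatedPrimes (I : Ideal A) :
    I.minimalPrimes ⊆ associatedPrimes A (A ⧸ I) := by
  have := Module.associatedPrimes.minimalPrimes_annihilator_subset_associatedPrimes A (A ⧸ I)
  rwa [Ideal.annihilator_quotient] at this

/-- Prime avoidance: a local nonzerodivisor in an ideal not contained in associated primes. -/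
lemma exists_mem_locNZD {q I : Ideal A} (J : Ideal A) [q.IsPrime]
    (h : ∀ p ∈ associatedPrimes A (A ⧸ I), p ≤ q → ¬ J ≤ p) : ∃ z ∈ J, LocNZD q I z := by
  let T : Set (Ideal A) := associatedPrimes A (A ⧸ I) ∩ {p | p ≤ q}
  have hT : T.Finite := (associatedPrimes.finite A _).inter_of_left _
  have key : ¬ ((J : Set A) ⊆ ⋃ p ∈ T, (p : Set A)) := by
    rw [Ideal.subset_union_prime_finite hT (f := fun p => p) ⊤ ⊤ (fun p hp _ _ => hp.1.1)]
    rintro ⟨p, hp, hJp⟩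
    exact h p hp.1 hp.2 hJp
  rw [Set.not_subset] at key
  obtain ⟨z, hz, hz'⟩ := key
  refine ⟨z, hz, ?_⟩
  by_contra hcon
  obtain ⟨p, hp, hzp, hpq⟩ := exists_associatedPrime_of_not_locNZD hcon
  exact hz' (Set.mem_biUnion (x := p) ⟨hp, hpq⟩ hzp)

lemma ofList_le_of_mem_associatedPrimes {p I : Ideal A} (h : p ∈ associatedPrimes A (A ⧸ I)) :
    I ≤ p := by
  obtain ⟨_, x, hx⟩ := mem_associatedPrimes_quotient.1 h
  intro a ha
  exact (hx a).2 (I.mul_mem_right _ ha)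

lemma HasDepth.extend (hA : HasDepth A) {P q : Ideal A} [P.IsPrime] [q.IsPrime] {l : List A}
    (hl : LocReg q ⊥ l) (n : ℕ)
    (hn : (l.length + n : ℕ) ≤ P.height) :
    ∃ l' : List A, (∀ a ∈ l', a ∈ P) ∧ l'.length = n ∧ (P ≤ q → LocReg q ⊥ (l ++ l')) := by
  by_cases hPq : P ≤ q
  swap
  · exact ⟨List.replicate n 0, by simp, by simp, fun h => absurd h hPq⟩
  induction n with
  | zero => exact ⟨[], by simp, rfl, fun _ => by simpa using hl⟩
  | succ n ih =>
    obtain ⟨l', hl', hlen, hreg⟩ := ih (le_trans (by exact_mod_cast Nat.le_succ _) hn)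
    obtain ⟨z, hz, hz'⟩ := exists_mem_locNZD (q := q) (I := Ideal.ofList (l ++ l')) P (by
      intro p hp hpq hPp
      have := hp.1
      have h1 := hA.height_le (q := p) ((hreg hPq).mono hpq) (fun a ha =>
        ofList_le_of_mem_associatedPrimes hp (Ideal.subset_span ha))
        (locAss_of_mem_associatedPrimes hp)
      have h2 := (hn.trans (Ideal.height_mono hPp)).trans h1
      rw [List.length_append, hlen] at h2
      have : l.length + (n + 1) ≤ l.length + n := by exact_mod_cast h2
      omega)
    refine ⟨l' ++ [z], ?_, by simp [hlen], fun _ => ?_⟩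
    · intro a ha
      rcases List.mem_append.1 ha with ha | ha
      · exact hl' a ha
      · rw [List.mem_singleton.1 ha]; exact hz
    · rw [← List.append_assoc, LocReg.append_iff]
      refine ⟨hreg hPq, by simpa using hz', trivial⟩

lemma LocReg.length_le_height {P : Ideal A} [hP : P.IsPrime] {l : List A} (hl : LocReg P ⊥ l)
    (hm : ∀ a ∈ l, a ∈ P) : (l.length : ℕ∞) ≤ P.height := by
  induction hn : l.length generalizing l P with
  | zero => simp
  | succ n ih =>
    obtain rfl | ⟨m, x, rfl⟩ := List.eq_nil_or_concat l
    · simp at hn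
    simp only [List.concat_eq_append] at *
    rw [LocReg.append_iff] at hl
    have hmP : Ideal.ofList m ≤ P := Ideal.span_le.2 fun a ha => hm a (by simp [show a ∈ m from ha])
    obtain ⟨p, hp, hpP⟩ := Ideal.exists_minimalPrimes_le hmP
    have := hp.1.1
    have hass := minimalPrimes_subset_associatedPrimes _ hp
    have h1 := ih (P := p) (l := m) (hl.1.mono hpP) (fun a ha => hp.1.2 (Ideal.subset_span ha))
      (by simpa using hn)
    have hx : x ∉ p := fun hx => (locAss_of_mem_associatedPrimes hass).not_locNZD hx (by
      have := hl.2.1.mono hpP; simpa using this)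
    have hlt : p < P := lt_of_le_of_ne hpP (by rintro rfl; exact hx (hm x (by simp)))
    have h2 := Ideal.height_add_one_le_of_lt_of_isPrime hlt
    push_cast
    exact le_trans (by gcongr) h2

/-- Associated primes propagate along regular elements. -/
lemma exists_associatedPrime_sup {p q I : Ideal A} [hq : q.IsPrime] {x : A}
    (hp : p ∈ associatedPrimes A (A ⧸ I)) (hpq : p ≤ q) (hx : x ∈ q) (hreg : LocNZD q I x) :
    ∃ p' ∈ associatedPrimes A (A ⧸ (I ⊔ Ideal.span {x})), p ≤ p' ∧ x ∈ p' ∧ p' ≤ q := by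
  obtain ⟨hpp, w, hw⟩ := mem_associatedPrimes_quotient.1 hp
  let N : Ideal A := I.colon p
  have hN : ∀ u, u ∈ N ↔ ∀ a ∈ p, u * a ∈ I := fun u => by
    simp [N, Submodule.mem_colon]
  -- some element of `N` lies outside `I + (x)` locally
  obtain ⟨u, huN, hu⟩ : ∃ u ∈ N, ∀ s, s ∉ q → s * u ∉ I ⊔ Ideal.span {x} := by
    by_contra hcon
    push Not at hcon
    have h1 : ∀ u ∈ N, ∃ s, s ∉ q ∧ ∃ v ∈ N, s * u - x * v ∈ I := by
      intro u hu
      obtain ⟨s, hs, hsu⟩ := hcon u hu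
      obtain ⟨i, hi, v, hv⟩ := mem_sup_span_singleton_iff.1 hsu
      have h2 : ∀ a ∈ p, ∃ t, t ∉ q ∧ t * (v * a) ∈ I := fun a ha => hreg _ (by
        have : x * (v * a) = s * (u * a) - a * i := by linear_combination a * hv
        rw [this]
        exact I.sub_mem (I.mul_mem_left _ ((hN u).1 hu a ha)) (I.mul_mem_left _ hi))
      obtain ⟨G, hG⟩ := (isNoetherianRing_iff_ideal_fg A).1 inferInstance p
      choose! t ht ht' using h2
      have hTmem : (∏ g ∈ G, t g) ∉ q := by
        rw [Ideal.IsPrime.prod_mem_iff]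
        rintro ⟨g, hg, hgq⟩
        exact ht g (hG ▸ Ideal.subset_span hg) hgq
      refine ⟨(∏ g ∈ G, t g) * s, notMem_mul hTmem hs, (∏ g ∈ G, t g) * v, ?_, ?_⟩
      · have : p ≤ I.colon (Ideal.span {(∏ g ∈ G, t g) * v}) := by
          rw [← hG, Ideal.span_le]
          intro g hg
          simp only [SetLike.mem_coe, Submodule.mem_colon, smul_eq_mul]
          intro y hy
          obtain ⟨b, rfl⟩ := Ideal.mem_span_singleton'.1 hy
          classical
          have hgG : g ∈ G := hg
          rw [← Finset.mul_prod_erase _ _ hgG]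
          have := I.mul_mem_left (b * ∏ x ∈ G.erase g, t x) (ht' g (hG ▸ Ideal.subset_span hg))
          convert this using 1; ring
        rw [hN]
        intro a ha
        have := this ha
        rw [Submodule.mem_colon] at this
        simpa [mul_comm] using this _ (Ideal.mem_span_singleton_self _)
      · have : (∏ g ∈ G, t g) * s * u - x * ((∏ g ∈ G, t g) * v) = (∏ g ∈ G, t g) * i := by
          linear_combination - (∏ g ∈ G, t g) * hv
        rw [this]
        exact I.mul_mem_left _ hi
    -- uniform multiplier
    obtain ⟨G, hG⟩ := (isNoetherianRing_iff_ideal_fg A).1 inferInstance N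
    choose! s hs v hv hsv using h1
    classical
    set S := ∏ g ∈ G, s g with hS
    have hSq : S ∉ q := by
      rw [hS, Ideal.IsPrime.prod_mem_iff]
      rintro ⟨g, hg, hgq⟩
      exact hs g (hG ▸ Ideal.subset_span hg) hgq
    let M : Submodule A (A ⧸ I) := Submodule.map (Submodule.mkQ I) N
    have hrange : LinearMap.range (LinearMap.lsmul A M S) ≤ Ideal.span {x} • ⊤ := by
      have key : ∀ u ∈ N, ∃ v ∈ N, S * u - x * v ∈ I := by
        intro u hu
        rw [← hG] at hu
        induction hu using Submodule.span_induction with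
        | mem g hg =>
          have hgG : g ∈ G := hg
          refine ⟨(∏ x ∈ G.erase g, s x) * v g, N.mul_mem_left _ (hv g (hG ▸ Ideal.subset_span hg)),
            ?_⟩
          rw [hS, ← Finset.mul_prod_erase _ _ hgG]
          have := I.mul_mem_left (∏ x ∈ G.erase g, s x) (hsv g (hG ▸ Ideal.subset_span hg))
          convert this using 1; ring
        | zero => exact ⟨0, N.zero_mem, by simp⟩
        | add a b _ _ ha hb =>
          obtain ⟨v1, h1, h1'⟩ := ha
          obtain ⟨v2, h2, h2'⟩ := hb
          exact ⟨v1 + v2, N.add_mem h1 h2, by convert I.add_mem h1' h2' using 1; ring⟩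
        | smul c a _ ha =>
          obtain ⟨v1, h1, h1'⟩ := ha
          exact ⟨c * v1, N.mul_mem_left _ h1, by
            convert I.mul_mem_left c h1' using 1; simp only [smul_eq_mul]; ring⟩
      rintro _ ⟨⟨_, u, hu, rfl⟩, rfl⟩
      obtain ⟨v, hv, h⟩ := key u hu
      have : (LinearMap.lsmul A M S) ⟨Submodule.mkQ I u, u, hu, rfl⟩ =
          x • (⟨Submodule.mkQ I v, v, hv, rfl⟩ : M) := by
        ext
        change S • Submodule.mkQ I u = x • Submodule.mkQ I v
        rw [← map_smul, ← map_smul, ← sub_eq_zero, ← map_sub]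
        exact (Submodule.Quotient.mk_eq_zero I).2 h
      rw [this]
      exact Submodule.smul_mem_smul (Ideal.mem_span_singleton_self x) trivial
    obtain ⟨f, hf, -, hfc, hf0⟩ :=
      LinearMap.exists_monic_and_natDegree_eq_and_coeff_mem_pow_and_aeval_eq_zero A
        (LinearMap.lsmul A M S) _ hrange
    have hfS : f.eval S ∉ q := by
      intro hmem
      rw [Polynomial.eval_eq_sum_range, Finset.sum_range_succ, hf.coeff_natDegree, one_mul] at hmem
      have hsum : ∑ i ∈ Finset.range f.natDegree, f.coeff i * S ^ i ∈ q := by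
        refine Ideal.sum_mem _ fun i hi => q.mul_mem_right _ ?_
        have hle : Ideal.span {x} ^ (f.natDegree - i) ≤ q :=
          (Ideal.pow_le_self (by simp at hi; omega)).trans
            ((Ideal.span_singleton_le_iff_mem _).2 hx)
        exact hle (hfc i)
      exact hSq (hq.mem_of_pow_mem _ ((Ideal.add_mem_iff_right _ hsum).1 hmem))
    have hwN : w ∈ N := (hN w).2 fun a ha => by rw [mul_comm]; exact (hw a).1 ha
    have hzero := LinearMap.congr_fun hf0 ⟨Submodule.mkQ I w, w, hwN, rfl⟩
    have halg : LinearMap.lsmul A M S = algebraMap A (Module.End A M) S := by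
      ext; rfl
    rw [halg, Polynomial.aeval_algebraMap_apply, Polynomial.aeval_def, Polynomial.eval₂_eq_eval_map,
      Algebra.algebraMap_self, Polynomial.map_id] at hzero
    have h0 := congrArg Subtype.val hzero
    change f.eval S • Submodule.mkQ I w = 0 at h0
    rw [← map_smul, Submodule.mkQ_apply, Submodule.Quotient.mk_eq_zero, smul_eq_mul, ← hw] at h0
    exact hfS (hpq h0)
  let J : Ideal A := (I ⊔ Ideal.span {x}).colon {u}
  have hJmem : ∀ s, s ∈ J ↔ s * u ∈ I ⊔ Ideal.span {x} := fun s => by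
    simp [J, Submodule.mem_colon_singleton]
  have hz : ¬ LocNZD q (I ⊔ Ideal.span {x}) 0 := fun h => by
    obtain ⟨s, hs, h⟩ := h u (by simp)
    exact hu s hs h
  have hJq : J ≤ q := fun s hs => by
    by_contra hs'
    exact hu s hs' ((hJmem s).1 hs)
  obtain ⟨p', hp', hp'q⟩ := Ideal.exists_minimalPrimes_le hJq
  let L : Submodule A (A ⧸ (I ⊔ Ideal.span {x})) :=
    Submodule.span A {Ideal.Quotient.mk (I ⊔ Ideal.span {x}) u}
  have hL : Module.annihilator A L = J := by
    ext s
    rw [hJmem, ← Submodule.annihilator, Submodule.mem_annihilator_span_singleton]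
    rw [← Ideal.Quotient.eq_zero_iff_mem, map_mul]
    rfl
  refine ⟨p', ?_, ?_, ?_, hp'q⟩
  · rw [← hL] at hp'
    exact associatedPrimes.subset_of_injective L.injective_subtype
      (Module.associatedPrimes.minimalPrimes_annihilator_subset_associatedPrimes A L hp')
  · intro a ha
    refine hp'.1.2 ((hJmem a).2 (Ideal.mem_sup_left ?_))
    rw [mul_comm]; exact (hN u).1 huN a ha
  · exact hp'.1.2 ((hJmem x).2 (Ideal.mem_sup_right
      (Ideal.mem_span_singleton.2 (dvd_mul_right _ _))))

lemma LocReg.exists_chain {P q : Ideal A} [P.IsPrime] [hq : q.IsPrime] {l : List A} {I p : Ideal A}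
    (hp : p ∈ associatedPrimes A (A ⧸ I)) (hPp : P ≤ p) (hpq : p ≤ q) (hl : LocReg q I l)
    (hm : ∀ a ∈ l, a ∈ q) :
    ((p.map (Ideal.Quotient.mk P)).height + l.length) ≤
      (q.map (Ideal.Quotient.mk P)).height := by
  induction l generalizing I p with
  | nil => simpa using Ideal.height_mono (Ideal.map_mono hpq)
  | cons x l ih =>
    obtain ⟨p', hp', h1, h2, h3⟩ := exists_associatedPrime_sup hp hpq (hm x (by simp)) hl.1
    have i1 := hp.1
    have i2 := hp'.1
    have hx : x ∉ p := fun hx =>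
      (locAss_of_mem_associatedPrimes hp).not_locNZD hx (hl.1.mono hpq)
    have hlt : p < p' := lt_of_le_of_ne h1 (by rintro rfl; exact hx h2)
    refine le_trans ?_ (ih hp' (hPp.trans h1) h3 hl.2 fun a ha => hm a (by simp [ha]))
    rw [List.length_cons, Nat.cast_add, add_comm (l.length : ℕ∞), ← add_assoc]
    gcongr
    exact height_map_mk_add_one_le hPp hlt

/-- In a Cohen-Macaulay ring, cutting an irreducible closed subset by `n` equations raises the
height by at most `n`. -/
theorem HasDepth.height_le_add (hA : HasDepth A) {P q : Ideal A} [hP : P.IsPrime]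
    {F : Finset A} (hq : q ∈ (P ⊔ Ideal.span (F : Set A)).minimalPrimes) :
    q.height ≤ P.height + F.card := by
  classical
  have iq := hq.1.1
  have hPq : P ≤ q := le_sup_left.trans hq.1.2
  obtain ⟨h, hh⟩ := ENat.ne_top_iff_exists.1 (Ideal.height_ne_top_of_isPrime (I := P))
  obtain ⟨H, hH⟩ := ENat.ne_top_iff_exists.1 (Ideal.height_ne_top_of_isPrime (I := q))
  have hle : h ≤ H := by exact_mod_cast hh ▸ hH ▸ Ideal.height_mono hPq
  obtain ⟨b, hbP, hblen, hbreg⟩ := hA.extend (P := P) (q := q) (l := []) trivial h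
    (by simp [hh])
  have hbreg := hbreg hPq
  simp only [List.nil_append] at hbreg
  obtain ⟨t, htq, htlen, htreg⟩ := hA.extend (P := q) (q := q) hbreg (H - h)
    (by rw [hblen, Nat.add_sub_of_le hle, hH])
  have htreg := htreg le_rfl
  have hPass : P ∈ associatedPrimes A (A ⧸ Ideal.ofList b) := by
    obtain ⟨p0, hp0, hp0P⟩ := Ideal.exists_minimalPrimes_le
      (I := Ideal.ofList b) (J := P) (Ideal.span_le.2 hbP)
    have i0 := hp0.1.1
    have h1 := (hbreg.mono (hp0P.trans hPq)).length_le_height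
      (fun a ha => hp0.1.2 (Ideal.subset_span ha))
    obtain rfl : p0 = P :=
      Ideal.eq_of_le_of_height_le _ hp0P (by rw [← hh, ← hblen]; exact h1)
    exact minimalPrimes_subset_associatedPrimes _ hp0
  rw [LocReg.append_iff, bot_sup_eq] at htreg
  have key := htreg.2.exists_chain hPass le_rfl hPq htq
  have hs : Function.Surjective (Ideal.Quotient.mk P) := Ideal.Quotient.mk_surjective
  have hqmin : q.map (Ideal.Quotient.mk P) ∈
      (Ideal.span
        ((F.image (Ideal.Quotient.mk P) : Finset (A ⧸ P)) : Set (A ⧸ P))).minimalPrimes := by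
    refine ⟨⟨Ideal.map_isPrime_of_surjective hs (by rwa [Ideal.mk_ker]), ?_⟩, ?_⟩
    · rw [Finset.coe_image, ← Ideal.map_span]
      exact Ideal.map_mono (le_sup_right.trans hq.1.2)
    · rintro Q ⟨hQ, hFQ⟩ hQq
      rw [Finset.coe_image, ← Ideal.map_span, Ideal.map_le_iff_le_comap] at hFQ
      rw [Ideal.map_le_iff_le_comap]
      refine hq.2 ⟨inferInstance, sup_le ?_ hFQ⟩ ?_
      · intro a ha
        rw [Ideal.mem_comap, Ideal.Quotient.eq_zero_iff_mem.2 ha]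
        exact Q.zero_mem
      · have := Ideal.comap_mono (f := Ideal.Quotient.mk P) hQq
        rwa [Ideal.comap_map_of_surjective' _ hs, Ideal.mk_ker, sup_eq_left.2 hPq] at this
  have h3 := Ideal.height_le_card_of_mem_minimalPrimes_span_finset hqmin
  have h4 : ((H - h : ℕ) : ℕ∞) ≤ F.card := by
    rw [← htlen]
    exact (le_add_self.trans key).trans (h3.trans (by exact_mod_cast Finset.card_image_le))
  have h5 : H - h ≤ F.card := by exact_mod_cast h4
  rw [← hh, ← hH]
  exact_mod_cast (by omega : H ≤ h + F.card)

end Catenary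

/-! ### Freeness over a homogeneous regular sequence -/

/-- A finite family is a regular sequence. -/
def RegFam {R : Type*} [CommRing R] {n : ℕ} (g : Fin n → R) : Prop :=
  ∀ k x, g k * x ∈ Ideal.span (g '' Set.Iio k) → x ∈ Ideal.span (g '' Set.Iio k)

section Free
universe u v
variable {K : Type u} {R : Type v} [Field K] [CommRing R] [Algebra K R] {n : ℕ}

/-- The map `(P_λ) ↦ ∑ P_λ(g) m_λ`. -/
noncomputable def freeMap (g : Fin n → R) {Λ : Type*} (m : Λ → R) :
    (Λ →₀ MvPolynomial (Fin n) K) →ₗ[K] R :=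
  Finsupp.lsum K fun l => (LinearMap.mulRight K (m l)) ∘ₗ (aeval g).toLinearMap

variable {g : Fin n → R} {Λ : Type*} {m : Λ → R}

lemma freeMap_single (l : Λ) (P : MvPolynomial (Fin n) K) :
    freeMap g m (Finsupp.single l P) = aeval g P * m l := by
  simp [freeMap]

lemma freeMap_apply (f : Λ →₀ MvPolynomial (Fin n) K) :
    freeMap g m f = f.sum fun l P => aeval g P * m l := by
  simp only [freeMap, Finsupp.lsum_apply]
  rfl

lemma freeMap_smul (P : MvPolynomial (Fin n) K) (f : Λ →₀ MvPolynomial (Fin n) K) :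
    freeMap g m (P • f) = aeval g P * freeMap g m f := by
  induction f using Finsupp.induction_linear with
  | zero => simp
  | add f g hf hg => rw [smul_add, map_add, hf, hg, map_add, mul_add]
  | single l Q => rw [Finsupp.smul_single, freeMap_single, freeMap_single, smul_eq_mul, map_mul,
      mul_assoc]

variable (𝒜 : ℕ → Submodule K R)

/-- A homogeneous basis of `R` as a module over `K[g]`. -/
structure FreeData (g : Fin n → R) where
  /-- index set -/
  Λ : Type v
  /-- degrees of the basis elements -/
  deg : Λ → ℕ
  /-- the basis elements -/
  m : Λ → R
  hm : ∀ l, m l ∈ 𝒜 (deg l)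
  bij : Function.Bijective (freeMap (K := K) g m)

variable {𝒜} [GradedAlgebra 𝒜] {e : Fin n → ℕ}

lemma proj_mul_of_mem {a b : R} {i : ℕ} (N : ℕ) (ha : a ∈ 𝒜 i) :
    GradedRing.proj 𝒜 N (a * b) = if i ≤ N then a * GradedRing.proj 𝒜 (N - i) b else 0 := by
  simp only [GradedRing.proj_apply]
  split_ifs with h
  · exact DirectSum.coe_decompose_mul_of_left_mem_of_le 𝒜 ha h
  · exact DirectSum.coe_decompose_mul_of_left_mem_of_not_le 𝒜 ha h

lemma proj_smul (c : K) (N : ℕ) (b : R) :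
    GradedRing.proj 𝒜 N (c • b) = c • GradedRing.proj 𝒜 N b := by
  simp only [GradedRing.proj_apply, DirectSum.decompose_smul]
  rfl

lemma proj_of_mem {a : R} {i : ℕ} (N : ℕ) (ha : a ∈ 𝒜 i) :
    GradedRing.proj 𝒜 N a = if i = N then a else 0 := by
  simp only [GradedRing.proj_apply]
  split_ifs with h
  · subst h; exact DirectSum.decompose_of_mem_same 𝒜 ha
  · exact DirectSum.decompose_of_mem_ne 𝒜 ha h

lemma freeMap_surjective (hg : ∀ i, g i ∈ 𝒜 (e i)) (he : ∀ i, 0 < e i)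
    {deg : Λ → ℕ} (hm : ∀ l, m l ∈ 𝒜 (deg l))
    (hspan : ∀ r : R, ∃ c : Λ →₀ K, r - c.sum (fun l a => a • m l) ∈ Ideal.span (Set.range g)) :
    Function.Surjective (freeMap (K := K) g m) := by
  have hmul : ∀ i r, r ∈ LinearMap.range (freeMap (K := K) g m) →
      r * g i ∈ LinearMap.range (freeMap (K := K) g m) := by
    rintro i _ ⟨f, rfl⟩
    exact ⟨X i • f, by rw [freeMap_smul, aeval_X, mul_comm]⟩
  have hm' : ∀ l, m l ∈ LinearMap.range (freeMap (K := K) g m) := fun l =>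
    ⟨Finsupp.single l 1, by rw [freeMap_single]; simp⟩
  have key : ∀ N, ∀ r ∈ 𝒜 N, r ∈ LinearMap.range (freeMap (K := K) g m) := by
    intro N
    induction N using Nat.strong_induction_on with
    | _ N ih =>
      intro r hr
      obtain ⟨c, hc⟩ := hspan r
      obtain ⟨h, hh⟩ := Ideal.mem_span_range_iff_exists_fun.1 hc
      have h1 := congrArg (GradedRing.proj 𝒜 N) hh
      rw [map_sub, proj_of_mem N hr, if_pos rfl, eq_sub_iff_add_eq] at h1
      rw [← h1]
      refine Submodule.add_mem _ ?_ ?_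
      · rw [map_sum]
        refine Submodule.sum_mem _ fun i _ => ?_
        rw [mul_comm, proj_mul_of_mem N (hg i)]
        split_ifs with hi
        · rw [mul_comm]
          exact hmul i _ (ih (N - e i) (by have := he i; omega) _ (by
            simp only [GradedRing.proj_apply]; exact SetLike.coe_mem _))
        · exact Submodule.zero_mem _
      · rw [Finsupp.sum, map_sum]
        refine Submodule.sum_mem _ fun l _ => ?_
        rw [proj_smul, proj_of_mem N (hm l)]
        split_ifs
        · exact Submodule.smul_mem _ _ (hm' l)
        · simp
  intro r
  classical
  have := DirectSum.sum_support_decompose 𝒜 r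
  change r ∈ LinearMap.range (freeMap (K := K) g m)
  rw [← this]
  exact Submodule.sum_mem _ fun i _ => key i _ (SetLike.coe_mem _)

lemma freeMap_mem_of_forall {k : Set (Fin n)} {f : Λ →₀ MvPolynomial (Fin n) K}
    (h : ∀ l, f l ∈ Ideal.span ((X : Fin n → MvPolynomial (Fin n) K) '' k)) :
    freeMap g m f ∈ Ideal.span (g '' k) := by
  rw [freeMap_apply]
  refine Ideal.sum_mem _ fun l _ => Ideal.mul_mem_right _ _ ?_
  have := Ideal.mem_map_of_mem (aeval g : MvPolynomial (Fin n) K →ₐ[K] R) (h l)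
  rw [Ideal.map_span, Set.image_image] at this
  simpa using this

lemma freeMap_independent (hreg : RegFam g)
    (hind : ∀ c : Λ →₀ K, c.sum (fun l a => a • m l) ∈ Ideal.span (Set.range g) → c = 0)
    {k : ℕ} (hk : k ≤ n) (f : Λ →₀ MvPolynomial (Fin n) K)
    (hf : freeMap g m f ∈ Ideal.span (g '' {i | i.val < k})) (l : Λ) :
    f l ∈ Ideal.span ((X : Fin n → MvPolynomial (Fin n) K) '' {i | i.val < k}) := by
  induction hk using Nat.decreasingInduction generalizing f l with
  | self =>
    have huniv : {i : Fin n | i.val < n} = Set.univ := by ext i; simp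
    rw [huniv, Set.image_univ] at hf ⊢
    set c : Λ →₀ K := f.mapRange constantCoeff (map_zero _) with hc
    have h0 : ∀ l, f l - C (c l) ∈ Ideal.span (Set.range (X : Fin n → MvPolynomial (Fin n) K)) := by
      intro l
      rw [← Set.image_univ, mem_ideal_span_X_image]
      intro μ hμ
      by_contra! hcon
      have : μ = 0 := by ext i; simpa using hcon i (Set.mem_univ i)
      subst this
      simp [mem_support_iff, hc, constantCoeff_eq] at hμ
    have h1 := freeMap_mem_of_forall (g := g) (m := m) (k := Set.univ)
      (f := f - c.mapRange C (map_zero _)) (fun l => by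
        rw [Set.image_univ]; simpa using h0 l)
    rw [Set.image_univ, map_sub] at h1
    have h2 : freeMap g m (c.mapRange C (map_zero _)) ∈ Ideal.span (Set.range g) :=
      (Submodule.sub_mem_iff_right _ hf).1 h1
    have h3 : c = 0 := hind c (by
      convert h2 using 1
      rw [freeMap_apply, Finsupp.sum_mapRange_index (g := c) (by simp)]
      refine Finset.sum_congr rfl fun l _ => ?_
      simp only [aeval_C, Algebra.smul_def])
    have := h0 l
    simpa [h3] using this
  | of_succ k hk ih =>
    -- induct on the degree in the `k`-th variable
    obtain ⟨D, hD⟩ : ∃ D, ∀ l, ∀ μ ∈ (f l).support, μ ⟨k, hk⟩ < D := by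
      refine ⟨f.support.sup (fun l => degreeOf ⟨k, hk⟩ (f l)) + 1, fun l μ hμ => ?_⟩
      have hl : l ∈ f.support := by
        rw [Finsupp.mem_support_iff]; intro h; simp [h] at hμ
      exact Nat.lt_succ_of_le ((monomial_le_degreeOf _ hμ).trans
        (Finset.le_sup (f := fun l => degreeOf ⟨k, hk⟩ (f l)) hl))
    induction D generalizing f l with
    | zero =>
      have : f l = 0 := by
        rw [← support_eq_empty, Finset.eq_empty_iff_forall_notMem]
        exact fun μ hμ => absurd (hD l μ hμ) (by simp)
      rw [this]; exact Ideal.zero_mem _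
    | succ D ihD =>
      have hset : ({i : Fin n | i.val < k}) = Set.Iio ⟨k, hk⟩ := by
        ext i; simp [Fin.lt_def]
      set f' : Λ →₀ MvPolynomial (Fin n) K :=
        f.mapRange (fun P => P.divMonomial (Finsupp.single ⟨k, hk⟩ 1)) (zero_divMonomial _) with hf'
      have hq : ∀ l, (f - (X ⟨k, hk⟩ : MvPolynomial (Fin n) K) • f') l ∈
          Ideal.span ((X : Fin n → MvPolynomial (Fin n) K) '' {i | i.val < k}) := by
        intro l
        have heq : (f - (X ⟨k, hk⟩ : MvPolynomial (Fin n) K) • f') l =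
            (f l).modMonomial (Finsupp.single ⟨k, hk⟩ 1) := by
          have := divMonomial_add_modMonomial_single (f l) ⟨k, hk⟩
          simp only [Finsupp.sub_apply, Finsupp.smul_apply, hf', Finsupp.mapRange_apply,
            smul_eq_mul]
          rw [sub_eq_iff_eq_add', this]
        rw [heq, mem_ideal_span_X_image]
        intro μ hμ
        rw [mem_support_iff] at hμ
        have hle : ¬ Finsupp.single ⟨k, hk⟩ 1 ≤ μ := fun h =>
          hμ (coeff_modMonomial_of_le _ h)
        rw [coeff_modMonomial_of_not_le _ hle] at hμ
        have hsub : {i : Fin n | i.val < k} ⊆ {i : Fin n | i.val < k + 1} := by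
          intro i hi
          exact Nat.lt_succ_of_lt hi
        have h1 := ih f (Ideal.span_mono (Set.image_mono hsub) hf) l
        rw [mem_ideal_span_X_image] at h1
        obtain ⟨i, hi, hi'⟩ := h1 μ (mem_support_iff.2 hμ)
        refine ⟨i, ?_, hi'⟩
        rcases Nat.lt_succ_iff_lt_or_eq.1 hi with hi | hi
        · exact hi
        · exfalso
          apply hle
          rw [Finsupp.single_le_iff]
          have : i = ⟨k, hk⟩ := Fin.ext hi
          subst this
          omega
      have h2 := freeMap_mem_of_forall (g := g) (m := m) hq
      rw [map_sub, freeMap_smul, aeval_X] at h2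
      have h3 := (Submodule.sub_mem_iff_right _ hf).1 h2
      rw [hset] at h3
      have h4 := hreg _ _ h3
      rw [← hset] at h4
      have h5 := ihD f' h4 l (by
        intro l μ hμ
        rw [hf', Finsupp.mapRange_apply, mem_support_iff, coeff_divMonomial] at hμ
        have := hD l _ (mem_support_iff.2 hμ)
        simp at this
        omega)
      have h6 := hq l
      rw [Finsupp.sub_apply, Finsupp.smul_apply, smul_eq_mul] at h6
      have := Ideal.add_mem _ h6 (Ideal.mul_mem_left _ (X ⟨k, hk⟩) h5)
      simpa using this

variable (𝒜) in
/-- `R` is free over `K[g]` when `g` is a homogeneous regular sequence. -/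
theorem exists_freeData (hg : ∀ i, g i ∈ 𝒜 (e i)) (he : ∀ i, 0 < e i) (hreg : RegFam g) :
    Nonempty (FreeData 𝒜 g) := by
  set I := Ideal.span (Set.range g)
  let π : R →ₐ[K] R ⧸ I := Ideal.Quotient.mkₐ K I
  obtain ⟨b, hbs, hbspan, hbind⟩ := exists_linearIndependent K (V := R ⧸ I)
    (π '' {x | ∃ N, x ∈ 𝒜 N})
  have hbs' : ∀ x : b, ∃ r N, r ∈ 𝒜 N ∧ π r = x := by
    intro x
    obtain ⟨r, ⟨N, hN⟩, hr⟩ := hbs x.2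
    exact ⟨r, N, hN, hr⟩
  choose m deg hdeg hπ using hbs'
  have hsum : ∀ c : b →₀ K, π (c.sum fun l a => a • m l) = Finsupp.linearCombination K (↑) c := by
    intro c
    rw [Finsupp.linearCombination_apply, Finsupp.sum, Finsupp.sum, map_sum]
    refine Finset.sum_congr rfl fun l _ => ?_
    rw [map_smul, hπ l]
  have htop : Submodule.span K b = ⊤ := by
    rw [hbspan, eq_top_iff]
    rintro x -
    obtain ⟨r, rfl⟩ := Ideal.Quotient.mk_surjective x
    classical
    rw [← DirectSum.sum_support_decompose 𝒜 r]
    change π _ ∈ _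
    rw [map_sum]
    exact Submodule.sum_mem _ fun i _ => Submodule.subset_span ⟨_, ⟨i, SetLike.coe_mem _⟩, rfl⟩
  refine ⟨⟨b, deg, m, hdeg, ?_, ?_⟩⟩
  · rw [injective_iff_map_eq_zero]
    intro f hf
    ext1 l
    have := freeMap_independent (m := m) hreg (fun c hc => ?_) (Nat.zero_le n) f
      (by rw [hf]; exact Ideal.zero_mem _) l
    · simpa using this
    · refine hbind.finsuppLinearCombination_injective ?_
      rw [map_zero, ← hsum]
      exact Ideal.Quotient.eq_zero_iff_mem.2 hc
  · refine freeMap_surjective hg he hdeg fun r => ?_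
    have : π r ∈ Submodule.span K b := htop ▸ Submodule.mem_top
    rw [← Subtype.range_coe (s := b), Finsupp.mem_span_range_iff_exists_finsupp] at this
    obtain ⟨c, hc⟩ := this
    refine ⟨c, ?_⟩
    rw [← Ideal.Quotient.eq_zero_iff_mem, map_sub, sub_eq_zero]
    change π r = π _
    rw [hsum, ← hc, Finsupp.linearCombination_apply]

end Free

/-! ### Extension of primes along `K[g] → R` -/

section Extend
universe u v
variable {K : Type u} {R : Type v} [Field K] [CommRing R] [Algebra K R] {n : ℕ}
  {𝒜 : ℕ → Submodule K R} {g : Fin n → R}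

namespace FreeData

/-- Coordinates with respect to the basis. -/
noncomputable def coord (F : FreeData 𝒜 g) : R ≃ₗ[K] (F.Λ →₀ MvPolynomial (Fin n) K) :=
  (LinearEquiv.ofBijective _ F.bij).symm

variable (F : FreeData 𝒜 g)

lemma freeMap_coord (r : R) : freeMap g F.m (F.coord r) = r :=
  (LinearEquiv.ofBijective _ F.bij).apply_symm_apply r

lemma coord_freeMap (f : F.Λ →₀ MvPolynomial (Fin n) K) : F.coord (freeMap g F.m f) = f :=
  (LinearEquiv.ofBijective _ F.bij).symm_apply_apply f

lemma coord_aeval_mul (P : MvPolynomial (Fin n) K) (r : R) :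
    F.coord (aeval g P * r) = P • F.coord r := by
  rw [← F.coord_freeMap (P • F.coord r), freeMap_smul, F.freeMap_coord]

lemma mem_map_iff (Q : Ideal (MvPolynomial (Fin n) K)) (r : R) :
    r ∈ Q.map (aeval g : MvPolynomial (Fin n) K →ₐ[K] R) ↔ ∀ l, F.coord r l ∈ Q := by
  constructor
  · intro h
    induction h using Submodule.span_induction with
    | mem x hx =>
      obtain ⟨P, hP, rfl⟩ := hx
      intro l
      have := F.coord_aeval_mul P 1
      rw [mul_one] at this
      change F.coord (aeval g P) l ∈ Q
      rw [this]
      exact Q.mul_mem_right _ hP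
    | zero => intro l; simp
    | add x y _ _ hx hy => intro l; rw [map_add]; exact Q.add_mem (hx l) (hy l)
    | smul a x _ hx =>
      intro l
      have : a • x = ∑ k ∈ (F.coord x).support, aeval g (F.coord x k) * (a * F.m k) := by
        conv_lhs => rw [← F.freeMap_coord x, freeMap_apply, Finsupp.sum, smul_eq_mul,
          Finset.mul_sum]
        exact Finset.sum_congr rfl fun k _ => by ring
      rw [this, map_sum, Finsupp.finsetSum_apply]
      refine Q.sum_mem fun k _ => ?_
      rw [F.coord_aeval_mul]
      exact Q.mul_mem_right _ (hx k)
  · intro h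
    rw [← F.freeMap_coord r, freeMap_apply]
    exact Ideal.sum_mem _ fun l _ => Ideal.mul_mem_right _ _ (Ideal.mem_map_of_mem _ (h l))

lemma aeval_mem_map_iff (F : FreeData 𝒜 g) [Nontrivial R] (Q : Ideal (MvPolynomial (Fin n) K))
    (P : MvPolynomial (Fin n) K) :
    aeval g P ∈ Q.map (aeval g : MvPolynomial (Fin n) K →ₐ[K] R) ↔ P ∈ Q := by
  refine ⟨fun h => ?_, fun h => Ideal.mem_map_of_mem _ h⟩
  obtain ⟨l⟩ : Nonempty F.Λ := by
    by_contra hcon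
    rw [not_nonempty_iff] at hcon
    refine one_ne_zero (α := R) (F.coord.injective ?_)
    exact Subsingleton.elim _ _
  have h1 := (F.mem_map_iff Q _).1 (Ideal.mul_mem_right (F.m l) _ h) l
  have h2 : F.coord (F.m l) = Finsupp.single l 1 := by
    rw [← F.coord_freeMap (Finsupp.single l 1), freeMap_single, map_one, one_mul]
  rw [F.coord_aeval_mul, h2] at h1
  simpa using h1

end FreeData

lemma span_range_eq_map : Ideal.span (Set.range g) = (Ideal.span (Set.range X)).map
    (aeval g : MvPolynomial (Fin n) K →ₐ[K] R) := by
  rw [Ideal.map_span, ← Set.range_comp]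
  congr 1
  ext x
  simp

/-- Constant coefficient vectors. -/
noncomputable def FreeData.const {Λ : Type v} (c : Λ →₀ K) : Λ →₀ MvPolynomial (Fin n) K :=
  c.mapRange C (map_zero _)

lemma FreeData.freeMap_const (F : FreeData 𝒜 g) (c : F.Λ →₀ K) :
    freeMap g F.m (FreeData.const c) = ∑ l ∈ c.support, c l • F.m l := by
  rw [freeMap_apply, FreeData.const, Finsupp.sum_mapRange_index (by simp), Finsupp.sum]
  simp only [aeval_C, Algebra.smul_def]

lemma FreeData.exists_const (F : FreeData 𝒜 g) (a : Fin n → K) (r : R) :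
    ∃ c : F.Λ →₀ K, r - freeMap g F.m (FreeData.const c) ∈
      (RingHom.ker (eval a)).map (aeval g : MvPolynomial (Fin n) K →ₐ[K] R) := by
  refine ⟨(F.coord r).mapRange (eval a) (map_zero _), ?_⟩
  rw [F.mem_map_iff]
  intro l
  rw [map_sub, F.coord_freeMap]
  simp [FreeData.const, RingHom.mem_ker]

lemma C_mem_span_range_X {c : K} (h : (C c : MvPolynomial (Fin n) K) ∈ Ideal.span (Set.range X)) :
    c = 0 := by
  rw [← Set.image_univ, mem_ideal_span_X_image] at h
  by_contra hc
  obtain ⟨i, -, hi⟩ := h 0 (by simp [mem_support_iff, hc])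
  simp at hi

variable {e : Fin n → ℕ} [GradedAlgebra 𝒜]

lemma aeval_mem_of_isWeightedHomogeneous (hg : ∀ i, g i ∈ 𝒜 (e i)) {P : MvPolynomial (Fin n) K}
    {N : ℕ} (hP : IsWeightedHomogeneous e P N) : aeval g P ∈ 𝒜 N := by
  rw [aeval_def, eval₂_eq]
  refine Submodule.sum_mem _ fun μ hμ => ?_
  rw [← Algebra.smul_def]
  refine Submodule.smul_mem _ _ ?_
  have h1 := hP (mem_support_iff.1 hμ)
  rw [← h1, Finsupp.weight_apply, Finsupp.sum]
  exact SetLike.prod_mem_graded _ _ _ fun i _ => SetLike.pow_mem_graded _ (hg i)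

lemma proj_aeval (hg : ∀ i, g i ∈ 𝒜 (e i)) (N : ℕ) (P : MvPolynomial (Fin n) K) :
    GradedRing.proj 𝒜 N (aeval g P) = aeval g (weightedHomogeneousComponent e N P) := by
  classical
  induction P using MvPolynomial.induction_on' with
  | monomial μ a =>
    have h := isWeightedHomogeneous_monomial e μ a rfl
    rw [proj_of_mem N (aeval_mem_of_isWeightedHomogeneous hg h),
      weightedHomogeneousComponent_of_mem h]
    split_ifs with h1 h2 h2
    · rfl
    · exact absurd h1.symm h2
    · exact absurd h2.symm h1
    · simp
  | add p q hp hq => simp only [map_add, hp, hq]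

lemma FreeData.coord_proj (F : FreeData 𝒜 g) (hg : ∀ i, g i ∈ 𝒜 (e i)) (N : ℕ) (r : R) (l : F.Λ) :
    F.coord (GradedRing.proj 𝒜 N r) l =
      if F.deg l ≤ N then weightedHomogeneousComponent e (N - F.deg l) (F.coord r l) else 0 := by
  classical
  obtain ⟨f, rfl⟩ : ∃ f, freeMap g F.m f = r := ⟨_, F.freeMap_coord r⟩
  rw [F.coord_freeMap]
  induction f using Finsupp.induction_linear with
  | zero => simp
  | add f f' hf hf' => simp only [map_add, Finsupp.add_apply, hf, hf']; split_ifs <;> simp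
  | single k P =>
    rw [freeMap_single, mul_comm, proj_mul_of_mem N (F.hm k)]
    split_ifs with h1 h2 h2
    · rw [proj_aeval hg, mul_comm, ← freeMap_single, F.coord_freeMap]
      rcases eq_or_ne k l with rfl | hkl
      · simp
      · simp [hkl]
    · rw [proj_aeval hg, mul_comm, ← freeMap_single, F.coord_freeMap]
      rcases eq_or_ne k l with rfl | hkl
      · exact absurd h1 h2
      · simp [hkl]
    · rcases eq_or_ne k l with rfl | hkl
      · exact absurd h2 h1
      · simp [hkl]
    · simp

lemma mem_span_range_X_of_isWeightedHomogeneous {P : MvPolynomial (Fin n) K} {N : ℕ} (hN : N ≠ 0)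
    (hP : IsWeightedHomogeneous e P N) : P ∈ Ideal.span (Set.range X) := by
  rw [← Set.image_univ, mem_ideal_span_X_image]
  intro μ hμ
  have h1 := hP (mem_support_iff.1 hμ)
  by_contra! hcon
  have : μ = 0 := by ext i; simpa using hcon i (Set.mem_univ i)
  subst this
  simp at h1
  exact hN h1.symm

/-- The fibres of `Spec R → Spec K[g]` over rational points are integral. -/
theorem FreeData.isPrime_map_ker_eval (F : FreeData 𝒜 g) (hg : ∀ i, g i ∈ 𝒜 (e i))
    (he : ∀ i, 0 < e i) (hprime : (Ideal.span (Set.range g)).IsPrime) (a : Fin n → K) :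
    ((RingHom.ker (eval a)).map (aeval g : MvPolynomial (Fin n) K →ₐ[K] R)).IsPrime := by
  classical
  set M := (RingHom.ker (eval a)).map (aeval g : MvPolynomial (Fin n) K →ₐ[K] R) with hM
  have hconst : ∀ c : F.Λ →₀ K, freeMap g F.m (FreeData.const c) ∈
      Ideal.span (Set.range g) → c = 0 := by
    intro c hc
    rw [span_range_eq_map (K := K), F.mem_map_iff] at hc
    ext l
    have := hc l
    rw [F.coord_freeMap] at this
    exact C_mem_span_range_X (by simpa [FreeData.const] using this)
  have hconstM : ∀ c : F.Λ →₀ K, freeMap g F.m (FreeData.const c) ∈ M → c = 0 := by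
    intro c hc
    rw [hM, F.mem_map_iff] at hc
    ext l
    have := hc l
    rw [F.coord_freeMap] at this
    simpa [FreeData.const, RingHom.mem_ker] using this
  have htop : ∀ c : F.Λ →₀ K, c ≠ 0 → ∃ i, (∀ l ∈ c.support, F.deg l ≤ i) ∧
      (∑ l ∈ c.support, if F.deg l = i then c l • F.m l else 0) ∉ Ideal.span (Set.range g) := by
    intro c hc
    have hne : c.support.Nonempty := Finsupp.support_nonempty_iff.2 hc
    obtain ⟨l0, hl0, hmax⟩ := Finset.exists_max_image c.support F.deg hne
    refine ⟨F.deg l0, hmax, fun hcon => ?_⟩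
    have h1 := hconst (c.filter fun l => F.deg l = F.deg l0) (by
      rw [F.freeMap_const, Finsupp.support_filter, Finset.sum_filter]
      convert hcon using 1
      refine Finset.sum_congr rfl fun l _ => ?_
      split_ifs with h <;> simp [h])
    have h2 := DFunLike.congr_fun h1 l0
    simp at h2 hl0
    exact hl0 h2
  refine ⟨?_, ?_⟩
  · intro h
    by_cases hR : Nonempty F.Λ
    · obtain ⟨l⟩ := hR
      have := hconstM (Finsupp.single l 1) (h ▸ Submodule.mem_top)
      simp at this
    · apply hprime.ne_top
      rw [eq_top_iff]
      intro x _
      rw [← F.freeMap_coord x, freeMap_apply]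
      rw [not_nonempty_iff] at hR
      simp [Finsupp.sum, Finset.eq_empty_of_isEmpty]
  · intro r s hrs
    by_contra! hcon
    obtain ⟨c, hc⟩ := F.exists_const a r
    obtain ⟨c', hc'⟩ := F.exists_const a s
    rw [← hM] at hc hc'
    have hc0 : c ≠ 0 := by
      rintro rfl
      exact hcon.1 (by simpa [FreeData.const] using hc)
    have hc0' : c' ≠ 0 := by
      rintro rfl
      exact hcon.2 (by simpa [FreeData.const] using hc')
    obtain ⟨i, hi, hi'⟩ := htop c hc0
    obtain ⟨j, hj, hj'⟩ := htop c' hc0'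
    set u := freeMap g F.m (FreeData.const c) * freeMap g F.m (FreeData.const c') with hu
    have huM : u ∈ M := by
      have h1 := M.mul_mem_left (freeMap g F.m (FreeData.const c)) hc'
      have h2 := M.mul_mem_right s hc
      have : u = r * s - (r - freeMap g F.m (FreeData.const c)) * s -
        freeMap g F.m (FreeData.const c) * (s - freeMap g F.m (FreeData.const c')) := by
        rw [hu]; ring
      rw [this]
      exact M.sub_mem (M.sub_mem hrs h2) h1
    have hproj : ∀ N, i + j ≤ N → GradedRing.proj 𝒜 N u = if i + j = N then
        (∑ l ∈ c.support, if F.deg l = i then c l • F.m l else 0) *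
        (∑ l ∈ c'.support, if F.deg l = j then c' l • F.m l else 0) else 0 := by
      intro N hN
      rw [hu, F.freeMap_const, F.freeMap_const, Finset.sum_mul_sum, Finset.sum_mul_sum, map_sum]
      have hterm : ∀ l ∈ c.support, ∀ k ∈ c'.support,
          GradedRing.proj 𝒜 N (c l • F.m l * c' k • F.m k) = if i + j = N then
            (if F.deg l = i then c l • F.m l else 0) * (if F.deg k = j then c' k • F.m k else 0)
          else 0 := by
        intro l hl k hk
        have h1 := hi l hl
        have h2 := hj k hk
        rw [proj_of_mem N (SetLike.mul_mem_graded (Submodule.smul_mem _ (c l) (F.hm l))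
          (Submodule.smul_mem _ (c' k) (F.hm k)))]
        by_cases h3 : F.deg l + F.deg k = N
        · rw [if_pos h3, if_pos (by omega), if_pos (by omega), if_pos (by omega)]
        · rw [if_neg h3]
          split_ifs with h4 h5 h6
          · omega
          · simp
          · simp
          · simp
          · rfl
      rw [Finset.sum_congr rfl fun l hl => by
        rw [map_sum, Finset.sum_congr rfl fun k hk => hterm l hl k hk]]
      split_ifs <;> simp
    have hcoord : ∀ l, F.coord (GradedRing.proj 𝒜 (i + j) u) l ∈ Ideal.span (Set.range X) := by
      intro l
      rw [F.coord_proj hg]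
      split_ifs with hl
      · rcases hl.lt_or_eq with hl | hl
        · exact mem_span_range_X_of_isWeightedHomogeneous (by omega)
            (weightedHomogeneousComponent_isWeightedHomogeneous (w := e) _ _)
        · have h1 : ∀ k, 0 < k → weightedHomogeneousComponent e k (F.coord u l) = 0 := by
            intro k hk
            have h2 := F.coord_proj hg (i + j + k) u l
            rw [hproj _ (by omega), if_neg (by omega), if_pos (by omega),
              show i + j + k - F.deg l = k by omega] at h2
            rw [← h2]; simp
          have h3 : F.coord u l = C (coeff 0 (F.coord u l)) := by
            rw [← weightedHomogeneousComponent_zero (w := e) (F.coord u l)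
              (fun i => (he i).ne')]
            ext μ
            rw [coeff_weightedHomogeneousComponent]
            split_ifs with hμ
            · rfl
            · have h4 := congrArg (coeff μ) (h1 _ (Nat.pos_of_ne_zero hμ))
              rwa [coeff_weightedHomogeneousComponent, if_pos rfl, coeff_zero] at h4
          have h4 : F.coord u l ∈ RingHom.ker (eval a) := (F.mem_map_iff _ _).1 huM l
          rw [h3, RingHom.mem_ker, eval_C] at h4
          rw [h3, h4]
          simp
      · exact Ideal.zero_mem _
    have h5 : GradedRing.proj 𝒜 (i + j) u ∈ Ideal.span (Set.range g) := by
      rw [span_range_eq_map (K := K), F.mem_map_iff]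
      exact hcoord
    rw [hproj _ le_rfl, if_pos rfl] at h5
    rcases hprime.mem_or_mem h5 with h | h
    · exact hi' h
    · exact hj' h

/-- Primes of `K[g]` extend to primes of `R`. -/
theorem FreeData.isPrime_map [IsAlgClosed K] (F : FreeData 𝒜 g) (hg : ∀ i, g i ∈ 𝒜 (e i))
    (he : ∀ i, 0 < e i) (hprime : (Ideal.span (Set.range g)).IsPrime)
    (Q : Ideal (MvPolynomial (Fin n) K)) (hQ : Q.IsPrime) :
    (Q.map (aeval g : MvPolynomial (Fin n) K →ₐ[K] R)).IsPrime := by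
  have hmem : ∀ p, (∀ x ∈ zeroLocus K Q, eval x p = 0) → p ∈ Q := by
    intro p hp
    rw [← IsPrime.vanishingIdeal_zeroLocus (K := K) Q, mem_vanishingIdeal_iff]
    intro x hx
    simpa [aeval_eq_eval] using hp x hx
  have hfib : ∀ x ∈ zeroLocus K Q, Q ≤ RingHom.ker (eval x) := by
    intro x hx p hp
    rw [mem_zeroLocus_iff] at hx
    simpa [aeval_eq_eval, RingHom.mem_ker] using hx p hp
  refine ⟨?_, ?_⟩
  · intro h
    obtain ⟨x, hx⟩ : (zeroLocus K Q).Nonempty := by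
      by_contra hcon
      rw [Set.not_nonempty_iff_eq_empty] at hcon
      exact hQ.ne_top ((Ideal.eq_top_iff_one _).2 (hmem 1 (by simp [hcon])))
    refine (F.isPrime_map_ker_eval hg he hprime x).ne_top ?_
    rw [eq_top_iff, ← h]
    exact Ideal.map_mono (hfib x hx)
  · intro r s hrs
    by_contra! hcon
    rw [F.mem_map_iff, F.mem_map_iff] at hcon
    push Not at hcon
    obtain ⟨⟨l, hl⟩, ⟨k, hk⟩⟩ := hcon
    refine (hQ.mul_notMem hl hk) (hmem _ fun x hx => ?_)
    have h1 := Ideal.map_mono (f := (aeval g : MvPolynomial (Fin n) K →ₐ[K] R)) (hfib x hx) hrs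
    rw [map_mul]
    rcases (F.isPrime_map_ker_eval hg he hprime x).mem_or_mem h1 with h | h
    · rw [(F.mem_map_iff _ _).1 h l, zero_mul]
    · rw [(F.mem_map_iff _ _).1 h k, mul_zero]

end Extend

/-- A prime of height at most `k` in a regular ring is generated by `k` elements up to
multiplication by elements outside the prime. -/
lemma exists_local_generators {A : Type*} [CommRing A] [IsRegularRing A] (q : Ideal A) [q.IsPrime]
    {k : ℕ} (hk : q.height ≤ k) : ∃ F : Fin k → A, (∀ i, F i ∈ q) ∧
      ∀ a ∈ q, ∃ t, t ∉ q ∧ t * a ∈ Ideal.span (Set.range F) := by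
  have hreg := IsRegularRing.isRegularLocalRing_localization (R := A) q
  have h1 := hreg.spanFinrank_maximalIdeal
  rw [IsLocalization.AtPrime.ringKrullDim_eq_height q (Localization.AtPrime q)] at h1
  obtain ⟨s, hs, hspan⟩ := Submodule.FG.exists_span_finset_card_eq_spanFinrank
    (IsNoetherian.noetherian (IsLocalRing.maximalIdeal (Localization.AtPrime q)))
  have hcard : s.card ≤ k := by
    rw [hs]
    have : (((IsLocalRing.maximalIdeal (Localization.AtPrime q)).spanFinrank : ℕ∞) : WithBot ℕ∞)
      ≤ ((k : ℕ∞) : WithBot ℕ∞) := by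
      rw [show (((IsLocalRing.maximalIdeal (Localization.AtPrime q)).spanFinrank : ℕ∞) :
        WithBot ℕ∞) = ((IsLocalRing.maximalIdeal (Localization.AtPrime q)).spanFinrank :
        WithBot ℕ∞) from rfl, h1]
      exact_mod_cast hk
    exact_mod_cast this
  have hmax : ∀ x ∈ s, ∃ a ∈ q, ∃ t : q.primeCompl, algebraMap A (Localization.AtPrime q) a =
      algebraMap A _ t * x := by
    intro x hx
    have hxm : x ∈ IsLocalRing.maximalIdeal (Localization.AtPrime q) := by
      rw [← hspan]; exact Submodule.subset_span hx
    obtain ⟨⟨a, t⟩, h⟩ := IsLocalization.surj q.primeCompl x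
    refine ⟨a, ?_, t, by rw [← h, mul_comm]⟩
    rw [← IsLocalization.AtPrime.to_map_mem_maximal_iff (Localization.AtPrime q) q, ← h]
    exact Ideal.mul_mem_right _ _ hxm
  choose! num hnum den hden using hmax
  let f : Fin k → A := fun i => if h : (i : ℕ) < s.card then num (s.equivFin.symm ⟨i, h⟩) else 0
  have hrange : ∀ x ∈ s, num x ∈ Set.range f := by
    intro x hx
    refine ⟨⟨s.equivFin ⟨x, hx⟩, (s.equivFin ⟨x, hx⟩).2.trans_le hcard⟩, ?_⟩
    simp [f]
  refine ⟨f, fun i => ?_, fun a ha => ?_⟩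
  · simp only [f]
    split_ifs with h
    · exact hnum _ (s.equivFin.symm ⟨i, h⟩).2
    · exact q.zero_mem
  · have h2 : algebraMap A (Localization.AtPrime q) a ∈
        (Ideal.span (Set.range f)).map (algebraMap A (Localization.AtPrime q)) := by
      have h3 : algebraMap A (Localization.AtPrime q) a ∈
          IsLocalRing.maximalIdeal (Localization.AtPrime q) :=
        (IsLocalization.AtPrime.to_map_mem_maximal_iff (Localization.AtPrime q) q a).2 ha
      rw [← hspan] at h3
      refine (Submodule.span_le (p := ((Ideal.span (Set.range f)).map
        (algebraMap A (Localization.AtPrime q))))).2 (fun x hx => ?_) h3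
      have h4 := hden x hx
      have h5 : algebraMap A (Localization.AtPrime q) (num x) ∈
          (Ideal.span (Set.range f)).map (algebraMap A (Localization.AtPrime q)) :=
        Ideal.mem_map_of_mem _ (Ideal.subset_span (hrange x hx))
      rw [h4] at h5
      exact (Ideal.unit_mul_mem_iff_mem _ (IsLocalization.map_units _ (den x))).1 h5
    obtain ⟨t, ht, h⟩ := (IsLocalization.algebraMap_mem_map_algebraMap_iff q.primeCompl _ _ _).1 h2
    exact ⟨t, ht, h⟩

section Minors

lemma Matrix.exists_det_submatrix_ne_zero {κ : Type*} [Field κ] {n : ℕ} {ι : Type*} [Fintype ι]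
    (M : Matrix (Fin n) ι κ) (h : LinearIndependent κ M.row) :
    ∃ c : Fin n → ι, (M.submatrix id c).det ≠ 0 := by
  obtain ⟨J, a, ha, hspan, hli⟩ := exists_linearIndependent' κ M.col
  have : Finite J := Finite.of_injective a ha
  have : Fintype J := Fintype.ofFinite J
  have hr := h.rank_matrix
  rw [Matrix.rank_eq_finrank_span_cols, ← hspan, finrank_span_eq_card hli] at hr
  obtain ⟨e⟩ : Nonempty (Fin n ≃ J) := Fintype.card_eq.1 hr.symm
  refine ⟨a ∘ e, ?_⟩
  have h2 : LinearIndependent κ (M.submatrix id (a ∘ e)).col := hli.comp e e.injective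
  rw [Matrix.linearIndependent_cols_iff_isUnit, Matrix.isUnit_iff_isUnit_det] at h2
  exact h2.ne_zero

variable {A : Type*} [CommRing A]

/-- Linear independence of the rows of a matrix modulo an ideal. -/
def RowIndep (q : Ideal A) {n : ℕ} {ι : Type*} (M : Matrix (Fin n) ι A) : Prop :=
  ∀ c : Fin n → A, (∀ j, ∑ i, c i * M i j ∈ q) → ∀ i, c i ∈ q

lemma RowIndep.exists_det_notMem {q : Ideal A} [q.IsPrime] {n : ℕ} {ι : Type*} [Fintype ι]
    {M : Matrix (Fin n) ι A} (h : RowIndep q M) :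
    ∃ c : Fin n → ι, (M.submatrix id c).det ∉ q := by
  let κ := FractionRing (A ⧸ q)
  let φ : A →+* κ := (algebraMap (A ⧸ q) κ).comp (Ideal.Quotient.mk q)
  have hφ : ∀ x, φ x = 0 ↔ x ∈ q := fun x => by
    rw [← Ideal.Quotient.eq_zero_iff_mem]
    exact map_eq_zero_iff _ (IsFractionRing.injective (A ⧸ q) κ)
  have hli : LinearIndependent κ (M.map φ).row := by
    rw [← LinearIndependent.iff_fractionRing (A ⧸ q) κ, Fintype.linearIndependent_iff]
    intro g hg i
    choose c hc using fun i => Ideal.Quotient.mk_surjective (I := q) (g i)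
    rw [← hc i, Ideal.Quotient.eq_zero_iff_mem]
    refine h c (fun j => ?_) i
    rw [← hφ, map_sum]
    have h2 := congrFun hg j
    rw [Finset.sum_apply] at h2
    rw [← Pi.zero_apply (M := fun _ => κ) j, ← h2]
    refine Finset.sum_congr rfl fun i _ => ?_
    rw [map_mul, Pi.smul_apply, Algebra.smul_def, ← hc i]
    rfl
  obtain ⟨c, hc⟩ := Matrix.exists_det_submatrix_ne_zero _ hli
  refine ⟨c, fun hd => hc ?_⟩
  rw [← hφ, RingHom.map_det] at hd
  exact hd

lemma RowIndep.of_det_notMem {q : Ideal A} [hq : q.IsPrime] {n : ℕ} {ι : Type*}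
    {M : Matrix (Fin n) ι A} (c : Fin n → ι) (h : (M.submatrix id c).det ∉ q) : RowIndep q M := by
  intro v hv i
  have h1 : Matrix.vecMul v (M.submatrix id c) = fun j => ∑ i, v i * M i (c j) := by
    ext j; simp [Matrix.vecMul, dotProduct]
  have h2 := congrArg (fun w => Matrix.vecMul w (M.submatrix id c).adjugate i) h1
  simp only [Matrix.vecMul_vecMul, Matrix.mul_adjugate] at h2
  rw [Matrix.vecMul_smul, Matrix.vecMul_one, Pi.smul_apply, smul_eq_mul] at h2
  refine (hq.mem_or_mem ?_).resolve_left h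
  rw [h2]
  simp only [Matrix.vecMul, dotProduct]
  exact q.sum_mem fun j _ => Ideal.mul_mem_right _ _ (hv (c j))

/-- Jacobian criterion: if the Jacobian rows of `g` are independent modulo `q`, all but
`k - n` of the `k` local generators of `q` are redundant modulo `g`. -/
lemma exists_locally_mem_of_rowIndep {K : Type*} [CommRing K] [Algebra K A] {q : Ideal A}
    [hq : q.IsPrime] {ι : Type*} (D : ι → Derivation K A A) {n k : ℕ} {g : Fin n → A}
    (hg : ∀ i, g i ∈ q) (hind : RowIndep q (fun i j => D j (g i))) {F : Fin k → A}
    (hF : ∀ i, F i ∈ q) (hgen : ∀ a ∈ q, ∃ t, t ∉ q ∧ t * a ∈ Ideal.span (Set.range F)) :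
    ∃ c : Fin n → Fin k, Function.Injective c ∧ ∀ a ∈ q, ∃ t, t ∉ q ∧
      t * a ∈ Ideal.span (Set.range g) ⊔ Ideal.span (F '' (Set.range c)ᶜ) := by
  choose u hu hmem using fun i => hgen (g i) (hg i)
  have hex : ∀ i, ∃ a : Fin k → A, u i * g i = ∑ j, a j * F j := fun i => by
    obtain ⟨a, ha⟩ := Ideal.mem_span_range_iff_exists_fun.1 (hmem i)
    exact ⟨a, ha.symm⟩
  choose a ha using hex
  have hai : RowIndep q (Matrix.of a) := by
    intro v hv i
    refine (hq.mem_or_mem (hind (fun i => v i * u i) (fun l => ?_) i)).resolve_right (hu i)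
    simp only [Matrix.of_apply] at hv
    have h1 : ∀ i, u i * D l (g i) - ∑ j, a i j * D l (F j) ∈ q := by
      intro i
      have h2 := congrArg (D l) (ha i)
      rw [Derivation.leibniz, map_sum] at h2
      simp only [Derivation.leibniz, smul_eq_mul, Finset.sum_add_distrib] at h2
      rw [show u i * D l (g i) - ∑ j, a i j * D l (F j) =
        ∑ j, F j * D l (a i j) - g i * D l (u i) by linear_combination h2]
      exact q.sub_mem (q.sum_mem fun j _ => Ideal.mul_mem_right _ _ (hF j))
        (Ideal.mul_mem_right _ _ (hg i))
    have h3 : ∑ i, v i * u i * D l (g i) = ∑ i, v i * (u i * D l (g i) - ∑ j, a i j * D l (F j))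
        + ∑ j, (∑ i, v i * a i j) * D l (F j) := by
      simp only [Finset.sum_mul, mul_sub, Finset.sum_sub_distrib, Finset.mul_sum]
      rw [Finset.sum_comm (s := Finset.univ (α := Fin k))]
      simp only [mul_assoc]
      ring
    rw [h3]
    exact q.add_mem (q.sum_mem fun i _ => Ideal.mul_mem_left _ _ (h1 i))
      (q.sum_mem fun j _ => Ideal.mul_mem_right _ _ (hv j))
  obtain ⟨c, hc⟩ := hai.exists_det_notMem
  have hcinj : Function.Injective c := by
    intro i j hij
    by_contra hne
    refine hc ?_
    rw [Matrix.det_zero_of_column_eq hne (fun r => by simp [Matrix.submatrix_apply, hij])]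
    exact q.zero_mem
  set I := Ideal.span (Set.range g) ⊔ Ideal.span (F '' (Set.range c)ᶜ) with hI
  have hrow : ∀ i, ∑ l, a i (c l) * F (c l) ∈ I := by
    intro i
    have h1 : ∑ l, a i (c l) * F (c l) = ∑ j ∈ Finset.univ.image c, a i j * F j := by
      rw [Finset.sum_image (fun x _ y _ h => hcinj h)]
    have h2 : ∑ j ∈ Finset.univ.image c, a i j * F j = u i * g i -
        ∑ j ∈ (Finset.univ.image c)ᶜ, a i j * F j := by
      rw [ha, ← Finset.sum_add_sum_compl (Finset.univ.image c)]; ring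
    rw [h1, h2]
    refine I.sub_mem (Ideal.mul_mem_left _ _ (Ideal.mem_sup_left (Ideal.subset_span ⟨i, rfl⟩)))
      (I.sum_mem fun j hj => Ideal.mul_mem_left _ _ (Ideal.mem_sup_right (Ideal.subset_span
        ⟨j, ?_, rfl⟩)))
    simpa using hj
  set B : Matrix (Fin n) (Fin n) A := (Matrix.of a).submatrix id c with hB
  have hall : ∀ j, B.det * F j ∈ I := by
    intro j
    by_cases hj : j ∈ Set.range c
    · obtain ⟨l, rfl⟩ := hj
      have h1 : Matrix.mulVec B (F ∘ c) = fun i => ∑ l, a i (c l) * F (c l) := by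
        ext i; simp [Matrix.mulVec, dotProduct, hB]
      have h2 := congrArg (fun w => Matrix.mulVec B.adjugate w l) h1
      simp only [Matrix.mulVec_mulVec, Matrix.adjugate_mul, Matrix.smul_mulVec,
        Matrix.one_mulVec, Pi.smul_apply, smul_eq_mul, Function.comp] at h2
      rw [h2]
      simp only [Matrix.mulVec, dotProduct]
      exact I.sum_mem fun i _ => Ideal.mul_mem_left _ _ (hrow i)
    · exact Ideal.mul_mem_left _ _ (Ideal.mem_sup_right (Ideal.subset_span ⟨j, hj, rfl⟩))
  refine ⟨c, hcinj, fun x hx => ?_⟩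
  obtain ⟨t, ht, htx⟩ := hgen x hx
  refine ⟨B.det * t, notMem_mul hc ht, ?_⟩
  obtain ⟨b, hb⟩ := Ideal.mem_span_range_iff_exists_fun.1 htx
  rw [mul_assoc, ← hb, Finset.mul_sum]
  refine I.sum_mem fun j _ => ?_
  rw [show B.det * (b j * F j) = b j * (B.det * F j) by ring]
  exact Ideal.mul_mem_left _ _ (hall j)

lemma exists_locally_mem_sup_singleton {K : Type*} [CommRing K] [Algebra K A] [IsRegularRing A]
    {q : Ideal A} [hq : q.IsPrime] {ι : Type*} (D : ι → Derivation K A A) {n : ℕ} {g : Fin n → A}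
    (hg : ∀ i, g i ∈ q) (hind : RowIndep q (fun i j => D j (g i))) (hn : q.height ≤ n + 1) :
    ∃ h ∈ q, ∀ a ∈ q, ∃ t, t ∉ q ∧ t * a ∈ Ideal.span (Set.range g) ⊔ Ideal.span {h} := by
  obtain ⟨F, hF, hgen⟩ := exists_local_generators q (k := n + 1) (by exact_mod_cast hn)
  obtain ⟨c, hc, hmem⟩ := exists_locally_mem_of_rowIndep D hg hind hF hgen
  have hcard : (Finset.univ.image c)ᶜ.card = 1 := by
    rw [Finset.card_compl, Finset.card_image_of_injective _ hc]; simp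
  obtain ⟨j, hj⟩ := Finset.card_eq_one.1 hcard
  refine ⟨F j, hF j, fun a ha => ?_⟩
  obtain ⟨t, ht, h⟩ := hmem a ha
  refine ⟨t, ht, ?_⟩
  have h2 : (Set.range c)ᶜ = {j} := by
    have := congrArg (fun s : Finset (Fin (n + 1)) => (s : Set (Fin (n + 1)))) hj
    simpa using this
  rwa [h2, Set.image_singleton] at h

lemma exists_locally_mem {K : Type*} [CommRing K] [Algebra K A] [IsRegularRing A]
    {q : Ideal A} [hq : q.IsPrime] {ι : Type*} (D : ι → Derivation K A A) {n : ℕ} {g : Fin n → A}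
    (hg : ∀ i, g i ∈ q) (hind : RowIndep q (fun i j => D j (g i))) (hn : q.height ≤ n) :
    ∀ a ∈ q, ∃ t, t ∉ q ∧ t * a ∈ Ideal.span (Set.range g) := by
  obtain ⟨F, hF, hgen⟩ := exists_local_generators q (k := n) (by exact_mod_cast hn)
  obtain ⟨c, hc, hmem⟩ := exists_locally_mem_of_rowIndep D hg hind hF hgen
  intro a ha
  obtain ⟨t, ht, h⟩ := hmem a ha
  refine ⟨t, ht, ?_⟩
  rwa [(Finite.injective_iff_surjective.1 hc).range_eq, Set.compl_univ, Set.image_empty,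
    Ideal.span_empty, sup_bot_eq] at h

end Minors

section Norm

variable {T : Type*} [CommRing T] [IsNoetherianRing T]

/-- In a local Noetherian ring with principal maximal ideal, `a` is a multiple of the
non-zero-divisor `s` as soon as `a / s` is integral in a special form. -/
lemma IsLocalRing.dvd_of_principal [IsLocalRing T] {h : T}
    (hm : IsLocalRing.maximalIdeal T = Ideal.span {h}) {a s f₁ f₂ : T} {m : ℕ}
    (hs : ∀ x, s * x = 0 → x = 0) (hrel : a ^ (m + 1) = s * (f₁ * a ^ m + f₂ * s ^ m)) : s ∣ a := by
  have key : ∀ x : T, x ≠ 0 → ∃ (l : ℕ) (u : T), IsUnit u ∧ x = u * h ^ l := by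
    intro x hx
    have hne : ∃ l, x ∉ Ideal.span {h} ^ l := by
      by_contra! hcon
      refine hx ?_
      have := Ideal.iInf_pow_eq_bot_of_isLocalRing (Ideal.span {h} : Ideal T)
        (by rw [← hm]; exact Ideal.IsPrime.ne_top')
      have h2 : x ∈ ⨅ i, Ideal.span {h} ^ i := by rw [Ideal.mem_iInf]; exact hcon
      rwa [this] at h2
    classical
    have hpos : Nat.find hne ≠ 0 := by
      intro h0
      have := Nat.find_spec hne
      rw [h0] at this
      simp at this
    obtain ⟨l, hl⟩ := Nat.exists_eq_succ_of_ne_zero hpos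
    have h1 : x ∈ Ideal.span {h} ^ l := by
      by_contra hcon
      have := Nat.find_min' hne hcon
      omega
    rw [Ideal.span_singleton_pow, Ideal.mem_span_singleton'] at h1
    obtain ⟨u, hu⟩ := h1
    refine ⟨l, u, ?_, hu.symm⟩
    by_contra hnu
    have h2 : u ∈ Ideal.span {h} := by rw [← hm]; exact hnu
    obtain ⟨v, rfl⟩ := Ideal.mem_span_singleton'.1 h2
    refine Nat.find_spec hne ?_
    rw [hl, Ideal.span_singleton_pow, Ideal.mem_span_singleton']
    exact ⟨v, by rw [← hu, Nat.succ_eq_add_one]; ring⟩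
  by_cases ha : a = 0
  · simp [ha]
  have hs0 : s ≠ 0 := by
    rintro rfl
    exact one_ne_zero (hs 1 (by simp))
  obtain ⟨l, u', hu', rfl⟩ := key a ha
  obtain ⟨k, u, hu, rfl⟩ := key s hs0
  by_cases hkl : k ≤ l
  · obtain ⟨r, rfl⟩ := Nat.exists_eq_add_of_le hkl
    obtain ⟨w, rfl⟩ := hu
    refine ⟨↑w⁻¹ * u' * h ^ r, ?_⟩
    rw [pow_add]
    linear_combination (-(u' * h ^ k * h ^ r)) * w.mul_inv
  exfalso
  obtain ⟨r, rfl⟩ := Nat.exists_eq_add_of_lt (not_le.1 hkl)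
  have hh : h ^ (l * (m + 1)) * (u' ^ (m + 1) - h * (h ^ r * u * (f₁ * u' ^ m + f₂ *
      (u * h ^ (r + 1)) ^ m))) = 0 := by
    have e1 : h ^ (l * (m + 1)) = h ^ l * (h ^ l) ^ m := by rw [← pow_mul, ← pow_add]; ring
    rw [e1]
    rw [show u * h ^ (l + r + 1) = h ^ l * (u * h ^ (r + 1)) by ring] at hrel
    simp only [mul_pow] at hrel ⊢
    linear_combination hrel
  have hunit : IsUnit (u' ^ (m + 1) - h * (h ^ r * u * (f₁ * u' ^ m + f₂ *
      (u * h ^ (r + 1)) ^ m))) := by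
    by_contra hnu
    have h1 : h * (h ^ r * u * (f₁ * u' ^ m + f₂ * (u * h ^ (r + 1)) ^ m)) ∈
        IsLocalRing.maximalIdeal T := by
      rw [hm]; exact Ideal.mul_mem_right _ _ (Ideal.mem_span_singleton_self h)
    have h2 := (IsLocalRing.maximalIdeal T).add_mem
      ((IsLocalRing.mem_maximalIdeal _).2 hnu) h1
    rw [sub_add_cancel] at h2
    exact h2 (hu'.pow _)
  rw [hunit.mul_left_eq_zero] at hh
  have hpow : (u * h ^ (l + r + 1)) ^ (l * (m + 1)) = 0 := by
    rw [mul_pow, ← pow_mul, mul_comm (l + r + 1), pow_mul h, hh, zero_pow (by omega), mul_zero]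
  have hreg : ∀ N : ℕ, (u * h ^ (l + r + 1)) ^ N ≠ 0 := by
    intro N
    induction N with
    | zero => simp
    | succ N ih => rw [pow_succ']; exact fun h => ih (hs _ h)
  exact hreg _ hpow

lemma exists_notMem_mul_mem_span {q : Ideal T} [hq : q.IsPrime] {h : T} (hh : h ∈ q)
    (hgen : ∀ a ∈ q, ∃ t, t ∉ q ∧ t * a ∈ Ideal.span {h}) {a s f₁ f₂ : T} {m : ℕ}
    (hs : ∀ x, s * x = 0 → x = 0) (hrel : a ^ (m + 1) = s * (f₁ * a ^ m + f₂ * s ^ m)) :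
    ∃ t, t ∉ q ∧ t * a ∈ Ideal.span {s} := by
  let L := Localization.AtPrime q
  let φ := algebraMap T L
  have : IsNoetherianRing L := IsLocalization.isNoetherianRing q.primeCompl L inferInstance
  have hm : IsLocalRing.maximalIdeal L = Ideal.span {φ h} := by
    rw [← Localization.AtPrime.map_eq_maximalIdeal]
    refine le_antisymm (Ideal.map_le_iff_le_comap.2 fun a ha => ?_) ?_
    · obtain ⟨t, ht, hta⟩ := hgen a ha
      rw [Ideal.mem_comap, ← Set.image_singleton, ← Ideal.map_span,
        IsLocalization.algebraMap_mem_map_algebraMap_iff q.primeCompl]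
      exact ⟨t, ht, hta⟩
    · rw [Ideal.span_singleton_le_iff_mem]
      exact Ideal.mem_map_of_mem _ hh
  have hs' : ∀ x, φ s * x = 0 → x = 0 := by
    intro x hx
    obtain ⟨⟨y, t⟩, hy⟩ := IsLocalization.surj q.primeCompl x
    have h1 : φ (s * y) = 0 := by
      rw [map_mul]
      change φ s * algebraMap T L y = 0
      rw [← hy, ← mul_assoc, hx, zero_mul]
    rw [IsLocalization.map_eq_zero_iff q.primeCompl] at h1
    obtain ⟨w, hw⟩ := h1
    have h2 : (w : T) * y = 0 := hs _ (by rw [← hw]; ring)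
    have h3 : algebraMap T L y = 0 := by
      rw [IsLocalization.map_eq_zero_iff q.primeCompl]; exact ⟨w, h2⟩
    rw [h3] at hy
    exact (IsLocalization.map_units L t).mul_left_eq_zero.1 hy
  have h4 := IsLocalRing.dvd_of_principal hm (a := φ a) (f₁ := φ f₁) (f₂ := φ f₂) (m := m) hs'
    (by simp only [← map_mul, ← map_add, ← map_pow, hrel])
  have h5 : φ a ∈ (Ideal.span {s}).map φ := by
    rw [Ideal.map_span, Set.image_singleton, Ideal.mem_span_singleton]; exact h4
  obtain ⟨t, ht, h⟩ := (IsLocalization.algebraMap_mem_map_algebraMap_iff q.primeCompl _ _ _).1 h5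
  exact ⟨t, ht, h⟩

end Norm

section Domain

variable {A : Type*} [CommRing A]

lemma RegFam.castSucc {n : ℕ} {g : Fin (n + 1) → A} (h : RegFam g) :
    RegFam (fun i => g (Fin.castSucc i)) := by
  intro k x hx
  have h1 : (fun i => g (Fin.castSucc i)) '' Set.Iio k = g '' Set.Iio (Fin.castSucc k) := by
    ext y
    constructor
    · rintro ⟨i, hi, rfl⟩
      exact ⟨i.castSucc, Fin.castSucc_lt_castSucc_iff.2 hi, rfl⟩
    · rintro ⟨i, hi, rfl⟩
      have h2 : (i : ℕ) < k := hi
      exact ⟨⟨i, by omega⟩, h2, rfl⟩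
  rw [h1] at hx ⊢
  exact h _ x hx

lemma ofList_ofFn {n : ℕ} (g : Fin n → A) :
    Ideal.ofList (List.ofFn g) = Ideal.span (Set.range g) := by
  rw [Ideal.ofList]
  congr 1
  ext x
  simp [List.mem_ofFn]

lemma RegFam.locReg {q : Ideal A} [hq : q.IsPrime] {n : ℕ} {g : Fin n → A} (h : RegFam g) :
    LocReg q ⊥ (List.ofFn g) := by
  induction n with
  | zero => simp [LocReg]
  | succ n ih =>
    rw [List.ofFn_succ', List.concat_eq_append, LocReg.append_iff]
    refine ⟨ih h.castSucc, fun x hx => ⟨1, fun h1 => hq.ne_top ((Ideal.eq_top_iff_one _).2 h1), ?_⟩,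
      trivial⟩
    have h1 : (⊥ : Ideal A) ⊔ Ideal.ofList (List.ofFn fun i => g (Fin.castSucc i)) =
        Ideal.span (g '' Set.Iio (Fin.last n)) := by
      rw [bot_sup_eq, ofList_ofFn]
      congr 1
      ext y
      constructor
      · rintro ⟨i, rfl⟩
        exact ⟨i.castSucc, Fin.castSucc_lt_last i, rfl⟩
      · rintro ⟨i, hi, rfl⟩
        have h2 : (i : ℕ) < n := hi
        exact ⟨⟨i, h2⟩, rfl⟩
    rw [h1] at hx ⊢
    rw [one_mul]
    exact h _ _ hx

/-- A weak form of normality of `A ⧸ J`. -/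
def NormIdeal (J : Ideal A) : Prop := ∀ (s a f₁ f₂ : A) (m : ℕ), (∀ x, s * x ∈ J → x ∈ J) →
  a ^ (m + 1) - s * (f₁ * a ^ m + f₂ * s ^ m) ∈ J → a ∈ J ⊔ Ideal.span {s}

/-- Serre's criterion for complete intersections, in the form needed here. -/
theorem normIdeal_of_rowIndep (hA : HasDepth A) [IsRegularRing A] {K : Type*} [CommRing K]
    [Algebra K A] {ι : Type*} (D : ι → Derivation K A A) {n : ℕ} {g : Fin n → A} (hreg : RegFam g)
    (hJ : ∀ q : Ideal A, q.IsPrime → (∀ i, g i ∈ q) → q.height ≤ n + 1 →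
      RowIndep q (fun i j => D j (g i))) : NormIdeal (Ideal.span (Set.range g)) := by
  intro s a f₁ f₂ m hs hrel
  set J := Ideal.span (Set.range g) with hJdef
  by_contra ha
  have hne : (Ideal.Quotient.mk (J ⊔ Ideal.span {s}) a) ≠ 0 := by
    rwa [Ne, Ideal.Quotient.eq_zero_iff_mem]
  obtain ⟨q, hqass, hle⟩ := exists_le_isAssociatedPrime_of_isNoetherianRing A _ hne
  have hq := hqass.isPrime
  have hI : J ⊔ Ideal.span {s} ≤ q := by
    intro x hx
    refine hle ?_
    rw [Submodule.mem_colon_singleton, Submodule.mem_bot, Algebra.smul_def,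
      Ideal.Quotient.algebraMap_eq, Ideal.Quotient.eq_zero_iff_mem.2 hx, zero_mul]
  have hgq : ∀ i, g i ∈ q := fun i =>
    hI (Ideal.mem_sup_left (Ideal.subset_span ⟨i, rfl⟩))
  have hlist : J ⊔ Ideal.span {s} = Ideal.ofList (List.ofFn g ++ [s]) := by
    rw [Ideal.ofList_append, ofList_ofFn, Ideal.ofList_singleton]
  have hloc : LocReg q ⊥ (List.ofFn g ++ [s]) := by
    rw [LocReg.append_iff]
    refine ⟨hreg.locReg, fun x hx => ⟨1, fun h1 => hq.ne_top ((Ideal.eq_top_iff_one _).2 h1), ?_⟩,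
      trivial⟩
    rw [bot_sup_eq, ofList_ofFn] at hx ⊢
    rw [one_mul]
    exact hs x hx
  have hht : q.height ≤ (List.ofFn g ++ [s]).length := by
    refine hA.height_le hloc (fun b hb => hI ?_) ?_
    · rw [hlist]; exact Ideal.subset_span hb
    · rw [← hlist]; exact locAss_of_mem_associatedPrimes hqass
  obtain ⟨h, hh, hgen⟩ := exists_locally_mem_sup_singleton D hgq
    (hJ q hq hgq (by simpa using hht)) (by simpa using hht)
  -- pass to the quotient by `J`
  have hJq : J ≤ q := le_sup_left.trans hI
  let π := Ideal.Quotient.mk J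
  have hπ : Function.Surjective π := Ideal.Quotient.mk_surjective
  have hker : RingHom.ker π ≤ q := by rw [Ideal.mk_ker]; exact hJq
  have hq' : (q.map π).IsPrime := Ideal.map_isPrime_of_surjective hπ hker
  have hmem : ∀ x, π x ∈ q.map π ↔ x ∈ q := fun x => by
    rw [← Ideal.mem_comap, Ideal.comap_map_of_surjective' _ hπ, sup_eq_left.2 hker]
  obtain ⟨t, ht, hta⟩ := exists_notMem_mul_mem_span (q := q.map π) (h := π h) (a := π a) (s := π s)
    (f₁ := π f₁) (f₂ := π f₂) (m := m) ((hmem h).2 hh) (fun b hb => by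
      obtain ⟨b, rfl⟩ := hπ b
      obtain ⟨t, ht, htb⟩ := hgen b ((hmem b).1 hb)
      refine ⟨π t, mt (hmem t).1 ht, ?_⟩
      have := Ideal.mem_map_of_mem π htb
      rwa [Ideal.map_sup, Ideal.map_quotient_self, bot_sup_eq, Ideal.map_span,
        Set.image_singleton, map_mul] at this)
    (fun x hx => by
      obtain ⟨x, rfl⟩ := hπ x
      rw [← map_mul, Ideal.Quotient.eq_zero_iff_mem] at hx
      exact Ideal.Quotient.eq_zero_iff_mem.2 (hs x hx))
    (by
      rw [← sub_eq_zero]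
      simp only [← map_mul, ← map_add, ← map_pow, ← map_sub]
      exact Ideal.Quotient.eq_zero_iff_mem.2 hrel)
  obtain ⟨t, rfl⟩ := hπ t
  obtain ⟨r, hr⟩ := Ideal.mem_span_singleton'.1 hta
  obtain ⟨r, rfl⟩ := hπ r
  refine mt (hmem t).2 ht (hle ?_)
  rw [Submodule.mem_colon_singleton, Submodule.mem_bot, Algebra.smul_def,
    Ideal.Quotient.algebraMap_eq, ← map_mul, Ideal.Quotient.eq_zero_iff_mem]
  rw [← map_mul, ← map_mul, ← sub_eq_zero, ← map_sub, Ideal.Quotient.eq_zero_iff_mem] at hr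
  rw [show t * a = r * s - (r * s - t * a) by ring]
  exact Ideal.sub_mem _ (Ideal.mem_sup_right (Ideal.mul_mem_left _ _
    (Ideal.mem_span_singleton_self s))) (Ideal.mem_sup_left hr)

theorem isPrime_of_normIdeal [IsNoetherianRing A] {J : Ideal A} (hnorm : NormIdeal J) (hne : J ≠ ⊤)
    (hass : ∀ p ∈ associatedPrimes A (A ⧸ J), ∀ a ∈ p, ∃ t, t ∉ p ∧ t * a ∈ J)
    (hidem : ∀ t, t ^ 2 - t ∈ J → t ∈ J ∨ 1 - t ∈ J) : J.IsPrime := by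
  refine ⟨hne, fun {a b} hab => ?_⟩
  by_contra! hcon
  obtain ⟨ha, hb⟩ := hcon
  let K₁ : Ideal A := J.colon {a}
  let K₂ : Ideal A := J.colon K₁
  have hK₁ : ∀ x, x ∈ K₁ ↔ x * a ∈ J := fun x => Submodule.mem_colon_singleton
  have hK₂ : ∀ y, y ∈ K₂ ↔ ∀ x ∈ K₁, y * x ∈ J := fun y => Submodule.mem_colon
  have hL : ¬ ((K₁ ⊔ K₂ : Ideal A) : Set A) ⊆ ⋃ p ∈ associatedPrimes A (A ⧸ J), (p : Set A) := by
    intro hsub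
    have hfin := associatedPrimes.finite A (A ⧸ J)
    rw [Ideal.subset_union_prime_finite hfin ⊥ ⊥ (fun p hp _ _ => hp.isPrime)] at hsub
    obtain ⟨p, hp, hle⟩ := hsub
    have hap : a ∈ p := hle (Ideal.mem_sup_right ((hK₂ a).2 fun x hx => by
      rw [mul_comm]; exact (hK₁ x).1 hx))
    obtain ⟨t, ht, hta⟩ := hass p hp a hap
    exact ht (hle (Ideal.mem_sup_left ((hK₁ t).2 hta)))
  rw [biUnion_associatedPrimes_eq_compl_regular, Set.not_subset] at hL
  obtain ⟨s, hsL, hs⟩ := hL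
  rw [Set.mem_compl_iff, not_not] at hs
  have hs : ∀ x, s * x ∈ J → x ∈ J := by
    intro x hx
    rw [← Ideal.Quotient.eq_zero_iff_mem] at hx ⊢
    refine hs ?_
    simp only [Algebra.smul_def, Ideal.Quotient.algebraMap_eq, ← map_mul, hx, mul_zero]
  obtain ⟨u, hu, v, hv, rfl⟩ := Submodule.mem_sup.1 hsL
  have huv : v * u ∈ J := (hK₂ v).1 hv u hu
  obtain ⟨j, hj, w, hw, hjw⟩ := Submodule.mem_sup.1 (hnorm (u + v) u 1 0 1 hs (by
    rw [show u ^ (1 + 1) - (u + v) * (1 * u ^ 1 + 0 * (u + v) ^ 1) = -(v * u) by ring]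
    exact J.neg_mem huv))
  obtain ⟨t, rfl⟩ := Ideal.mem_span_singleton'.1 hw
  have ht : t ^ 2 - t ∈ J := by
    refine hs _ (hs _ ?_)
    rw [show (u + v) * ((u + v) * (t ^ 2 - t)) = -(v * u) + j * (j - 2 * u) + j * (u + v) by
      linear_combination (t * (u + v) + (u - j) - (u + v)) * hjw]
    exact J.add_mem (J.add_mem (J.neg_mem huv) (J.mul_mem_right _ hj)) (J.mul_mem_right _ hj)
  rcases hidem t ht with h | h
  · have huJ : u ∈ J := by rw [← hjw]; exact J.add_mem hj (J.mul_mem_right _ h)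
    refine hb (hs b ?_)
    rw [add_mul]
    exact J.add_mem (J.mul_mem_right _ huJ) ((hK₂ v).1 hv b ((hK₁ b).2 (by rwa [mul_comm])))
  · have hvJ : v ∈ J := by
      rw [show v = (1 - t) * (u + v) - j by linear_combination hjw]
      exact J.sub_mem (J.mul_mem_right _ h) hj
    refine ha (hs a ?_)
    rw [add_mul]
    exact J.add_mem ((hK₁ u).1 hu) (J.mul_mem_right _ hvJ)

lemma mem_associatedPrimes_height_le [IsNoetherianRing A] (hA : HasDepth A) {n : ℕ} {g : Fin n → A}
    (hreg : RegFam g)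
    {p : Ideal A} (hp : p ∈ associatedPrimes A (A ⧸ Ideal.span (Set.range g))) :
    (∀ i, g i ∈ p) ∧ p.height ≤ n := by
  have hpp := hp.isPrime
  have hloc := hreg.locReg (q := p)
  have hle := ofList_le_of_mem_associatedPrimes hp
  have hg : ∀ i, g i ∈ p := fun i => hle (Ideal.subset_span ⟨i, rfl⟩)
  refine ⟨hg, ?_⟩
  have := hA.height_le hloc (fun a ha => by
    obtain ⟨i, rfl⟩ := (List.mem_ofFn' _ _).1 ha
    exact hg i) (by rw [ofList_ofFn]; exact locAss_of_mem_associatedPrimes hp)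
  simpa using this

end Domain

section WeightedIdeals

variable {K : Type*} [Field K] {N : ℕ} (w : Fin N → ℕ)

/-- Weighted homogeneous ideals of a polynomial ring. -/
def WHom (J : Ideal (MvPolynomial (Fin N) K)) : Prop :=
  ∀ p ∈ J, ∀ i, weightedHomogeneousComponent w i p ∈ J

section
attribute [local instance] MvPolynomial.weightedGradedAlgebra

lemma wHom_iff {J : Ideal (MvPolynomial (Fin N) K)} :
    WHom w J ↔ J.IsHomogeneous (weightedHomogeneousSubmodule K w) := by
  have key : ∀ p i, ((DirectSum.decompose (weightedHomogeneousSubmodule K w) p) i :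
      MvPolynomial (Fin N) K) = weightedHomogeneousComponent w i p := fun p i =>
    weightedDecomposition.decompose'_apply K w p i
  constructor
  · intro h i p hp
    rw [key]
    exact h p hp i
  · intro h p hp i
    rw [← key]
    exact h i hp

lemma WHom.span {S : Set (MvPolynomial (Fin N) K)}
    (hS : ∀ p ∈ S, ∃ n, IsWeightedHomogeneous w p n) : WHom w (Ideal.span S) := by
  rw [wHom_iff]
  exact Ideal.homogeneous_span _ _ fun p hp => hS p hp

lemma exists_wHom_core (P : Ideal (MvPolynomial (Fin N) K)) [hP : P.IsPrime] :
    ∃ P₀ : Ideal (MvPolynomial (Fin N) K), P₀.IsPrime ∧ WHom w P₀ ∧ P₀ ≤ P ∧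
      ∀ p ∈ P, ∀ n, IsWeightedHomogeneous w p n → p ∈ P₀ := by
  refine ⟨(P.homogeneousCore (weightedHomogeneousSubmodule K w)).toIdeal, hP.homogeneousCore, ?_,
    Ideal.toIdeal_homogeneousCore_le _ _, fun p hp n hn => ?_⟩
  · rw [wHom_iff]
    exact HomogeneousIdeal.isHomogeneous _
  · exact Ideal.mem_homogeneousCore_of_homogeneous_of_mem ⟨n, hn⟩ hp

end

variable {w}

lemma WHom.le_core {J P₀ P : Ideal (MvPolynomial (Fin N) K)} (hJ : WHom w J) (hle : J ≤ P)
    (h : ∀ p ∈ P, ∀ n, IsWeightedHomogeneous w p n → p ∈ P₀) : J ≤ P₀ := by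
  intro p hp
  rw [← sum_weightedHomogeneousComponent w p]
  exact finsum_induction (p := fun x => x ∈ P₀) P₀.zero_mem (fun _ _ => P₀.add_mem)
    fun i => h _ (hle (hJ p hp i)) i (weightedHomogeneousComponent_isWeightedHomogeneous i p)

/-- Minimal primes of weighted homogeneous ideals are weighted homogeneous. -/
lemma WHom.of_mem_minimalPrimes {J P : Ideal (MvPolynomial (Fin N) K)} (hJ : WHom w J)
    (hP : P ∈ J.minimalPrimes) : WHom w P := by
  have := hP.1.1
  obtain ⟨P₀, h1, h2, h3, h4⟩ := exists_wHom_core w P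
  have := hP.2 ⟨h1, hJ.le_core hP.1.2 h4⟩ h3
  rwa [le_antisymm this h3]

lemma WHom.C_notMem {J : Ideal (MvPolynomial (Fin N) K)} (hne : J ≠ ⊤) {c : K}
    (h : C c ∈ J) : c = 0 := by
  by_contra hc
  refine hne ((Ideal.eq_top_iff_one _).2 ?_)
  have := J.mul_mem_left (C c⁻¹) h
  rwa [← C_mul, inv_mul_cancel₀ hc, C_1] at this

lemma WHom.constantCoeff_eq_zero {J : Ideal (MvPolynomial (Fin N) K)} (hJ : WHom w J)
    (hw : ∀ i, 0 < w i) (hne : J ≠ ⊤) {p : MvPolynomial (Fin N) K} (hp : p ∈ J) :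
    constantCoeff p = 0 := by
  refine WHom.C_notMem hne ?_
  have := hJ p hp 0
  rwa [weightedHomogeneousComponent_zero _ fun i => (hw i).ne'] at this

lemma WHom.mem_of_constantCoeff_eq_zero {J : Ideal (MvPolynomial (Fin N) K)} (hJ : WHom w J)
    (hw : ∀ i, 0 < w i) {t : MvPolynomial (Fin N) K} (ht : t ^ 2 - t ∈ J)
    (h0 : constantCoeff t = 0) : t ∈ J := by
  have key : ∀ i, weightedHomogeneousComponent w i t ∈ J := by
    intro i
    induction i using Nat.strong_induction_on with
    | _ i ih =>
    rcases Nat.eq_zero_or_pos i with rfl | hi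
    · rw [weightedHomogeneousComponent_zero _ fun i => (hw i).ne']
      change C (constantCoeff t) ∈ J
      rw [h0, C_0]
      exact J.zero_mem
    set u := ∑ j ∈ Finset.range i, weightedHomogeneousComponent w j t with hu
    have huJ : u ∈ J := J.sum_mem fun j hj => ih j (Finset.mem_range.1 hj)
    have hv : (t - u) ^ 2 - (t - u) ∈ J := by
      rw [show (t - u) ^ 2 - (t - u) = (t ^ 2 - t) + u * (u - 2 * t + 1) by ring]
      exact J.add_mem ht (J.mul_mem_right _ huJ)
    have hcoeff : ∀ d, coeff d (t - u) = if Finsupp.weight w d < i then 0 else coeff d t := by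
      intro d
      rw [coeff_sub, hu, coeff_sum]
      simp only [coeff_weightedHomogeneousComponent]
      rw [Finset.sum_ite_eq]
      simp only [Finset.mem_range]
      split_ifs <;> simp
    have h1 := hJ _ hv i
    have h2 : weightedHomogeneousComponent w i ((t - u) ^ 2 - (t - u)) =
        - weightedHomogeneousComponent w i t := by
      ext d
      rw [coeff_neg, coeff_weightedHomogeneousComponent, coeff_weightedHomogeneousComponent]
      split_ifs with hd
      · rw [coeff_sub, hcoeff d, if_neg (by omega), pow_two, coeff_mul, Finset.sum_eq_zero,
          zero_sub]
        rintro ⟨a, b⟩ hab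
        rw [Finset.HasAntidiagonal.mem_antidiagonal] at hab
        have h3 : Finsupp.weight w a + Finsupp.weight w b = i := by rw [← map_add, hab, hd]
        simp only [hcoeff]
        by_cases hA : Finsupp.weight w a < i
        · rw [if_pos hA, zero_mul]
        · have hb : Finsupp.weight w b < i := by omega
          rw [if_pos hb, mul_zero]
      · simp
    rw [h2] at h1
    simpa using J.neg_mem h1
  rw [← sum_weightedHomogeneousComponent w t]
  exact finsum_induction (p := fun x => x ∈ J) J.zero_mem (fun _ _ => J.add_mem) key

lemma WHom.mem_or_mem_of_sq_sub_mem {J : Ideal (MvPolynomial (Fin N) K)} (hJ : WHom w J)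
    (hw : ∀ i, 0 < w i) (hne : J ≠ ⊤) (t : MvPolynomial (Fin N) K) (ht : t ^ 2 - t ∈ J) :
    t ∈ J ∨ 1 - t ∈ J := by
  have h1 := hJ.constantCoeff_eq_zero hw hne ht
  rw [map_sub, map_pow, pow_two, ← mul_sub_one, mul_eq_zero, sub_eq_zero] at h1
  rcases h1 with h | h
  · exact Or.inl (hJ.mem_of_constantCoeff_eq_zero hw ht h)
  · refine Or.inr (hJ.mem_of_constantCoeff_eq_zero hw ?_ (by simp [h]))
    rwa [show (1 - t) ^ 2 - (1 - t) = t ^ 2 - t by ring]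

end WeightedIdeals

section LemmaE

variable {K R : Type*} [Field K] [Infinite K] [CommRing R] [Algebra K R]

lemma exists_mem_forall_notMem (V : Submodule K R) (s : Set (Ideal R)) (hs : s.Finite)
    (h : ∀ p ∈ s, ¬ (V : Set R) ⊆ p) : ∃ v ∈ V, ∀ p ∈ s, v ∉ p := by
  by_contra! hcon
  have := hs.to_subtype
  obtain ⟨⟨p, hp⟩, htop⟩ := Subspace.exists_eq_top_of_iUnion_eq_univ (k := K) (E := V)
    (p := fun p : s => (p.1.restrictScalars K).comap V.subtype) (by
      rw [Set.eq_univ_iff_forall]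
      rintro ⟨v, hv⟩
      obtain ⟨p, hp, hvp⟩ := hcon v hv
      exact Set.mem_iUnion.2 ⟨⟨p, hp⟩, hvp⟩)
  refine h p hp fun v hv => ?_
  have : (⟨v, hv⟩ : V) ∈ (p.restrictScalars K).comap V.subtype := by
    have h2 : (p.restrictScalars K).comap V.subtype = ⊤ := htop
    rw [h2]; trivial
  exact this

variable [IsNoetherianRing R]

/-- A minimal prime over an ideal spanned by a `K`-subspace `V` is minimal over few elements
of `V`. -/
lemma exists_finset_minimalPrimes (V : Submodule K R) {P : Ideal R}
    (hP : P ∈ (Ideal.span (V : Set R)).minimalPrimes) {k : ℕ} (hk : P.height ≤ k) :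
    ∃ h : Finset R, h.card ≤ k ∧ (h : Set R) ⊆ V ∧
      P ∈ (Ideal.span (h : Set R)).minimalPrimes := by
  classical
  have hPp : P.IsPrime := hP.1.1
  have hVP : ∀ v ∈ V, v ∈ P := fun v hv => hP.1.2 (Ideal.subset_span hv)
  have key : ∀ r : ℕ, ∃ h : Finset R, h.card ≤ r ∧ (h : Set R) ⊆ V ∧
      (P ∈ (Ideal.span (h : Set R)).minimalPrimes ∨
        ∀ p ∈ (Ideal.span (h : Set R)).minimalPrimes, p ≤ P → (r : ℕ∞) ≤ p.height) := by
    intro r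
    induction r with
    | zero => exact ⟨∅, by simp, by simp, Or.inr fun p _ _ => by simp⟩
    | succ r ih =>
      obtain ⟨h, hcard, hV, hor⟩ := ih
      rcases hor with hmin | hht
      · exact ⟨h, by omega, hV, Or.inl hmin⟩
      by_cases hmin : P ∈ (Ideal.span (h : Set R)).minimalPrimes
      · exact ⟨h, by omega, hV, Or.inl hmin⟩
      obtain ⟨v, hvV, hv⟩ := exists_mem_forall_notMem V
        {p | p ∈ (Ideal.span (h : Set R)).minimalPrimes ∧ p ≤ P}
        ((Ideal.finite_minimalPrimes_of_isNoetherianRing R _).subset fun p hp => hp.1)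
        (by
          rintro p ⟨hp, hpP⟩ hsub
          have := hP.2 ⟨hp.1.1, Ideal.span_le.2 hsub⟩ hpP
          rw [le_antisymm hpP this] at hp
          exact hmin hp)
      refine ⟨insert v h, (Finset.card_insert_le _ _).trans (by omega), ?_,
        Or.inr fun q hq hqP => ?_⟩
      · rw [Finset.coe_insert]; exact Set.insert_subset hvV hV
      · have hqp : q.IsPrime := hq.1.1
        have hle : Ideal.span (h : Set R) ≤ q := (Ideal.span_mono (by simp)).trans hq.1.2
        obtain ⟨p, hp, hpq⟩ := Ideal.exists_minimalPrimes_le hle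
        have hpp : p.IsPrime := hp.1.1
        have hvq : v ∈ q := hq.1.2 (Ideal.subset_span (by simp))
        have hlt : p < q := lt_of_le_of_ne hpq fun e => hv p ⟨hp, hpq.trans hqP⟩ (e ▸ hvq)
        have h1 := Ideal.height_add_one_le_of_lt_of_isPrime hlt
        push_cast
        exact (add_le_add (hht p hp (hpq.trans hqP)) le_rfl).trans h1
  obtain ⟨h, hcard, hV, hor⟩ := key k
  refine ⟨h, hcard, hV, ?_⟩
  rcases hor with hmin | hht
  · exact hmin
  obtain ⟨p, hp, hpP⟩ := Ideal.exists_minimalPrimes_le (J := P)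
    (Ideal.span_le.2 fun v hv => hVP v (hV hv))
  have hpp : p.IsPrime := hp.1.1
  have h2 : p = P := by
    have : p.FiniteHeight := ⟨Or.inr (Ideal.height_ne_top_of_isPrime)⟩
    exact Ideal.eq_of_le_of_height_le p hpP (hk.trans (hht p hp hpP))
  rwa [← h2]

end LemmaE

section Nice

variable {K : Type*} [Field K] {N : ℕ}

/-- Homogeneous families generating prime ideals with the weak normality property. -/
structure Nice {n : ℕ} (g : Fin n → MvPolynomial (Fin N) K) (dg : Fin n → ℕ) : Prop where
  hom : ∀ i, (g i).IsHomogeneous (dg i)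
  pos : ∀ i, 0 < dg i
  reg : RegFam g
  prime : (Ideal.span (Set.range g)).IsPrime
  norm : NormIdeal (Ideal.span (Set.range g))

section
attribute [local instance] MvPolynomial.weightedGradedAlgebra

lemma Nice.exists_freeData {n : ℕ} {g : Fin n → MvPolynomial (Fin N) K} {dg : Fin n → ℕ}
    (h : Nice g dg) :
    Nonempty (FreeData (weightedHomogeneousSubmodule K (1 : Fin N → ℕ)) g) :=
  _root_.exists_freeData _ h.hom h.pos h.reg

lemma Nice.isPrime_map [IsAlgClosed K] {n : ℕ} {g : Fin n → MvPolynomial (Fin N) K}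
    {dg : Fin n → ℕ} (h : Nice g dg) (Q : Ideal (MvPolynomial (Fin n) K)) (hQ : Q.IsPrime) :
    (Q.map (aeval g : MvPolynomial (Fin n) K →ₐ[K] MvPolynomial (Fin N) K)).IsPrime := by
  obtain ⟨F⟩ := h.exists_freeData
  exact F.isPrime_map h.hom h.pos h.prime Q hQ

end

lemma Nice.wHom {n : ℕ} {g : Fin n → MvPolynomial (Fin N) K} {dg : Fin n → ℕ}
    (h : Nice g dg) : WHom 1 (Ideal.span (Set.range g)) := by
  refine WHom.span _ ?_
  rintro _ ⟨i, rfl⟩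
  exact ⟨dg i, h.hom i⟩

/-- If `P` is minimal over an ideal generated by elements of `K[g]`, it is extended from `K[g]`. -/
lemma Nice.eq_map_of_minimalPrimes [IsAlgClosed K] {n : ℕ} {g : Fin n → MvPolynomial (Fin N) K}
    {dg : Fin n → ℕ} (hg : Nice g dg) {S : Set (MvPolynomial (Fin N) K)}
    (hS : S ⊆ Algebra.adjoin K (Set.range g)) {P : Ideal (MvPolynomial (Fin N) K)}
    (hP : P ∈ (Ideal.span S).minimalPrimes) :
    P = (P.comap (aeval g : MvPolynomial (Fin n) K →ₐ[K] MvPolynomial (Fin N) K)).map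
      (aeval g : MvPolynomial (Fin n) K →ₐ[K] MvPolynomial (Fin N) K) := by
  have hPp := hP.1.1
  have h1 := hg.isPrime_map (P.comap (aeval g : MvPolynomial (Fin n) K →ₐ[K] _))
    (Ideal.comap_isPrime _ _)
  refine le_antisymm (hP.2 ⟨h1, Ideal.span_le.2 fun s hs => ?_⟩ Ideal.map_comap_le)
    Ideal.map_comap_le
  have h2 := hS hs
  rw [Algebra.adjoin_range_eq_range_aeval] at h2
  obtain ⟨p, rfl⟩ := h2
  exact Ideal.mem_map_of_mem _ (hP.1.2 (Ideal.subset_span hs))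

/-- Homogeneous proper ideals meet `K[g]` in the irrelevant ideal. -/
lemma Nice.map_comap_le {n : ℕ} {g : Fin n → MvPolynomial (Fin N) K} {dg : Fin n → ℕ}
    (hg : Nice g dg) {P : Ideal (MvPolynomial (Fin N) K)} (hP : WHom 1 P) (hne : P ≠ ⊤) :
    (P.comap (aeval g : MvPolynomial (Fin n) K →ₐ[K] MvPolynomial (Fin N) K)).map
      (aeval g : MvPolynomial (Fin n) K →ₐ[K] MvPolynomial (Fin N) K) ≤
      Ideal.span (Set.range g) := by
  rw [span_range_eq_map (K := K)]
  refine Ideal.map_mono fun p hp => ?_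
  have h1 := hP.constantCoeff_eq_zero (fun _ => Nat.one_pos) hne hp
  have h2 : constantCoeff (aeval g p) = constantCoeff p := by
    have : (constantCoeff.comp (aeval g : MvPolynomial (Fin n) K →ₐ[K] _).toRingHom) =
        (constantCoeff : MvPolynomial (Fin n) K →+* K) := by
      refine MvPolynomial.ringHom_ext (fun c => by simp) fun i => ?_
      have h3 : coeff 0 (g i) = 0 := by
        by_contra hc
        have h4 := hg.hom i hc
        have h5 := hg.pos i
        simp at h4
        omega
      simpa [constantCoeff_eq] using h3
    exact congrArg (fun φ : MvPolynomial (Fin n) K →+* K => φ p) this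
  change constantCoeff (aeval g p) = 0 at h1
  rw [h2] at h1
  rw [← Set.image_univ, mem_ideal_span_X_image]
  intro m hm
  by_contra! hcon
  have : m = 0 := by ext i; exact hcon i trivial
  rw [this, mem_support_iff] at hm
  exact hm h1

/-- Families of at most `k` forms of degree `e` lie in algebras generated by at most `M` nice
forms. -/
def NiceCover (K : Type*) [Field K] (N e k M : ℕ) : Prop :=
  ∀ h : Finset (MvPolynomial (Fin N) K), h.card ≤ k → (∀ p ∈ h, p.IsHomogeneous e) →
    ∃ (n : ℕ) (g : Fin n → MvPolynomial (Fin N) K) (dg : Fin n → ℕ), n ≤ M ∧ Nice g dg ∧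
      (∀ i, dg i ≤ e) ∧ (h : Set (MvPolynomial (Fin N) K)) ⊆ Algebra.adjoin K (Set.range g)

lemma NiceCover.exists_pderiv_mem [IsAlgClosed K] {e k M : ℕ} (hc : NiceCover K N e k M)
    {f : MvPolynomial (Fin N) K} (hf : f.IsHomogeneous (e + 1))
    {P : Ideal (MvPolynomial (Fin N) K)} [hP : P.IsPrime] (hk : P.height ≤ k)
    (hfP : ∀ j, pderiv j f ∈ P) :
    ∃ (n : ℕ) (g : Fin n → MvPolynomial (Fin N) K) (dg : Fin n → ℕ), n ≤ M ∧ Nice g dg ∧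
      (∀ i, dg i ≤ e) ∧ ∀ j, pderiv j f ∈ Ideal.span (Set.range g) := by
  have hfe : ∀ j, (pderiv j f).IsHomogeneous e := fun j => hf.pderiv
  obtain ⟨P₁, hP₁, -, hle, hmem⟩ := exists_wHom_core 1 P
  let V : Submodule K (MvPolynomial (Fin N) K) :=
    Submodule.span K (Set.range fun j => pderiv j f)
  have hVe : ∀ v ∈ V, IsHomogeneous v e := by
    intro v hv
    have : V ≤ homogeneousSubmodule (Fin N) K e := by
      rw [Submodule.span_le]
      rintro _ ⟨j, rfl⟩
      exact hfe j
    exact this hv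
  have hVP : Ideal.span (V : Set (MvPolynomial (Fin N) K)) ≤ P₁ := by
    rw [Ideal.span_le]
    have : V ≤ P₁.restrictScalars K := by
      rw [Submodule.span_le]
      rintro _ ⟨j, rfl⟩
      exact hmem _ (hfP j) e (hfe j)
    exact this
  obtain ⟨P₀, hP₀, hP₀₁⟩ := Ideal.exists_minimalPrimes_le hVP
  have hP₀p := hP₀.1.1
  obtain ⟨h, hcard, hhV, hmin⟩ := exists_finset_minimalPrimes V hP₀
    ((Ideal.height_mono (hP₀₁.trans hle)).trans hk)
  obtain ⟨n, g, dg, hn, hg, hdg, hh⟩ := hc h hcard fun p hp => hVe p (hhV hp)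
  refine ⟨n, g, dg, hn, hg, hdg, fun j => ?_⟩
  have hw : WHom 1 P₀ := WHom.of_mem_minimalPrimes
    (WHom.span 1 (S := (V : Set (MvPolynomial (Fin N) K))) fun p hp => ⟨e, hVe p hp⟩) hP₀
  have h1 := hg.map_comap_le hw hP₀p.ne_top
  rw [← hg.eq_map_of_minimalPrimes hh hmin] at h1
  exact h1 (hP₀.1.2 (Ideal.subset_span (Submodule.subset_span ⟨j, rfl⟩)))

end Nice

namespace Polynomial

lemma aeval_X_pow_sub_C_self {E : Type*} [Field E] (p : ℕ)
    (M : Subfield E) (hM : ∀ x : E, x ^ p ∈ M) (z : E) :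
    aeval z (X ^ p - C (⟨z ^ p, hM z⟩ : M)) = 0 := by
  rw [map_sub, map_pow, aeval_X, aeval_C]
  exact sub_self _

lemma isIntegral_of_pow_mem {E : Type*} [Field E] (p : ℕ) (hp : 0 < p)
    (M : Subfield E) (hM : ∀ x : E, x ^ p ∈ M) (z : E) : IsIntegral M z :=
  IsIntegral.of_pow hp (isIntegral_algebraMap (A := E) (x := (⟨z ^ p, hM z⟩ : M)))

lemma minpoly_eq_X_pow_sub_C {E : Type*} [Field E] (p : ℕ) [hp : Fact p.Prime] [CharP E p]
    (M : Subfield E) (hM : ∀ x : E, x ^ p ∈ M) {z : E} (hz : z ∉ M) :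
    minpoly M z = X ^ p - C ⟨z ^ p, hM z⟩ := by
  symm
  apply minpoly.eq_of_irreducible_of_monic
  · apply X_pow_sub_C_irreducible_of_prime hp.out
    intro b hb
    apply hz
    have h : (b : E) ^ p = z ^ p := by simpa using congrArg Subtype.val hb
    have := frobenius_inj E p h
    exact this ▸ b.2
  · exact aeval_X_pow_sub_C_self p M hM z
  · exact monic_X_pow_sub_C _ hp.out.ne_zero

/-- A non-`p`-th power of a field of characteristic `p` admits a derivation not killing it. -/
lemma exists_derivation_eq_one {E : Type*} [Field E] (p : ℕ) [hp : Fact p.Prime] [CharP E p]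
    {f : E} (hf : ∀ t, t ^ p ≠ f) : ∃ D : Derivation ℤ E E, D f = 1 := by
  obtain ⟨M, hSM, hMmax⟩ := zorn_le_nonempty₀ {M : Subfield E | (∀ x : E, x ^ p ∈ M) ∧ f ∉ M}
    (fun c hc hchain y hy => by
      refine ⟨sSup c, ⟨fun x => ?_, ?_⟩, fun z hz => le_sSup hz⟩
      · exact (le_sSup hy : y ≤ sSup c) ((hc hy).1 x)
      · rw [Subfield.mem_sSup_of_directedOn ⟨y, hy⟩ hchain.directedOn]
        rintro ⟨M, hM, hfM⟩
        exact (hc hM).2 hfM)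
    (frobenius E p).fieldRange ⟨fun x => ⟨x, rfl⟩, by rintro ⟨t, ht⟩; exact hf t ht⟩
  obtain ⟨hM, hfM⟩ := hMmax.prop
  have hdeg : ∀ z ∉ M, Module.finrank M (IntermediateField.adjoin M {z}) = p := by
    intro z hz
    have hi : IsIntegral M z := isIntegral_of_pow_mem p hp.out.pos M hM z
    rw [IntermediateField.adjoin.finrank hi, minpoly_eq_X_pow_sub_C p M hM hz,
      natDegree_X_pow_sub_C]
  have hint : IsIntegral M f := isIntegral_of_pow_mem p hp.out.pos M hM f
  have htop : ∀ z, z ∈ IntermediateField.adjoin M {f} := by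
    intro z
    by_cases hz : z ∈ M
    · exact (IntermediateField.adjoin M {f}).algebraMap_mem ⟨z, hz⟩
    have hfz : f ∈ IntermediateField.adjoin M {z} := by
      by_contra hfz
      have hle : M ≤ (IntermediateField.adjoin M {z}).toSubfield := fun x hx =>
        (IntermediateField.adjoin M {z}).algebraMap_mem ⟨x, hx⟩
      have := hMmax.le_of_ge (y := (IntermediateField.adjoin M {z}).toSubfield)
        ⟨fun x => hle (hM x), hfz⟩ hle
      exact hz (this (IntermediateField.mem_adjoin_simple_self M z))
    have hle : IntermediateField.adjoin M {f} ≤ IntermediateField.adjoin M {z} := by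
      simpa using hfz
    have : FiniteDimensional M (IntermediateField.adjoin M {z}) :=
      Module.finite_of_finrank_pos (by rw [hdeg z hz]; exact hp.out.pos)
    rw [IntermediateField.eq_of_le_of_finrank_eq hle (by rw [hdeg z hz, hdeg f hfM])]
    exact IntermediateField.mem_adjoin_simple_self M z
  have hsurj : ∀ z, ∃ P : M[X], aeval f P = z := by
    intro z
    have := htop z
    rw [← IntermediateField.mem_toSubalgebra,
      IntermediateField.adjoin_simple_toSubalgebra_of_isAlgebraic hint.isAlgebraic,
      Algebra.adjoin_singleton_eq_range_aeval] at this
    exact this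
  choose P hP using hsurj
  have hkey : ∀ Q : M[X], aeval f Q = 0 → aeval f (derivative Q) = 0 := by
    intro Q hQ
    obtain ⟨Q', rfl⟩ := minpoly.dvd M f hQ
    rw [minpoly_eq_X_pow_sub_C p M hM hfM] at hQ ⊢
    have hc : ((p : ℕ) : M[X]) = 0 := CharP.cast_eq_zero _ _
    have h0 := aeval_X_pow_sub_C_self p M hM f
    rw [derivative_mul, derivative_sub, derivative_X_pow, derivative_C, map_add, map_mul,
      map_mul, h0]
    simp
  have hd : ∀ Q₁ Q₂ : M[X], aeval f Q₁ = aeval f Q₂ →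
      aeval f (derivative Q₁) = aeval f (derivative Q₂) := by
    intro Q₁ Q₂ h
    have := hkey (Q₁ - Q₂) (by simp [h])
    simpa [sub_eq_zero] using this
  refine ⟨Derivation.mk' (AddMonoidHom.toIntLinearMap
    { toFun := fun z => aeval f (derivative (P z))
      map_zero' := by
        rw [hd _ 0 (by simp [hP])]; simp
      map_add' := fun x y => by
        rw [hd (P (x + y)) (P x + P y) (by simp [hP])]; simp }) ?_, ?_⟩
  · intro a b
    change aeval f (derivative (P (a * b))) = a • aeval f (derivative (P b)) +
      b • aeval f (derivative (P a))
    rw [hd (P (a * b)) (P a * P b) (by simp [hP])]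
    simp [derivative_mul, hP]; ring
  · change aeval f (derivative (P f)) = 1
    rw [hd (P f) X (by simp [hP])]; simp

end Polynomial

section

variable {K : Type*} [Field K] {N : ℕ}

/-- `f` is in an ideal generated by at most `k` forms of positive degrees less than `e`. -/
def Weak (k e : ℕ) (f : MvPolynomial (Fin N) K) : Prop :=
  ∃ U : Finset (MvPolynomial (Fin N) K), U.card ≤ k ∧
    (∀ u ∈ U, ∃ a, 0 < a ∧ a < e ∧ u.IsHomogeneous a) ∧
    f ∈ Ideal.span (U : Set (MvPolynomial (Fin N) K))

lemma Weak.mono {k k' e : ℕ} {f : MvPolynomial (Fin N) K} (h : Weak k e f) (hk : k ≤ k') :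
    Weak k' e f := by
  obtain ⟨U, h1, h2, h3⟩ := h
  exact ⟨U, h1.trans hk, h2, h3⟩

lemma derivation_apply_of_perfect {E : Type*} [Field E] [IsAlgClosed K] (p : ℕ) [hp : Fact p.Prime]
    [CharP E p] (φ : MvPolynomial (Fin N) K →+* E) (D : Derivation ℤ E E)
    (f : MvPolynomial (Fin N) K) :
    D (φ f) = ∑ j, φ (pderiv j f) * D (φ (X j)) := by
  induction f using MvPolynomial.induction_on with
  | C a =>
    obtain ⟨b, rfl⟩ := IsAlgClosed.exists_pow_nat_eq a hp.out.pos
    simp [Derivation.leibniz_pow]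
  | add a b ha hb =>
    simp [ha, hb, add_mul, Finset.sum_add_distrib]
  | mul_X a i ha =>
    simp only [map_mul, Derivation.leibniz, ha, smul_eq_mul, map_add, add_mul,
      Finset.sum_add_distrib, pderiv_X, Finset.mul_sum]
    congr 1
    · rw [Finset.sum_eq_single i]
      · simp
      · intro j _ hj
        simp [hj.symm]
      · simp
    · exact Finset.sum_congr rfl fun j _ => by ring

lemma exists_sub_pow_char_mem [IsAlgClosed K] (p : ℕ) [hp : Fact p.Prime] [CharP K p]
    {J : Ideal (MvPolynomial (Fin N) K)} [hJ : J.IsPrime] (hnorm : NormIdeal J)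
    {f : MvPolynomial (Fin N) K} (hf : ∀ j, pderiv j f ∈ J) : ∃ t, f - t ^ p ∈ J := by
  let E := FractionRing (MvPolynomial (Fin N) K ⧸ J)
  let φ : MvPolynomial (Fin N) K →+* E := (algebraMap _ E).comp (Ideal.Quotient.mk J)
  have hφ : ∀ x, φ x = 0 ↔ x ∈ J := by
    intro x
    rw [← Ideal.Quotient.eq_zero_iff_mem]
    exact map_eq_zero_iff (algebraMap (MvPolynomial (Fin N) K ⧸ J) E)
      (IsFractionRing.injective (MvPolynomial (Fin N) K ⧸ J) E)
  have : CharP E p := charP_of_injective_ringHom (φ.comp C).injective p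
  have h1 : ∃ t : E, t ^ p = φ f := by
    by_contra hcon
    push Not at hcon
    obtain ⟨D, hD⟩ := Polynomial.exists_derivation_eq_one p hcon
    rw [derivation_apply_of_perfect p φ D f, Finset.sum_eq_zero] at hD
    · exact zero_ne_one hD
    · intro j _
      rw [(hφ _).2 (hf j), zero_mul]
  obtain ⟨x, hx⟩ := h1
  obtain ⟨a', s', hs', rfl⟩ := IsFractionRing.div_surjective (A := MvPolynomial (Fin N) K ⧸ J) x
  obtain ⟨a, rfl⟩ := Ideal.Quotient.mk_surjective a'
  obtain ⟨s, rfl⟩ := Ideal.Quotient.mk_surjective s'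
  have hs : s ∉ J := by
    rw [← Ideal.Quotient.eq_zero_iff_mem]
    exact nonZeroDivisors.ne_zero hs'
  have hs0 : φ s ≠ 0 := by rwa [Ne, hφ]
  replace hx : (φ a / φ s) ^ p = φ f := hx
  have h2 : a ^ p - f * s ^ p ∈ J := by
    rw [← hφ, map_sub, map_pow, map_mul, map_pow, ← hx]
    rw [div_pow, div_mul_cancel₀ _ (pow_ne_zero _ hs0), sub_self]
  obtain ⟨m, hm⟩ : ∃ m, p = m + 1 := ⟨p - 1, (Nat.sub_add_cancel hp.out.pos).symm⟩
  have h3 := hnorm s a 0 f m (fun x hx => (hJ.mem_or_mem hx).resolve_left hs) (by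
    rw [hm] at h2
    convert h2 using 1
    ring)
  obtain ⟨j, hj, y, hy, rfl⟩ := Submodule.mem_sup.1 h3
  obtain ⟨t, rfl⟩ := Ideal.mem_span_singleton'.1 hy
  refine ⟨t, ?_⟩
  rw [← hφ, map_sub, map_pow] at h2 ⊢
  have hj0 : φ j = 0 := (hφ j).2 hj
  rw [map_add, map_mul, hj0, zero_add, map_mul, map_pow, mul_pow, ← sub_mul] at h2
  rcases mul_eq_zero.1 h2 with h | h
  · linear_combination -h
  · exact absurd h (pow_ne_zero _ hs0)

lemma exists_form_sub_pow_char_mem (p : ℕ) [hp : Fact p.Prime] [CharP K p]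
    {J : Ideal (MvPolynomial (Fin N) K)} (hJ : WHom (1 : Fin N → ℕ) J)
    {f t : MvPolynomial (Fin N) K} {e : ℕ} (hf : f.IsHomogeneous (p * e)) (h : f - t ^ p ∈ J) :
    ∃ u : MvPolynomial (Fin N) K, u.IsHomogeneous e ∧ f - u ^ p ∈ J := by
  refine ⟨homogeneousComponent e t, homogeneousComponent_isHomogeneous e t, ?_⟩
  have h1 := hJ _ h (p * e)
  change homogeneousComponent (p * e) (f - t ^ p) ∈ J at h1
  rw [map_sub, homogeneousComponent_of_mem hf, if_pos rfl] at h1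
  have : CharP (MvPolynomial (Fin N) K) p := inferInstance
  have h2 : homogeneousComponent (p * e) (t ^ p) = homogeneousComponent e t ^ p := by
    conv_lhs => rw [← sum_homogeneousComponent t]
    rw [sum_pow_char, map_sum]
    have : ∀ i ∈ Finset.range (t.totalDegree + 1),
        homogeneousComponent (p * e) (homogeneousComponent i t ^ p) =
        if i = e then homogeneousComponent e t ^ p else 0 := by
      intro i _
      have hi := (homogeneousComponent_isHomogeneous i t).pow p
      rw [homogeneousComponent_of_mem hi]
      by_cases hie : i = e
      · subst hie; simp [mul_comm]
      · rw [if_neg hie, if_neg]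
        rw [mul_comm i p]
        exact fun h => hie (Nat.eq_of_mul_eq_mul_left hp.out.pos h).symm
    rw [Finset.sum_congr rfl this, Finset.sum_ite_eq']
    split_ifs with hmem
    · rfl
    · rw [homogeneousComponent_eq_zero, zero_pow hp.out.ne_zero]
      simpa using hmem
  rwa [h2] at h1

/-- A form all of whose partial derivatives lie in the ideal of a nice family is weak. -/
lemma Nice.weak_of_pderiv_mem [IsAlgClosed K] {n : ℕ} {g : Fin n → MvPolynomial (Fin N) K}
    {dg : Fin n → ℕ} (hg : Nice g dg) {e : ℕ} (hlt : ∀ i, dg i < e)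
    {f : MvPolynomial (Fin N) K} (he : 0 < e) (hf : f.IsHomogeneous e)
    (hfg : ∀ j, pderiv j f ∈ Ideal.span (Set.range g)) : Weak (n + 1) e f := by
  classical
  have hcard : (Finset.univ.image g).card ≤ n := Finset.card_image_le.trans (by simp)
  have hU : ∀ u ∈ Finset.univ.image g, ∃ a, 0 < a ∧ a < e ∧ u.IsHomogeneous a := by
    intro u hu
    obtain ⟨i, -, rfl⟩ := Finset.mem_image.1 hu
    exact ⟨dg i, hg.pos i, hlt i, hg.hom i⟩
  by_cases h0 : (e : K) = 0
  · obtain ⟨p, hpc⟩ := CharP.exists K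
    have hp0 : p ≠ 0 := by
      rintro rfl
      have := (CharP.cast_eq_zero_iff K 0 e).1 h0
      exact he.ne' (zero_dvd_iff.1 this)
    have hp : Fact p.Prime := ⟨(CharP.char_is_prime_or_zero K p).resolve_right hp0⟩
    obtain ⟨e', rfl⟩ := (CharP.cast_eq_zero_iff K p e).1 h0
    have := hg.prime
    obtain ⟨t, ht⟩ := exists_sub_pow_char_mem p hg.norm hfg
    obtain ⟨u, hu, hfu⟩ := exists_form_sub_pow_char_mem p hg.wHom hf ht
    refine ⟨insert u (Finset.univ.image g), (Finset.card_insert_le _ _).trans (by omega), ?_, ?_⟩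
    · intro v hv
      rcases Finset.mem_insert.1 hv with rfl | hv
      · exact ⟨e', Nat.pos_of_mul_pos_left he,
          by nlinarith [hp.out.two_le, Nat.pos_of_mul_pos_left he], hu⟩
      · exact hU v hv
    · have h1 : f = (f - u ^ p) + u ^ p := by ring
      rw [h1]
      refine Ideal.add_mem _ (Ideal.span_mono ?_ hfu) ?_
      · rintro _ ⟨i, rfl⟩
        simp
      · exact Ideal.pow_mem_of_mem _ (Ideal.subset_span (by simp)) _ hp.out.pos
  · refine ⟨Finset.univ.image g, by omega, hU, ?_⟩
    have h1 := hf.sum_X_mul_pderiv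
    have h2 : (C (e : K)) * f ∈ Ideal.span (Set.range g) := by
      rw [map_natCast, ← nsmul_eq_mul, ← h1]
      exact Ideal.sum_mem _ fun i _ => Ideal.mul_mem_left _ _ (hfg i)
    have h3 : f = C (e : K)⁻¹ * (C (e : K) * f) := by
      rw [← mul_assoc, ← C_mul, inv_mul_cancel₀ h0, C_1, one_mul]
    rw [h3]
    simpa using Ideal.mul_mem_left _ _ h2

end

lemma isPrime_map_C_mvPolynomial {A ι : Type*} [CommRing A] (p : Ideal A) [p.IsPrime] :
    (p.map (C : A →+* MvPolynomial ι A)).IsPrime := by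
  have : p.map (C : A →+* MvPolynomial ι A) =
      RingHom.ker (MvPolynomial.map (σ := ι) (Ideal.Quotient.mk p)) := by
    ext f
    simp [MvPolynomial.mem_map_C_iff, RingHom.mem_ker, MvPolynomial.ext_iff, coeff_map,
      Ideal.Quotient.eq_zero_iff_mem]
  rw [this]
  exact RingHom.ker_isPrime _

lemma comap_C_map_C {A ι : Type*} [CommRing A] (p : Ideal A) :
    (p.map (C : A →+* MvPolynomial ι A)).comap C = p := by
  ext a
  classical
  rw [Ideal.mem_comap, MvPolynomial.mem_map_C_iff]
  constructor
  · intro h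
    simpa using h 0
  · intro h m
    rw [coeff_C]
    split_ifs
    · exact h
    · exact p.zero_mem

lemma height_map_C_le {A ι : Type*} [CommRing A] [IsNoetherianRing A] [Finite ι]
    (p : Ideal A) [p.IsPrime] :
    (p.map (C : A →+* MvPolynomial ι A)).height ≤ p.height := by
  have := isPrime_map_C_mvPolynomial (ι := ι) p
  have hl : (p.map (C : A →+* MvPolynomial ι A)).LiesOver p := ⟨(comap_C_map_C p).symm⟩
  have h := Ideal.height_le_height_add_of_liesOver p (p.map (C : A →+* MvPolynomial ι A))
  rw [algebraMap_eq, Ideal.map_quotient_self, Ideal.height_bot, add_zero] at h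
  exact h

lemma height_comap_C_le {A ι : Type*} [CommRing A] [IsNoetherianRing A] [Finite ι]
    (P : Ideal (MvPolynomial ι A)) [P.IsPrime] : (P.comap C).height ≤ P.height := by
  have hl : P.LiesOver (P.comap (C : A →+* MvPolynomial ι A)) := ⟨rfl⟩
  rw [Ideal.height_eq_height_add_of_liesOver_of_hasGoingDown (P.comap (C : A →+* _)) P]
  exact le_self_add

section
variable {A : Type*} [CommRing A] {n : ℕ}

/-- Evaluation along the line spanned by a family `c` modulo `p`. -/
noncomputable def lineMap (p : Ideal A) (c : Fin n → A) :
    MvPolynomial (Fin n) A →+* Polynomial (A ⧸ p) :=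
  eval₂Hom (Polynomial.C.comp (Ideal.Quotient.mk p))
    (fun i => Polynomial.C (Ideal.Quotient.mk p (c i)) * Polynomial.X)

lemma lineMap_C (p : Ideal A) (c : Fin n → A) (a : A) :
    lineMap p c (C a) = Polynomial.C (Ideal.Quotient.mk p a) := by
  simp [lineMap]

lemma lineMap_X (p : Ideal A) (c : Fin n → A) (i : Fin n) :
    lineMap p c (X i) = Polynomial.C (Ideal.Quotient.mk p (c i)) * Polynomial.X := by
  simp [lineMap]

lemma comp_lineMap {E : Type*} [CommRing E] (p : Ideal A) (c : Fin n → A) (θ : A →+* E)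
    (hθ : ∀ a ∈ p, θ a = 0) (u : E) (G : MvPolynomial (Fin n) A) (hG : lineMap p c G = 0) :
    eval₂ θ (fun i => θ (c i) * u) G = 0 := by
  have h : (Polynomial.eval₂RingHom (Ideal.Quotient.lift p θ hθ) u).comp (lineMap p c) =
      eval₂Hom θ (fun i => θ (c i) * u) := by
    apply MvPolynomial.ringHom_ext
    · intro a; simp [lineMap]
    · intro i; simp [lineMap]
  have h2 := congrArg (fun φ => φ G) h
  simp only [RingHom.comp_apply, hG, map_zero] at h2
  exact h2.symm

lemma height_ker_lineMap_le (hA : HasDepth A) [IsNoetherianRing A] (p : Ideal A) [hp : p.IsPrime]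
    (c : Fin n → A) {i₀ : Fin n} (hc : c i₀ ∉ p) :
    (RingHom.ker (lineMap p c)).height ≤ p.height + n := by
  classical
  have hpm := isPrime_map_C_mvPolynomial (ι := Fin n) p
  let F : Finset (MvPolynomial (Fin n) A) :=
    Finset.univ.image fun i => X i * C (c i₀) - X i₀ * C (c i)
  have hF : F.card ≤ n := Finset.card_image_le.trans (by simp)
  have hker : (RingHom.ker (lineMap p c)).IsPrime := RingHom.ker_isPrime _
  have hmin : RingHom.ker (lineMap p c) ∈
      (p.map (C : A →+* MvPolynomial (Fin n) A) ⊔ Ideal.span (F : Set _)).minimalPrimes := by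
    refine ⟨⟨hker, sup_le (Ideal.map_le_iff_le_comap.2 fun a ha => ?_) ?_⟩, ?_⟩
    · rw [Ideal.mem_comap, RingHom.mem_ker, lineMap_C, Ideal.Quotient.eq_zero_iff_mem.2 ha,
        map_zero]
    · rw [Ideal.span_le]
      intro y hy
      obtain ⟨i, -, rfl⟩ := Finset.mem_image.1 hy
      simp only [SetLike.mem_coe, RingHom.mem_ker, map_sub, map_mul, lineMap_C, lineMap_X]
      ring
    · rintro Q ⟨hQ, hQle⟩ hQk G hG
      rw [RingHom.mem_ker] at hG
      let E := FractionRing (MvPolynomial (Fin n) A ⧸ Q)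
      let ψ : MvPolynomial (Fin n) A →+* E := (algebraMap _ E).comp (Ideal.Quotient.mk Q)
      have hψ : ∀ x, ψ x = 0 ↔ x ∈ Q := by
        intro x
        rw [← Ideal.Quotient.eq_zero_iff_mem]
        exact map_eq_zero_iff (algebraMap (MvPolynomial (Fin n) A ⧸ Q) E)
          (IsFractionRing.injective (MvPolynomial (Fin n) A ⧸ Q) E)
      have hc0 : ψ (C (c i₀)) ≠ 0 := by
        rw [Ne, hψ]
        intro h
        have := hQk h
        rw [RingHom.mem_ker, lineMap_C, Polynomial.C_eq_zero, Ideal.Quotient.eq_zero_iff_mem]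
          at this
        exact hc this
      have h1 := comp_lineMap p c (ψ.comp C) (fun a ha => (hψ _).2
        (hQle (Ideal.mem_sup_left (Ideal.mem_map_of_mem _ ha)))) (ψ (X i₀) / ψ (C (c i₀))) G hG
      rw [← hψ, ← h1]
      have h2 : ψ = eval₂Hom (ψ.comp C)
          (fun i => (ψ.comp C) (c i) * (ψ (X i₀) / ψ (C (c i₀)))) := by
        apply MvPolynomial.ringHom_ext
        · intro a; simp
        · intro i
          have h3 : X i * C (c i₀) - X i₀ * C (c i) ∈ Q :=
            hQle (Ideal.mem_sup_right (Ideal.subset_span (by simp [F])))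
          rw [← hψ, map_sub, map_mul, map_mul, sub_eq_zero] at h3
          rw [coe_eval₂Hom, eval₂_X]
          change ψ (X i) = ψ (C (c i)) * (ψ (X i₀) / ψ (C (c i₀)))
          rw [← mul_div_assoc, eq_div_iff hc0, h3, mul_comm]
      exact congrArg (fun φ => φ G) h2
  refine ((HasDepth.mvPolynomial hA (Fin n)).height_le_add hmin).trans ?_
  exact add_le_add (height_map_C_le p) (by exact_mod_cast hF)

end
section
variable {K : Type*} [Field K] {N n : ℕ}

lemma eval_smul_of_isHomogeneous {f : MvPolynomial (Fin N) K} {e : ℕ} (hf : f.IsHomogeneous e)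
    (l : K) (x : Fin N → K) : eval (l • x) f = l ^ e * eval x f := by
  rw [eval_eq, eval_eq, Finset.mul_sum]
  refine Finset.sum_congr rfl fun m hm => ?_
  have h1 : m.degree = e := by
    rw [Finsupp.degree_eq_weight_one]
    exact hf (mem_support_iff.1 hm)
  rw [← h1, Finsupp.degree_apply]
  simp only [Pi.smul_apply, smul_eq_mul, mul_pow, Finset.prod_mul_distrib,
    Finset.prod_pow_eq_pow_sum]
  ring

lemma WHom.eval_smul_eq_zero {p : Ideal (MvPolynomial (Fin N) K)} (hp : WHom (1 : Fin N → ℕ) p)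
    {x : Fin N → K} (hx : ∀ f ∈ p, eval x f = 0) (l : K) {f : MvPolynomial (Fin N) K}
    (hf : f ∈ p) : eval (l • x) f = 0 := by
  rw [← sum_homogeneousComponent f, map_sum]
  refine Finset.sum_eq_zero fun i _ => ?_
  rw [eval_smul_of_isHomogeneous (homogeneousComponent_isHomogeneous i f),
    show eval x (homogeneousComponent i f) = 0 from hx _ (hp f hf i), mul_zero]

/-- A homogeneous linear relation degenerates to a constant one. -/
lemma exists_prime_of_linear_relation [IsAlgClosed K] {ι : Type*}
    {p : Ideal (MvPolynomial (Fin N) K)} [hp : p.IsPrime] (hph : WHom (1 : Fin N → ℕ) p)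
    (c : Fin n → MvPolynomial (Fin N) K) (a : ℕ) (b : Fin n → ℕ)
    (hc : ∀ i, (c i).IsHomogeneous (a + b i)) {i₀ : Fin n} (hb : b i₀ = 0) (hci : c i₀ ∉ p)
    (M : Matrix (Fin n) ι (MvPolynomial (Fin N) K)) (hM : ∀ j, ∑ i, c i * M i j ∈ p) :
    ∃ γ : Fin n → K, γ i₀ ≠ 0 ∧ (∀ i, γ i ≠ 0 → c i ≠ 0 ∧ b i = 0) ∧
      ∃ P : Ideal (MvPolynomial (Fin N) K), P.IsPrime ∧ P.height ≤ p.height + n + n ∧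
        ∀ j, ∑ i, C (γ i) * M i j ∈ P := by
  classical
  obtain ⟨x, hx, hcx⟩ : ∃ x : Fin N → K, (∀ f ∈ p, eval x f = 0) ∧ eval x (c i₀) ≠ 0 := by
    by_contra hcon
    push Not at hcon
    apply hci
    rw [← MvPolynomial.IsPrime.vanishingIdeal_zeroLocus (K := K) p, mem_vanishingIdeal_iff]
    intro x hx
    rw [aeval_eq_eval]
    refine hcon x fun f hf => ?_
    have := (mem_zeroLocus_iff.1 hx) f hf
    rwa [aeval_eq_eval] at this
  let γ : Fin n → K := fun i => if b i = 0 then eval x (c i) else 0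
  refine ⟨γ, by simpa [γ, hb] using hcx, fun i hi => ?_, ?_⟩
  · by_cases hbi : b i = 0
    · refine ⟨fun h0 => hi ?_, hbi⟩
      simp [γ, h0]
    · simp [γ, hbi] at hi
  let 𝔓 := RingHom.ker (lineMap p c)
  have hA : HasDepth (MvPolynomial (Fin N) K) := (HasDepth.of_field K).mvPolynomial (Fin N)
  have h𝔓 : 𝔓.IsPrime := RingHom.ker_isPrime _
  let F : Finset (MvPolynomial (Fin n) (MvPolynomial (Fin N) K)) :=
    Finset.univ.image fun i => X i - C (C (γ i))
  have hF : F.card ≤ n := Finset.card_image_le.trans (by simp)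
  let ev : MvPolynomial (Fin n) (MvPolynomial (Fin N) K) →+* K := eval₂Hom (eval 0) γ
  have hev : 𝔓 ≤ RingHom.ker ev := by
    intro G hG
    have hG0 : lineMap p c G = 0 := hG
    let θ : MvPolynomial (Fin n) (MvPolynomial (Fin N) K) →+* Polynomial K :=
      eval₂Hom (eval₂Hom Polynomial.C fun j => Polynomial.C (x j) * Polynomial.X)
        (fun i => Polynomial.C (eval x (c i)) * Polynomial.X ^ b i)
    have hl : ∀ l : K, l ≠ 0 → Polynomial.eval l (θ G) = 0 := by
      intro l hl
      have h1 := comp_lineMap p c (eval (l • x)) (fun f hf => hph.eval_smul_eq_zero hx l hf)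
        ((l ^ a)⁻¹) G hG0
      rw [← h1]
      have h2 : (Polynomial.evalRingHom l).comp θ =
          eval₂Hom (eval (l • x)) (fun i => eval (l • x) (c i) * (l ^ a)⁻¹) := by
        apply MvPolynomial.ringHom_ext
        · intro f
          have h3 : (Polynomial.evalRingHom l).comp (eval₂Hom Polynomial.C
              fun j => Polynomial.C (x j) * Polynomial.X) = eval (l • x) := by
            apply MvPolynomial.ringHom_ext
            · intro r; simp
            · intro j; simp; ring
          simpa [θ] using congrArg (fun φ => φ f) h3
        · intro i
          simp only [RingHom.comp_apply, θ, coe_eval₂Hom, eval₂_X]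
          rw [eval_smul_of_isHomogeneous (hc i), pow_add]
          simp
          field_simp
      exact congrArg (fun φ => φ G) h2
    have h0 : θ G = 0 := by
      have hinf : Infinite K := IsAlgClosed.instInfinite
      refine Polynomial.eq_zero_of_infinite_isRoot _ (Set.Infinite.mono (s := {0}ᶜ) ?_ ?_)
      · intro l hl'
        exact hl l hl'
      · exact (Set.finite_singleton (0 : K)).infinite_compl
    have h2 : (Polynomial.evalRingHom 0).comp θ = ev := by
      apply MvPolynomial.ringHom_ext
      · intro f
        have h3 : (Polynomial.evalRingHom 0).comp (eval₂Hom Polynomial.C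
            fun j => Polynomial.C (x j) * Polynomial.X) = eval 0 := by
          apply MvPolynomial.ringHom_ext
          · intro r; simp
          · intro j; simp
        simp [θ, ev, ← h3]
      · intro i
        by_cases hbi : b i = 0 <;> simp [θ, ev, γ, hbi]
    rw [RingHom.mem_ker, ← h2, RingHom.comp_apply, h0, map_zero]
  have hev2 : 𝔓 ⊔ Ideal.span (F : Set _) ≤ RingHom.ker ev := by
    refine sup_le hev (Ideal.span_le.2 ?_)
    intro y hy
    obtain ⟨i, -, rfl⟩ := Finset.mem_image.1 hy
    simp [ev, RingHom.mem_ker]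
  have hevp : (RingHom.ker ev).IsPrime := RingHom.ker_isPrime _
  obtain ⟨Q, hQ, -⟩ := Ideal.exists_minimalPrimes_le hev2
  have hQp := hQ.1.1
  refine ⟨Q.comap C, inferInstance, ?_, fun j => ?_⟩
  · refine (height_comap_C_le Q).trans
      (((hA.mvPolynomial (Fin n)).height_le_add hQ).trans ?_)
    exact add_le_add (height_ker_lineMap_le hA p c hci) (by exact_mod_cast hF)
  · have h1 : ∑ i, X i * C (M i j) ∈ 𝔓 := by
      rw [RingHom.mem_ker, map_sum]
      have h2 := (Ideal.Quotient.eq_zero_iff_mem (I := p)).2 (hM j)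
      have h3 : ∑ i, lineMap p c (X i * C (M i j)) =
          Polynomial.C (Ideal.Quotient.mk p (∑ i, c i * M i j)) * Polynomial.X := by
        rw [map_sum, map_sum, Finset.sum_mul]
        refine Finset.sum_congr rfl fun i _ => ?_
        rw [map_mul, lineMap_X, lineMap_C, map_mul, map_mul]
        ring
      rw [h3, h2, map_zero, zero_mul]
    have h4 : ∑ i, (X i - C (C (γ i))) * C (M i j) ∈ Q := by
      refine Ideal.sum_mem _ fun i _ => Ideal.mul_mem_right _ _ ?_
      exact hQ.1.2 (Ideal.mem_sup_right (Ideal.subset_span (by simp [F])))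
    have h5 := Ideal.sub_mem _ (hQ.1.2 (Ideal.mem_sup_left h1)) h4
    rw [Ideal.mem_comap, map_sum]
    convert h5 using 1
    rw [← Finset.sum_sub_distrib]
    refine Finset.sum_congr rfl fun i _ => ?_
    rw [map_mul]; ring

end
section
attribute [local instance] MvPolynomial.weightedGradedAlgebra
variable {K : Type*} [Field K]

lemma weightedHomogeneousComponent_mul_of_right {σ : Type*} {w : σ → ℕ} {a h : MvPolynomial σ K}
    {i : ℕ} (hh : IsWeightedHomogeneous w h i) (m : ℕ) :
    weightedHomogeneousComponent w m (a * h) =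
      if i ≤ m then weightedHomogeneousComponent w (m - i) a * h else 0 := by
  have hproj : ∀ (k : ℕ) (p : MvPolynomial σ K),
      GradedRing.proj (weightedHomogeneousSubmodule K w) k p =
        weightedHomogeneousComponent w k p := fun k p => by
    rw [GradedRing.proj_apply]
    exact weightedDecomposition.decompose'_apply K w p k
  have := proj_mul_of_mem (𝒜 := weightedHomogeneousSubmodule K w) (b := a) m hh
  rw [hproj, hproj] at this
  rw [mul_comm a h, mul_comm _ h, this]

end

section
variable {K : Type*} [Field K] {N n : ℕ}

lemma homogeneousComponent_mul_of_isHomogeneous {a h : MvPolynomial (Fin N) K} {i : ℕ}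
    (hh : h.IsHomogeneous i) (m : ℕ) : homogeneousComponent m (a * h) =
      if i ≤ m then homogeneousComponent (m - i) a * h else 0 :=
  weightedHomogeneousComponent_mul_of_right hh m

lemma isHomogeneous_det_submatrix {ι : Type*} {M : Matrix (Fin n) ι (MvPolynomial (Fin N) K)}
    {d : Fin n → ℕ} (hM : ∀ i j, (M i j).IsHomogeneous (d i)) (c : Fin n → ι) :
    (M.submatrix id c).det.IsHomogeneous (∑ i, d i) := by
  rw [Matrix.det_apply]
  refine IsHomogeneous.sum _ _ _ fun σ _ => ?_
  rw [Units.smul_def, zsmul_eq_mul, ← zero_add (∑ i, d i)]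
  have h1 : ∑ i, d i = ∑ i, d (σ i) := (Equiv.sum_comp σ d).symm
  rw [h1]
  refine IsHomogeneous.mul ?_ (IsHomogeneous.prod _ _ _ fun i _ => hM _ _)
  rw [← map_intCast (C : K →+* MvPolynomial (Fin N) K)]
  exact isHomogeneous_C _ _

/-- A linear dependence of graded rows modulo a homogeneous prime may be taken homogeneous. -/
lemma exists_homogeneous_relation {ι : Type*} {p : Ideal (MvPolynomial (Fin N) K)}
    (hph : WHom (1 : Fin N → ℕ) p) {M : Matrix (Fin n) ι (MvPolynomial (Fin N) K)}
    {d : Fin n → ℕ} (hM : ∀ i j, (M i j).IsHomogeneous (d i)) (h : ¬ RowIndep p M) :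
    ∃ (m : ℕ) (c : Fin n → MvPolynomial (Fin N) K), (∃ i, c i ∉ p) ∧
      (∀ i, c i ≠ 0 → c i ∉ p ∧ d i ≤ m ∧ (c i).IsHomogeneous (m - d i)) ∧
      ∀ j, ∑ i, c i * M i j ∈ p := by
  classical
  unfold RowIndep at h
  push Not at h
  obtain ⟨c, hc, i₁, hi₁⟩ := h
  obtain ⟨D, hD⟩ : ∃ D, homogeneousComponent D (c i₁) ∉ p := by
    by_contra hcon
    push Not at hcon
    apply hi₁
    rw [← sum_homogeneousComponent (c i₁)]
    exact Ideal.sum_mem _ fun i _ => hcon i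
  let m := D + d i₁
  let c' : Fin n → MvPolynomial (Fin N) K := fun i =>
    if d i ≤ m then homogeneousComponent (m - d i) (c i) else 0
  have hc' : ∀ j, ∑ i, c' i * M i j ∈ p := by
    intro j
    have h1 := hph _ (hc j) m
    change homogeneousComponent m _ ∈ p at h1
    rw [map_sum] at h1
    convert h1 using 2 with i
    rw [homogeneousComponent_mul_of_isHomogeneous (hM i j), ite_mul, zero_mul]
  refine ⟨m, fun i => if c' i ∈ p then 0 else c' i, ⟨i₁, ?_⟩, fun i hi => ?_, fun j => ?_⟩
  · have : c' i₁ ∉ p := by simpa [c', m] using hD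
    change (if c' i₁ ∈ p then 0 else c' i₁) ∉ p
    rwa [if_neg this]
  · change (if c' i ∈ p then 0 else c' i) ∉ p ∧
      d i ≤ m ∧ (if c' i ∈ p then 0 else c' i).IsHomogeneous (m - d i)
    by_cases h1 : c' i ∈ p
    · exact absurd (if_pos h1) hi
    · rw [if_neg h1]
      refine ⟨h1, ?_⟩
      by_cases h2 : d i ≤ m
      · refine ⟨h2, ?_⟩
        simp only [c', if_pos h2]
        exact homogeneousComponent_isHomogeneous _ _
      · exact absurd (by simp [c', if_neg h2]) h1
  · have h1 : ∑ i, (if c' i ∈ p then c' i else 0) * M i j ∈ p := by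
      refine Ideal.sum_mem _ fun i _ => Ideal.mul_mem_right _ _ ?_
      split_ifs with h
      · exact h
      · exact p.zero_mem
    have h2 := Ideal.sub_mem _ (hc' j) h1
    convert h2 using 1
    rw [← Finset.sum_sub_distrib]
    refine Finset.sum_congr rfl fun i _ => ?_
    change (if c' i ∈ p then 0 else c' i) * M i j = _
    by_cases h : c' i ∈ p <;> simp only [h, if_true, if_false] <;> ring

/-- If no linear combination of the forms `g i` of the same degree has its partial derivatives
in a prime of small height, then the Jacobian matrix of `g` has independent rows modulo every
prime of height at most `n + 1`. -/
theorem rowIndep_pderiv [IsAlgClosed K] {g : Fin n → MvPolynomial (Fin N) K} {dg : Fin n → ℕ}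
    (hg : ∀ i, (g i).IsHomogeneous (dg i))
    (hpos : ∀ i, 0 < dg i)
    (H : ∀ (e : ℕ) (γ : Fin n → K), (∃ i, γ i ≠ 0) → (∀ i, γ i ≠ 0 → dg i = e) →
      ∀ P : Ideal (MvPolynomial (Fin N) K), P.IsPrime → P.height ≤ (3 * n + 1 : ℕ) →
        ¬ ∀ j, pderiv j (∑ i, C (γ i) * g i) ∈ P)
    (q : Ideal (MvPolynomial (Fin N) K)) (hq : q.IsPrime) (hqh : q.height ≤ n + 1) :
    RowIndep q (fun i j => pderiv j (g i)) := by
  obtain ⟨p, hp, hph, hpq, hmem⟩ := exists_wHom_core 1 q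
  have hM : ∀ i j, (pderiv j (g i)).IsHomogeneous (dg i - 1) := fun i j => (hg i).pderiv
  by_contra hcon
  have hdep : ¬ RowIndep p (fun i j => pderiv j (g i)) := by
    intro hind
    obtain ⟨c, hc⟩ := hind.exists_det_notMem
    refine hcon (RowIndep.of_det_notMem c fun h => hc (hmem _ h _
      (isHomogeneous_det_submatrix hM c)))
  obtain ⟨m, c, hex, hc, hrel⟩ := exists_homogeneous_relation hph hM hdep
  classical
  obtain ⟨i₀, hi₀, hmax⟩ := Finset.exists_max_image (Finset.univ.filter fun i => c i ∉ p) dg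
    (by obtain ⟨i, hi⟩ := hex; exact ⟨i, by simpa using hi⟩)
  simp only [Finset.mem_filter, Finset.mem_univ, true_and] at hi₀ hmax
  have hc0 : ∀ i, c i ∉ p → c i ≠ 0 := fun i hi h0 => hi (h0 ▸ p.zero_mem)
  have hm0 := (hc i₀ (hc0 i₀ hi₀)).2.1
  have hcb : ∀ i, (c i).IsHomogeneous ((m - (dg i₀ - 1)) + (dg i₀ - dg i)) := by
    intro i
    by_cases h0 : c i = 0
    · rw [h0]; exact isHomogeneous_zero _ _ _
    · obtain ⟨h1, h2, h3⟩ := hc i h0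
      have h4 := hmax i h1
      have h5 := hpos i
      convert h3 using 1
      omega
  obtain ⟨γ, hγ0, hγ, P, hP, hPh, hPm⟩ := exists_prime_of_linear_relation hph c _
    (fun i => dg i₀ - dg i) hcb (i₀ := i₀) (by simp) hi₀ _ hrel
  refine H (dg i₀) γ ⟨i₀, hγ0⟩ (fun i hi => ?_) P hP ?_ fun j => ?_
  · obtain ⟨h1, h2⟩ := hγ i hi
    have := hmax i (hc i h1).1
    omega
  · have h1 : p.height ≤ (n + 1 : ℕ) := (Ideal.height_mono hpq).trans (by exact_mod_cast hqh)
    refine hPh.trans ((add_le_add (add_le_add h1 le_rfl) le_rfl).trans ?_)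
    norm_cast
    omega
  · simpa using hPm j

end

section
variable {K : Type*} [Field K] {N : ℕ}

/-- Finite sets of nonzero forms of positive degree. -/
def FormSet (S : Finset (MvPolynomial (Fin N) K)) : Prop :=
  ∀ s ∈ S, s ≠ 0 ∧ 0 < s.totalDegree ∧ s.IsHomogeneous s.totalDegree

/-- No nontrivial combination of the members of degree `e` is weak. -/
def StrongAt (A e : ℕ) (S : Finset (MvPolynomial (Fin N) K)) : Prop :=
  ∀ γ : MvPolynomial (Fin N) K → K, Weak A e (∑ s ∈ S with s.totalDegree = e, C (γ s) * s) →
    ∀ s ∈ S, s.totalDegree = e → γ s = 0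

lemma exists_homogeneous_cofactors {f : MvPolynomial (Fin N) K} {e : ℕ} (hf : f.IsHomogeneous e)
    {U : Finset (MvPolynomial (Fin N) K)} (a : MvPolynomial (Fin N) K → ℕ)
    (hU : ∀ u ∈ U, u.IsHomogeneous (a u) ∧ a u ≤ e)
    (hfU : f ∈ Ideal.span (U : Set (MvPolynomial (Fin N) K))) :
    ∃ h : MvPolynomial (Fin N) K → MvPolynomial (Fin N) K,
      (∀ u ∈ U, (h u).IsHomogeneous (e - a u)) ∧ f = ∑ u ∈ U, h u * u := by
  obtain ⟨h, -, hh⟩ := Submodule.mem_span_finset.1 hfU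
  refine ⟨fun u => homogeneousComponent (e - a u) (h u),
    fun u _ => homogeneousComponent_isHomogeneous _ _, ?_⟩
  have h1 := congrArg (homogeneousComponent e) hh
  rw [homogeneousComponent_of_mem hf, if_pos rfl, map_sum] at h1
  rw [← h1]
  refine Finset.sum_congr rfl fun u hu => ?_
  rw [smul_eq_mul, homogeneousComponent_mul_of_isHomogeneous (hU u hu).1, if_pos (hU u hu).2]

lemma FormSet.exists_improve {A e : ℕ} {S : Finset (MvPolynomial (Fin N) K)} (hS : FormSet S)
    (hstr : ¬ StrongAt A e S) :
    ∃ S' : Finset (MvPolynomial (Fin N) K), FormSet S' ∧ S'.card ≤ S.card + 2 * A ∧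
      (S : Set (MvPolynomial (Fin N) K)) ⊆ Algebra.adjoin K (S' : Set (MvPolynomial (Fin N) K)) ∧
      (∀ s, e < s.totalDegree → (s ∈ S' ↔ s ∈ S)) ∧
      (S'.filter fun s => s.totalDegree = e).card < (S.filter fun s => s.totalDegree = e).card := by
  classical
  unfold StrongAt at hstr
  push Not at hstr
  obtain ⟨γ, ⟨U, hUc, hU, hfU⟩, s₀, hs₀, hse, hγ⟩ := hstr
  set f := ∑ s ∈ S with s.totalDegree = e, C (γ s) * s with hfdef
  have hf : f.IsHomogeneous e := by
    refine IsHomogeneous.sum _ _ _ fun s hs => ?_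
    obtain ⟨h1, h2⟩ := Finset.mem_filter.1 hs
    have := (hS s h1).2.2
    rw [h2] at this
    simpa using (isHomogeneous_C (Fin N) (γ s)).mul this
  choose! a ha0 hae hah using hU
  obtain ⟨h, hh, hfs⟩ := exists_homogeneous_cofactors hf a (fun u hu => ⟨hah u hu, (hae u hu).le⟩)
    hfU
  let V := (U ∪ U.image h).filter (· ≠ 0)
  have hV : ∀ v ∈ V, v ≠ 0 ∧ 0 < v.totalDegree ∧ v.totalDegree < e ∧
      v.IsHomogeneous v.totalDegree := by
    intro v hv
    obtain ⟨hv, hv0⟩ := Finset.mem_filter.1 hv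
    have key : ∀ b, v.IsHomogeneous b → 0 < b → b < e → v ≠ 0 ∧ 0 < v.totalDegree ∧
        v.totalDegree < e ∧ v.IsHomogeneous v.totalDegree := by
      intro b hb h1 h2
      rw [hb.totalDegree hv0]
      exact ⟨hv0, h1, h2, hb⟩
    rcases Finset.mem_union.1 hv with hv | hv
    · exact key _ (hah v hv) (ha0 v hv) (hae v hv)
    · obtain ⟨u, hu, rfl⟩ := Finset.mem_image.1 hv
      have h1 := ha0 u hu
      have h2 := hae u hu
      exact key _ (hh u hu) (by omega) (by omega)
  have hVc : V.card ≤ 2 * A := by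
    refine (Finset.card_filter_le _ _).trans ((Finset.card_union_le _ _).trans ?_)
    have : (U.image h).card ≤ U.card := Finset.card_image_le
    omega
  refine ⟨S.erase s₀ ∪ V, ?_, ?_, ?_, ?_, ?_⟩
  · intro s hs
    rcases Finset.mem_union.1 hs with hs | hs
    · exact hS s (Finset.mem_of_mem_erase hs)
    · obtain ⟨h1, h2, -, h3⟩ := hV s hs
      exact ⟨h1, h2, h3⟩
  · refine (Finset.card_union_le _ _).trans (add_le_add ?_ hVc)
    exact Finset.card_le_card (Finset.erase_subset _ _)
  · set B := Algebra.adjoin K ((S.erase s₀ ∪ V : Finset _) : Set (MvPolynomial (Fin N) K)) with hB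
    have hBS : ∀ s ∈ S, s ≠ s₀ → s ∈ B := fun s hs hne =>
      Algebra.subset_adjoin (by simp [hs, hne])
    have hBV : ∀ v ∈ U ∪ U.image h, v ∈ B := by
      intro v hv
      by_cases hv0 : v = 0
      · rw [hv0]; exact B.zero_mem
      · refine Algebra.subset_adjoin ?_
        rw [Finset.mem_coe]
        exact Finset.mem_union_right _ (Finset.mem_filter.2 ⟨hv, hv0⟩)
    have hfB : f ∈ B := by
      rw [hfs]
      refine B.sum_mem fun u hu => B.mul_mem (hBV _ ?_) (hBV _ ?_)
      · exact Finset.mem_union_right _ (Finset.mem_image_of_mem _ hu)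
      · exact Finset.mem_union_left _ hu
    have hs₀B : s₀ ∈ B := by
      have hmem : s₀ ∈ S.filter fun s => s.totalDegree = e := by simp [hs₀, hse]
      have h1 : f = C (γ s₀) * s₀ +
          ∑ s ∈ (S.filter fun s => s.totalDegree = e).erase s₀, C (γ s) * s := by
        rw [hfdef, Finset.add_sum_erase _ (fun s => C (γ s) * s) hmem]
      have h2 : s₀ = C (γ s₀)⁻¹ *
          (f - ∑ s ∈ (S.filter fun s => s.totalDegree = e).erase s₀, C (γ s) * s) := by
        rw [h1, add_sub_cancel_right, ← mul_assoc, ← C_mul, inv_mul_cancel₀ hγ, C_1, one_mul]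
      rw [h2]
      refine B.mul_mem (B.algebraMap_mem _) (B.sub_mem hfB (B.sum_mem fun s hs => ?_))
      refine B.mul_mem (B.algebraMap_mem _) (hBS s ?_ (Finset.ne_of_mem_erase hs))
      exact (Finset.mem_filter.1 (Finset.mem_of_mem_erase hs)).1
    intro s hs
    by_cases hne : s = s₀
    · rw [hne]; exact hs₀B
    · exact hBS s hs hne
  · intro s hs
    have h1 : s ∉ V := fun h => by
      have := (hV s h).2.2.1
      omega
    have h2 : s ≠ s₀ := by rintro rfl; omega
    simp [h1, h2]
  · refine Finset.card_lt_card ⟨?_, fun hsub => ?_⟩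
    · intro s hs
      obtain ⟨h1, h2⟩ := Finset.mem_filter.1 hs
      rcases Finset.mem_union.1 h1 with h1 | h1
      · exact Finset.mem_filter.2 ⟨Finset.mem_of_mem_erase h1, h2⟩
      · have := (hV s h1).2.2.1
        omega
    · have h1 := hsub (Finset.mem_filter.2 ⟨hs₀, hse⟩)
      obtain ⟨h2, -⟩ := Finset.mem_filter.1 h1
      rcases Finset.mem_union.1 h2 with h2 | h2
      · exact Finset.notMem_erase _ _ h2
      · have := (hV _ h2).2.2.1
        omega

/-- Iterating `m ↦ ψ m + 2 (ψ (3 ψ m + 1) + 1)`, followed by `ψ`. -/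
def improveBound (ψ : ℕ → ℕ) : ℕ → ℕ → ℕ
  | 0, m => ψ m
  | j + 1, m => improveBound ψ j (ψ m + 2 * (ψ (3 * ψ m + 1) + 1))

/-- Bound for the number of forms in a strong family refining `m` forms of degree at most `e`. -/
def strongBound : ℕ → ℕ → ℕ
  | 0, m => m
  | e + 1, m => improveBound (strongBound e) m m

/-- The strength required in degree `e` of a family of at most `μ` forms. -/
def strengthAt (e μ : ℕ) : ℕ := strongBound (e - 1) (3 * μ + 1) + 1

lemma le_improveBound {ψ : ℕ → ℕ} (hψ : ∀ m, m ≤ ψ m) (j m : ℕ) : ψ m ≤ improveBound ψ j m := by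
  induction j generalizing m with
  | zero => exact le_rfl
  | succ j ih =>
    refine le_trans ?_ (ih _)
    exact le_trans (Nat.le_add_right _ _) (hψ _)

lemma le_strongBound (e m : ℕ) : m ≤ strongBound e m := by
  induction e generalizing m with
  | zero => exact le_rfl
  | succ e ih => exact (ih m).trans (le_improveBound ih _ _)

lemma improveBound_mono {ψ : ℕ → ℕ} (hψ : ∀ m, m ≤ ψ m) (hmono : Monotone ψ) {i j m n : ℕ}
    (hij : i ≤ j) (hmn : m ≤ n) : improveBound ψ i m ≤ improveBound ψ j n := by
  induction j generalizing i m n with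
  | zero =>
    obtain rfl : i = 0 := by omega
    exact hmono hmn
  | succ j ih =>
    have h1 := hmono hmn
    cases i with
    | zero => exact h1.trans (le_improveBound hψ _ _)
    | succ i =>
      have h2 : ψ (3 * ψ m + 1) ≤ ψ (3 * ψ n + 1) :=
        hmono (Nat.add_le_add_right (Nat.mul_le_mul_left 3 h1) 1)
      have h3 : ψ m + 2 * (ψ (3 * ψ m + 1) + 1) ≤ ψ n + 2 * (ψ (3 * ψ n + 1) + 1) := by omega
      have h4 := ih (Nat.le_of_succ_le_succ hij) h3
      exact h4

lemma strongBound_mono (e : ℕ) : Monotone (strongBound e) := by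
  induction e with
  | zero => exact monotone_id
  | succ e ih => exact fun m n hmn => improveBound_mono (le_strongBound e) ih hmn hmn

lemma FormSet.exists_strong (e : ℕ) {m : ℕ} {S : Finset (MvPolynomial (Fin N) K)}
    (hS : FormSet S) (hm : S.card ≤ m) :
    ∃ (μ : ℕ) (S' : Finset (MvPolynomial (Fin N) K)), FormSet S' ∧ S'.card ≤ μ ∧
      μ ≤ strongBound e m ∧
      (S : Set (MvPolynomial (Fin N) K)) ⊆ Algebra.adjoin K (S' : Set (MvPolynomial (Fin N) K)) ∧
      (∀ s, e < s.totalDegree → (s ∈ S' ↔ s ∈ S)) ∧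
      ∀ i, 0 < i → i ≤ e → StrongAt (strengthAt i μ) i S' := by
  classical
  induction e generalizing m S with
  | zero =>
    exact ⟨m, S, hS, hm, le_rfl, Algebra.subset_adjoin, fun _ _ => Iff.rfl, fun i h1 h2 => by omega⟩
  | succ e ih =>
    have key : ∀ (j m : ℕ) (S : Finset (MvPolynomial (Fin N) K)), FormSet S → S.card ≤ m →
        (S.filter fun s => s.totalDegree = e + 1).card ≤ j →
        ∃ (μ : ℕ) (S' : Finset (MvPolynomial (Fin N) K)), FormSet S' ∧ S'.card ≤ μ ∧
          μ ≤ improveBound (strongBound e) j m ∧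
          (S : Set (MvPolynomial (Fin N) K)) ⊆
            Algebra.adjoin K (S' : Set (MvPolynomial (Fin N) K)) ∧
          (∀ s, e + 1 < s.totalDegree → (s ∈ S' ↔ s ∈ S)) ∧
          ∀ i, 0 < i → i ≤ e + 1 → StrongAt (strengthAt i μ) i S' := by
      intro j
      induction j with
      | zero =>
        intro m S hS hm hj
        obtain ⟨μ, S', h1, h2, h3, h4, h5, h6⟩ := ih hS hm
        refine ⟨μ, S', h1, h2, h3, h4, fun s hs => h5 s (by omega), fun i hi hie => ?_⟩
        rcases Nat.lt_or_ge e i with h | h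
        · intro γ _ s hs hsi
          exfalso
          have hsS : s ∈ S := (h5 s (by omega)).1 hs
          have : s ∈ S.filter fun s => s.totalDegree = e + 1 :=
            Finset.mem_filter.2 ⟨hsS, by omega⟩
          rw [Finset.card_eq_zero.1 (Nat.le_zero.1 hj)] at this
          simp at this
        · exact h6 i hi h
      | succ j ihj =>
        intro m S hS hm hj
        obtain ⟨μ, S₁, h1, h2, h3, h4, h5, h6⟩ := ih hS hm
        by_cases hstr : StrongAt (strengthAt (e + 1) μ) (e + 1) S₁
        · refine ⟨μ, S₁, h1, h2, h3.trans (le_improveBound (le_strongBound e) _ _), h4,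
            fun s hs => h5 s (by omega), fun i hi hie => ?_⟩
          rcases hie.lt_or_eq with h | rfl
          · exact h6 i hi (by omega)
          · exact hstr
        · obtain ⟨S₂, g1, g2, g3, g4, g5⟩ := h1.exists_improve hstr
          have hc : (S₁.filter fun s => s.totalDegree = e + 1).card ≤ j + 1 := by
            refine le_trans (Finset.card_le_card fun s hs => ?_) hj
            obtain ⟨k1, k2⟩ := Finset.mem_filter.1 hs
            exact Finset.mem_filter.2 ⟨(h5 s (by omega)).1 k1, k2⟩
          have hb : S₂.card ≤
              strongBound e m + 2 * (strongBound e (3 * strongBound e m + 1) + 1) := by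
            have := strongBound_mono e (show 3 * μ + 1 ≤ 3 * strongBound e m + 1 by omega)
            have h' : strengthAt (e + 1) μ = strongBound e (3 * μ + 1) + 1 := rfl
            omega
          obtain ⟨μ', S', k1, k2, k3, k4, k5, k6⟩ := ihj _ S₂ g1 hb (by omega)
          refine ⟨μ', S', k1, k2, k3, ?_, fun s hs => ?_, k6⟩
          · have t1 : Algebra.adjoin K (S₁ : Set (MvPolynomial (Fin N) K)) ≤
                Algebra.adjoin K (S₂ : Set _) := Algebra.adjoin_le g3
            have t2 : Algebra.adjoin K (S₂ : Set (MvPolynomial (Fin N) K)) ≤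
                Algebra.adjoin K (S' : Set _) := Algebra.adjoin_le k4
            exact fun x hx => t2 (t1 (h4 hx))
          · rw [k5 s hs, g4 s hs, h5 s (by omega)]
    exact key m m S hS hm ((Finset.card_filter_le _ _).trans hm)

end

section
variable {K : Type*} [Field K] {N : ℕ}

lemma RegFam.of_castSucc {A : Type*} [CommRing A] {n : ℕ} {g : Fin (n + 1) → A}
    (h : RegFam (fun i => g (Fin.castSucc i)))
    (hl : ∀ x, g (Fin.last n) * x ∈ Ideal.span (Set.range fun i : Fin n => g i.castSucc) →
      x ∈ Ideal.span (Set.range fun i : Fin n => g i.castSucc)) : RegFam g := by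
  intro k
  induction k using Fin.lastCases with
  | last =>
    have h1 : g '' Set.Iio (Fin.last n) = Set.range fun i : Fin n => g i.castSucc := by
      ext y
      constructor
      · rintro ⟨i, hi, rfl⟩
        obtain ⟨j, rfl⟩ := Fin.exists_castSucc_eq.2 (ne_of_lt hi)
        exact ⟨j, rfl⟩
      · rintro ⟨j, rfl⟩
        exact ⟨j.castSucc, Fin.castSucc_lt_last j, rfl⟩
    rw [h1]
    exact hl
  | cast k =>
    have h1 : (fun i => g (Fin.castSucc i)) '' Set.Iio k = g '' Set.Iio (Fin.castSucc k) := by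
      ext y
      constructor
      · rintro ⟨i, hi, rfl⟩
        exact ⟨i.castSucc, Fin.castSucc_lt_castSucc_iff.2 hi, rfl⟩
      · rintro ⟨i, hi, rfl⟩
        obtain ⟨j, rfl⟩ := Fin.exists_castSucc_eq.2 (ne_of_lt
          (lt_trans hi (Fin.castSucc_lt_last k)))
        exact ⟨j, Fin.castSucc_lt_castSucc_iff.1 hi, rfl⟩
    rw [← h1]
    exact h k

/-- The strength condition for an indexed family of forms. -/
def StrongFam (e μ : ℕ) {n : ℕ} (g : Fin n → MvPolynomial (Fin N) K) (dg : Fin n → ℕ) : Prop :=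
  ∀ e', 0 < e' → e' ≤ e → ∀ γ : Fin n → K, (∀ i, γ i ≠ 0 → dg i = e') →
    Weak (strengthAt e' μ) e' (∑ i, C (γ i) * g i) → ∀ i, γ i = 0

lemma StrongFam.castSucc {e μ n : ℕ} {g : Fin (n + 1) → MvPolynomial (Fin N) K}
    {dg : Fin (n + 1) → ℕ} (h : StrongFam e μ g dg) :
    StrongFam e μ (fun i => g (Fin.castSucc i)) (fun i => dg i.castSucc) := by
  intro e' h0 he γ hγ hw i
  have := h e' h0 he (Fin.snoc γ 0) (fun i hi => ?_) ?_ i.castSucc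
  · simpa using this
  · induction i using Fin.lastCases with
    | last => simp at hi
    | cast i => exact hγ i (by simpa using hi)
  · simpa [Fin.sum_univ_castSucc] using hw

lemma StrongFam.nice_of_regFam [IsAlgClosed K] {e μ : ℕ}
    (ih : ∀ e' < e, ∀ k, NiceCover K N e' k (strongBound e' k)) {n : ℕ} (hn : n ≤ μ)
    {g : Fin n → MvPolynomial (Fin N) K} {dg : Fin n → ℕ} (hom : ∀ i, (g i).IsHomogeneous (dg i))
    (hpos : ∀ i, 0 < dg i) (hle : ∀ i, dg i ≤ e) (hs : StrongFam e μ g dg)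
    (hreg : RegFam g) : Nice g dg := by
  have hA : HasDepth (MvPolynomial (Fin N) K) := (HasDepth.of_field K).mvPolynomial (Fin N)
  have hrow : ∀ q : Ideal (MvPolynomial (Fin N) K), q.IsPrime → q.height ≤ n + 1 →
      RowIndep q (fun i j => pderiv j (g i)) := by
    refine fun q hq hqh => rowIndep_pderiv hom hpos ?_ q hq hqh
    rintro e' γ ⟨i₀, hi₀⟩ hγ P hP hPh hall
    have h0 : 0 < e' := hγ i₀ hi₀ ▸ hpos i₀
    have h1 : e' ≤ e := hγ i₀ hi₀ ▸ hle i₀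
    have hf : (∑ i, C (γ i) * g i).IsHomogeneous e' := by
      refine IsHomogeneous.sum _ _ _ fun i _ => ?_
      by_cases h : γ i = 0
      · simpa [h] using isHomogeneous_zero (Fin N) K e'
      · have := hom i
        rw [hγ i h] at this
        simpa using (isHomogeneous_C (Fin N) (γ i)).mul this
    obtain ⟨e'', rfl⟩ : ∃ e'', e' = e'' + 1 := ⟨e' - 1, by omega⟩
    obtain ⟨n', g', dg', hn', hnice, hdg', hmem⟩ :=
      (ih e'' (by omega) (3 * μ + 1)).exists_pderiv_mem hf
        (hPh.trans (by exact_mod_cast (by omega : 3 * n + 1 ≤ 3 * μ + 1))) hall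
    have hw := hnice.weak_of_pderiv_mem (fun i => Nat.lt_succ_of_le (hdg' i)) h0 hf hmem
    exact hi₀ (hs _ h0 h1 γ hγ (hw.mono (Nat.add_le_add_right hn' 1)) i₀)
  have hnorm : NormIdeal (Ideal.span (Set.range g)) :=
    normIdeal_of_rowIndep hA (fun j => pderiv j) hreg fun q hq _ hqh => hrow q hq hqh
  have hw : WHom 1 (Ideal.span (Set.range g)) := by
    refine WHom.span _ ?_
    rintro _ ⟨i, rfl⟩
    exact ⟨dg i, hom i⟩
  have hne : Ideal.span (Set.range g) ≠ ⊤ := by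
    intro h
    have h1 : Ideal.span (Set.range g) ≤ RingHom.ker (constantCoeff (σ := Fin N) (R := K)) := by
      rw [Ideal.span_le]
      rintro _ ⟨i, rfl⟩
      refine RingHom.mem_ker.2 ?_
      by_contra hc
      have h4 := hom i hc
      have h5 := hpos i
      simp at h4
      omega
    have h2 := h1 (h ▸ Submodule.mem_top : (1 : MvPolynomial (Fin N) K) ∈ _)
    simp [RingHom.mem_ker] at h2
  refine ⟨hom, hpos, hreg, isPrime_of_normIdeal hnorm hne ?_ ?_, hnorm⟩
  · intro p hp
    obtain ⟨h1, h2⟩ := mem_associatedPrimes_height_le hA hreg hp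
    have := hp.isPrime
    exact exists_locally_mem (fun j => pderiv j) h1
      (hrow p hp.isPrime (h2.trans le_self_add)) h2
  · exact hw.mem_or_mem_of_sq_sub_mem (fun _ => Nat.one_pos) hne

lemma StrongFam.last_notMem {e μ : ℕ} {n : ℕ} (hn : n ≤ μ)
    {g : Fin (n + 1) → MvPolynomial (Fin N) K} {dg : Fin (n + 1) → ℕ}
    (hom : ∀ i, (g i).IsHomogeneous (dg i))
    (hpos : ∀ i, 0 < dg i) (hle : ∀ i, dg i ≤ e) (hmon : Monotone dg)
    (hs : StrongFam e μ g dg) :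
    g (Fin.last n) ∉ Ideal.span (Set.range fun i : Fin n => g i.castSucc) := by
  classical
  intro hmem
  obtain ⟨h, hh⟩ := Ideal.mem_span_range_iff_exists_fun.1 hmem
  set e' := dg (Fin.last n)
  have hh' : ∑ i : Fin n, homogeneousComponent (e' - dg i.castSucc) (h i) * g i.castSucc =
      g (Fin.last n) := by
    have h1 := congrArg (homogeneousComponent e') hh
    rw [homogeneousComponent_of_mem (hom (Fin.last n)), if_pos rfl, map_sum] at h1
    rw [← h1]
    refine Finset.sum_congr rfl fun i _ => ?_
    rw [homogeneousComponent_mul_of_isHomogeneous (hom i.castSucc),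
      if_pos (hmon (Fin.castSucc_lt_last i).le)]
  let γ : Fin (n + 1) → K := Fin.snoc
    (fun i : Fin n => if dg i.castSucc = e' then - coeff 0 (h i) else 0) 1
  have hγl : γ (Fin.last n) = 1 := Fin.snoc_last _ _
  have hγc : ∀ i : Fin n, γ i.castSucc = if dg i.castSucc = e' then - coeff 0 (h i) else 0 :=
    fun i => Fin.snoc_castSucc _ _ _
  have h2 := hs e' (hpos _) (hle _) γ (fun i hi => ?_) ?_ (Fin.last n)
  · rw [hγl] at h2
    exact one_ne_zero h2
  · induction i using Fin.lastCases with
    | last => rfl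
    | cast i =>
      by_contra hc
      rw [hγc, if_neg hc] at hi
      exact hi rfl
  · have hsum : ∑ i, C (γ i) * g i = ∑ i : Fin n, if dg i.castSucc = e' then 0 else
        homogeneousComponent (e' - dg i.castSucc) (h i) * g i.castSucc := by
      rw [Fin.sum_univ_castSucc, hγl, C_1, one_mul, ← hh', ← Finset.sum_add_distrib]
      refine Finset.sum_congr rfl fun i _ => ?_
      rw [hγc]
      split_ifs with hi
      · rw [hi, Nat.sub_self, homogeneousComponent_zero, C_neg]
        ring
      · rw [C_0]
        ring
    have hb := le_strongBound (e' - 1) (3 * μ + 1)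
    have hb' : strengthAt e' μ = strongBound (e' - 1) (3 * μ + 1) + 1 := rfl
    refine ⟨(Finset.univ.filter fun i : Fin n => dg i.castSucc ≠ e').image fun i => g i.castSucc,
      ?_, ?_, ?_⟩
    · refine (Finset.card_image_le.trans (Finset.card_filter_le _ _)).trans ?_
      rw [Finset.card_univ, Fintype.card_fin]
      omega
    · intro u hu
      obtain ⟨i, hi, rfl⟩ := Finset.mem_image.1 hu
      have h1 := hmon (Fin.castSucc_lt_last i).le
      exact ⟨dg i.castSucc, hpos _, lt_of_le_of_ne h1 (Finset.mem_filter.1 hi).2, hom _⟩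
    · rw [hsum]
      refine Ideal.sum_mem _ fun i _ => ?_
      split_ifs with hi
      · exact Ideal.zero_mem _
      · refine Ideal.mul_mem_left _ _ (Ideal.subset_span ?_)
        rw [Finset.mem_coe]
        exact Finset.mem_image.2 ⟨i, by simpa using hi, rfl⟩

lemma StrongFam.nice [IsAlgClosed K] {e μ : ℕ}
    (ih : ∀ e' < e, ∀ k, NiceCover K N e' k (strongBound e' k)) {n : ℕ} (hn : n ≤ μ)
    {g : Fin n → MvPolynomial (Fin N) K} {dg : Fin n → ℕ} (hom : ∀ i, (g i).IsHomogeneous (dg i))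
    (hpos : ∀ i, 0 < dg i) (hle : ∀ i, dg i ≤ e) (hmon : Monotone dg)
    (hs : StrongFam e μ g dg) : Nice g dg := by
  refine hs.nice_of_regFam ih hn hom hpos hle ?_
  induction n with
  | zero => exact fun k => k.elim0
  | succ n ihn =>
    have h1 := ihn (by omega) (fun i => hom i.castSucc) (fun i => hpos _) (fun i => hle _)
      (fun i j hij => hmon (Fin.castSucc_le_castSucc_iff.2 hij)) hs.castSucc
    have h2 := hs.castSucc.nice_of_regFam ih (by omega) (fun i => hom i.castSucc)
      (fun i => hpos _) (fun i => hle _) h1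
    refine h1.of_castSucc fun x hx => ?_
    exact (h2.prime.mem_or_mem hx).resolve_left (hs.last_notMem (by omega) hom hpos hle hmon)

lemma exists_sorted_enum {α : Type*} (S : Finset α) (f : α → ℕ) :
    ∃ g : Fin S.card → α, Function.Injective g ∧ Set.range g = S ∧ Monotone fun i => f (g i) := by
  let g₀ : Fin S.card → α := fun i => S.equivFin.symm i
  have h0 : Function.Injective g₀ := Subtype.val_injective.comp S.equivFin.symm.injective
  have h1 : Set.range g₀ = S := by
    ext x
    constructor
    · rintro ⟨i, rfl⟩
      exact (S.equivFin.symm i).2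
    · intro hx
      exact ⟨S.equivFin ⟨x, hx⟩, by simp [g₀]⟩
  let τ := Tuple.sort fun i => f (g₀ i)
  refine ⟨fun i => g₀ (τ i), h0.comp τ.injective, ?_, Tuple.monotone_sort fun i => f (g₀ i)⟩
  rw [← h1]
  exact τ.surjective.range_comp g₀

lemma FormSet.exists_nice [IsAlgClosed K] {e m : ℕ}
    (ih : ∀ e' < e, ∀ k, NiceCover K N e' k (strongBound e' k))
    {S : Finset (MvPolynomial (Fin N) K)} (hS : FormSet S) (hm : S.card ≤ m)
    (hle : ∀ s ∈ S, s.totalDegree ≤ e) :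
    ∃ (n : ℕ) (g : Fin n → MvPolynomial (Fin N) K) (dg : Fin n → ℕ), n ≤ strongBound e m ∧
      Nice g dg ∧ (∀ i, dg i ≤ e) ∧
      (S : Set (MvPolynomial (Fin N) K)) ⊆ Algebra.adjoin K (Set.range g) := by
  classical
  obtain ⟨μ, S', h1, h2, h3, h4, h5, h6⟩ := hS.exists_strong e hm
  obtain ⟨g, hinj, hrange, hmon⟩ := exists_sorted_enum S' totalDegree
  have hg : ∀ i, g i ∈ S' := fun i => by
    have : g i ∈ Set.range g := ⟨i, rfl⟩
    rwa [hrange] at this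
  have hle' : ∀ i, (g i).totalDegree ≤ e := fun i => by
    by_contra! hc
    exact absurd (hle _ ((h5 _ hc).1 (hg i))) (by omega)
  refine ⟨S'.card, g, fun i => (g i).totalDegree, h2.trans h3, ?_, hle', ?_⟩
  · refine StrongFam.nice ih h2 (fun i => (h1 _ (hg i)).2.2) (fun i => (h1 _ (hg i)).2.1) hle'
      hmon ?_
    intro e' h0 he' γ hγ hw i
    have himg : S' = Finset.univ.image g := by
      rw [← Finset.coe_inj, ← hrange]
      simp
    by_contra hi
    refine hi ?_
    let γ' : MvPolynomial (Fin N) K → K := Function.extend g γ 0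
    have hγ' : ∀ i, γ' (g i) = γ i := fun i => hinj.extend_apply _ _ _
    rw [← hγ' i]
    refine h6 e' h0 he' γ' ?_ (g i) (hg i) (hγ i hi)
    convert hw using 1
    rw [Finset.sum_filter]
    nth_rw 1 [himg]
    rw [Finset.sum_image hinj.injOn]
    refine Finset.sum_congr rfl fun j _ => ?_
    rw [hγ']
    split_ifs with hj
    · rfl
    · have : γ j = 0 := by
        by_contra hc
        exact hj (hγ j hc)
      rw [this, C_0, zero_mul]
  · rw [hrange]
    exact h4

lemma niceCover_strongBound [IsAlgClosed K] (e k : ℕ) : NiceCover K N e k (strongBound e k) := by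
  classical
  induction e using Nat.strong_induction_on generalizing k with
  | _ e ih =>
  intro h hcard hom
  rcases Nat.eq_zero_or_pos e with rfl | he
  · obtain ⟨n, g, dg, h1, h2, h3, -⟩ := FormSet.exists_nice (K := K) (N := N) (e := 0) (m := k)
      (fun e' h => absurd h (Nat.not_lt_zero _)) (S := ∅) (fun s hs => by simp at hs) (by simp)
      (by simp)
    refine ⟨n, g, dg, h1, h2, h3, fun p hp => ?_⟩
    have := totalDegree_eq_zero_iff_eq_C.1 (Nat.le_zero.1 (hom p hp).totalDegree_le)
    rw [this]
    exact Subalgebra.algebraMap_mem _ _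
  · have hdeg : ∀ p ∈ h.filter (· ≠ 0), p.totalDegree = e := fun p hp =>
      (hom p (Finset.mem_filter.1 hp).1).totalDegree (Finset.mem_filter.1 hp).2
    obtain ⟨n, g, dg, h1, h2, h3, h4⟩ := FormSet.exists_nice (e := e) (m := k) ih
      (S := h.filter (· ≠ 0)) (fun s hs => by
        rw [hdeg s hs]
        exact ⟨(Finset.mem_filter.1 hs).2, he, hom s (Finset.mem_filter.1 hs).1⟩)
      ((Finset.card_filter_le _ _).trans hcard) (fun s hs => (hdeg s hs).le)
    refine ⟨n, g, dg, h1, h2, h3, fun p hp => ?_⟩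
    by_cases hp0 : p = 0
    · rw [hp0]
      exact Subalgebra.zero_mem _
    · exact h4 (by simpa [hp0] using hp)

end

section LinearSystems

variable {A : Type*} [CommRing A] {ι : Type*} {κ : Type}

/-- The solution module of a (possibly infinite) homogeneous linear system. -/
def linSol [Fintype κ] (M : ι → κ → A) : Submodule A (κ → A) where
  carrier := {s | ∀ i, ∑ j, M i j * s j = 0}
  zero_mem' := fun i => by simp
  add_mem' := fun {s t} hs ht i => by
    simp only [Pi.add_apply, mul_add, Finset.sum_add_distrib, hs i, ht i, add_zero]
  smul_mem' := fun a s hs i => by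
    have : ∑ j, M i j * (a • s) j = a * ∑ j, M i j * s j := by
      rw [Finset.mul_sum]
      refine Finset.sum_congr rfl fun j _ => ?_
      simp only [Pi.smul_apply, smul_eq_mul]
      ring
    rw [this, hs i, mul_zero]

lemma mem_linSol [Fintype κ] {M : ι → κ → A} {s : κ → A} :
    s ∈ linSol M ↔ ∀ i, ∑ j, M i j * s j = 0 := Iff.rfl

lemma exists_rows_linSol [Fintype κ] [IsDomain A] (M : ι → κ → A) :
    ∃ (ρ : ℕ) (r : Fin ρ → ι) (c : Fin ρ → κ), ρ ≤ Fintype.card κ ∧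
      (Matrix.of fun a b => M (r a) (c b)).det ≠ 0 ∧
      ∀ s, (∀ k, ∑ j, M (r k) j * s j = 0) → s ∈ linSol M := by
  let L := FractionRing A
  let φ : A →+* L := algebraMap A L
  have hφ : Function.Injective φ := IsFractionRing.injective A L
  let v : ι → κ → L := fun i j => φ (M i j)
  obtain ⟨J, a, ha, hspan, hli⟩ := exists_linearIndependent' L v
  have : Finite J := hli.finite
  have : Fintype J := Fintype.ofFinite J
  obtain ⟨e⟩ : Nonempty (Fin (Fintype.card J) ≃ J) := ⟨(Fintype.equivFin J).symm⟩
  have hli' : LinearIndependent L (Matrix.of fun k j => v (a (e k)) j).row :=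
    hli.comp e e.injective
  obtain ⟨c, hc⟩ := Matrix.exists_det_submatrix_ne_zero _ hli'
  refine ⟨Fintype.card J, fun k => a (e k), c, ?_, ?_, ?_⟩
  · simpa using hli.fintype_card_le_finrank
  · intro h
    refine hc ?_
    have h2 := congrArg φ h
    rw [RingHom.map_det, map_zero] at h2
    exact h2
  · intro s hs i
    have h1 : v i ∈ Submodule.span L (Set.range (v ∘ a)) := by
      rw [hspan]
      exact Submodule.subset_span ⟨i, rfl⟩
    have h2 : ∀ x ∈ Submodule.span L (Set.range (v ∘ a)), ∑ j, x j * φ (s j) = 0 := by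
      intro x hx
      induction hx using Submodule.span_induction with
      | mem x hx =>
        obtain ⟨k, rfl⟩ := hx
        have h3 := congrArg φ (hs (e.symm k))
        simp only [e.apply_symm_apply] at h3
        rw [map_sum, map_zero] at h3
        rw [← h3]
        exact Finset.sum_congr rfl fun j _ => (map_mul _ _ _).symm
      | zero => simp
      | add x y _ _ hx hy => simp [add_mul, Finset.sum_add_distrib, hx, hy]
      | smul l x _ hx =>
        simp only [Pi.smul_apply, smul_eq_mul, mul_assoc, ← Finset.mul_sum, hx, mul_zero]
    refine hφ ?_
    rw [map_zero, ← h2 _ h1, map_sum]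
    exact Finset.sum_congr rfl fun j _ => map_mul _ _ _

/-- The solution of a linear system given by Cramer's rule. -/
def cramerVec [DecidableEq κ] {ρ : ℕ} (M : Fin ρ → κ → A) (c : Fin ρ → κ) (j : κ) : κ → A :=
  fun j' => (if j' = j then (Matrix.of fun a b => M a (c b)).det else 0) -
    ∑ k, if j' = c k then Matrix.cramer (Matrix.of fun a b => M a (c b)) (fun l => M l j) k else 0

lemma sum_mul_cramerVec [Fintype κ] [DecidableEq κ] {ρ : ℕ} (M : Fin ρ → κ → A) (c : Fin ρ → κ)
    (j : κ) (a : Fin ρ) :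
    ∑ j', M a j' * cramerVec M c j j' = 0 := by
  have h := congrFun (Matrix.mulVec_cramer (Matrix.of fun a b => M a (c b)) (fun l => M l j)) a
  simp only [Matrix.mulVec, dotProduct, Matrix.of_apply, Pi.smul_apply, smul_eq_mul] at h
  simp only [cramerVec, mul_sub, Finset.sum_sub_distrib, mul_ite, mul_zero, Finset.sum_ite_eq',
    Finset.mem_univ, if_true, Finset.mul_sum]
  rw [Finset.sum_comm]
  simp only [Finset.sum_ite_eq', Finset.mem_univ, if_true]
  rw [h]
  ring

lemma cramerVec_apply_of_notMem [DecidableEq κ] {ρ : ℕ} (M : Fin ρ → κ → A) (c : Fin ρ → κ) (j : κ)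
    {j' : κ}
    (h : j' ∉ Set.range c) :
    cramerVec M c j j' = if j' = j then (Matrix.of fun a b => M a (c b)).det else 0 := by
  rw [cramerVec, Finset.sum_eq_zero, sub_zero]
  intro k _
  rw [if_neg fun e => h ⟨k, e.symm⟩]

lemma injective_of_det_ne_zero {ρ : ℕ} {M : Fin ρ → κ → A} {c : Fin ρ → κ}
    (h : (Matrix.of fun a b => M a (c b)).det ≠ 0) : Function.Injective c := by
  intro k k' hk
  by_contra hne
  exact h (Matrix.det_zero_of_column_eq hne fun a => by simp [hk])

lemma cramerVec_apply_self [DecidableEq κ] {ρ : ℕ} {M : Fin ρ → κ → A} {c : Fin ρ → κ}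
    (hc : Function.Injective c)
    (j : κ) (k : Fin ρ) : cramerVec M c j (c k) =
      (if c k = j then (Matrix.of fun a b => M a (c b)).det else 0) -
        Matrix.cramer (Matrix.of fun a b => M a (c b)) (fun l => M l j) k := by
  rw [cramerVec]
  congr 1
  rw [Finset.sum_eq_single k]
  · rw [if_pos rfl]
  · intro k' _ hk
    rw [if_neg fun e => hk (hc e).symm]
  · simp

lemma cramerVec_of_mem [DecidableEq κ] {ρ : ℕ} {M : Fin ρ → κ → A} {c : Fin ρ → κ}
    (hc : Function.Injective c)
    (k₀ : Fin ρ) : cramerVec M c (c k₀) = 0 := by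
  funext j'
  by_cases h : j' ∈ Set.range c
  · obtain ⟨k, rfl⟩ := h
    rw [cramerVec_apply_self hc]
    rw [Matrix.cramer_row_self (Matrix.of fun a b => M a (c b)) (fun l => M l (c k₀)) k₀
      fun _ => rfl, Pi.single_apply]
    by_cases hk : k = k₀
    · simp [hk]
    · simp [hk, hc.ne hk]
  · rw [cramerVec_apply_of_notMem _ _ _ h, if_neg fun e => h ⟨k₀, e.symm⟩]
    rfl

/-- Cramer's rule. -/
lemma det_smul_eq_sum_cramerVec [Fintype κ] [DecidableEq κ] {ρ : ℕ} (M : Fin ρ → κ → A)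
    (c : Fin ρ → κ) {s : κ → A}
    (hs : ∀ k, ∑ j, M k j * s j = 0) :
    (Matrix.of fun a b => M a (c b)).det • s = ∑ j, s j • cramerVec M c j := by
  funext j'
  simp only [Finset.sum_apply, Pi.smul_apply, smul_eq_mul, cramerVec, mul_sub,
    Finset.sum_sub_distrib, mul_ite, mul_zero, Finset.sum_ite_eq, Finset.mem_univ, if_true,
    Finset.mul_sum]
  rw [Finset.sum_comm]
  have h1 : ∀ k,
      ∑ j, s j * Matrix.cramer (Matrix.of fun a b => M a (c b)) (fun l => M l j) k = 0 := by
    intro k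
    simp only [Matrix.cramer_eq_adjugate_mulVec, Matrix.mulVec, dotProduct, Finset.mul_sum]
    rw [Finset.sum_comm]
    refine Finset.sum_eq_zero fun l _ => ?_
    have := hs l
    rw [← mul_zero ((Matrix.of fun a b => M a (c b)).adjugate k l), ← this, Finset.mul_sum]
    exact Finset.sum_congr rfl fun j _ => by ring
  rw [Finset.sum_eq_zero, sub_zero, mul_comm]
  intro k _
  split_ifs with h
  · exact h1 k
  · simp

end LinearSystems

namespace Polynomial

variable {S : Type*} [CommRing S]

lemma natDegree_det_le_of_forall_le {ρ D : ℕ} {M : Matrix (Fin ρ) (Fin ρ) S[X]}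
    (h : ∀ i j, (M i j).natDegree ≤ D) : M.det.natDegree ≤ ρ * D := by
  rw [Matrix.det_apply]
  refine natDegree_sum_le_of_forall_le _ _ fun τ _ => ?_
  refine (natDegree_smul_le _ _).trans ((natDegree_prod_le _ _).trans ?_)
  refine (Finset.sum_le_sum fun i _ => h _ _).trans ?_
  simp

variable {ι : Type*} {κ : Type}

/-- The linear system for the coefficients of the solutions of degree less than `E`. -/
noncomputable def coeffSystem (M : ι → κ → S[X]) (E : ℕ) : ι × ℕ → κ × Fin E → S :=
  fun i j => (M i.1 j.1 * X ^ (j.2 : ℕ)).coeff i.2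

/-- The vector of polynomials with given coefficients. -/
noncomputable def ofCoeffs (E : ℕ) (t : κ × Fin E → S) : κ → S[X] :=
  fun j => ∑ a : Fin E, C (t (j, a)) * X ^ (a : ℕ)

/-- `ofCoeffs` as a linear map. -/
noncomputable def ofCoeffsLin (E : ℕ) : (κ × Fin E → S) →ₗ[S] κ → S[X] where
  toFun := ofCoeffs E
  map_add' t t' := by
    funext j
    simp [ofCoeffs, add_mul, Finset.sum_add_distrib]
  map_smul' a t := by
    funext j
    simp [ofCoeffs, smul_eq_C_mul, mul_assoc, Finset.mul_sum]

lemma ofCoeffs_mem_linSol [Fintype κ] (M : ι → κ → S[X]) (E : ℕ) (t : κ × Fin E → S) :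
    ofCoeffs E t ∈ linSol M ↔ t ∈ linSol (coeffSystem M E) := by
  have key : ∀ i b, (∑ j, M i j * ofCoeffs E t j).coeff b =
      ∑ j, coeffSystem M E (i, b) j * t j := by
    intro i b
    rw [finsetSum_coeff, Fintype.sum_prod_type]
    refine Finset.sum_congr rfl fun j _ => ?_
    rw [ofCoeffs, Finset.mul_sum, finsetSum_coeff]
    refine Finset.sum_congr rfl fun a _ => ?_
    rw [mul_left_comm, coeff_C_mul, coeffSystem, mul_comm]
  constructor
  · rintro h ⟨i, b⟩
    rw [← key, h i, coeff_zero]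
  · intro h i
    ext b
    rw [key, h (i, b), coeff_zero]

lemma exists_ofCoeffs_eq {E : ℕ} {s : κ → S[X]} (h : ∀ j, (s j).degree < E) :
    ∃ t, ofCoeffs E t = s := by
  refine ⟨fun j => (s j.1).coeff j.2, ?_⟩
  funext j
  rw [ofCoeffs, Fin.sum_univ_eq_sum_range (fun a => C ((s j).coeff a) * X ^ a) E]
  ext b
  simp only [finsetSum_coeff, coeff_C_mul_X_pow, Finset.sum_ite_eq, Finset.mem_range]
  split_ifs with hb
  · rfl
  · exact (coeff_eq_zero_of_degree_lt ((h j).trans_le (by exact_mod_cast not_lt.1 hb))).symm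

lemma exists_generators_linSol [IsDomain S] [Fintype κ] {D E : ℕ} (hE : Fintype.card κ * D < E)
    {M : ι → κ → S[X]}
    (hD : ∀ i j, (M i j).natDegree ≤ D) {ρ : ℕ} {r : Fin ρ → ι} {c : Fin ρ → κ}
    (hρ : ρ ≤ Fintype.card κ)
    (hdet : IsUnit (Matrix.of fun a b => M (r a) (c b)).det.leadingCoeff)
    (hr : ∀ s, (∀ k, ∑ j, M (r k) j * s j = 0) → s ∈ linSol M)
    {G : Finset (κ × Fin E → S)}
    (hG : Submodule.span S (G : Set _) = linSol (coeffSystem M E)) :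
    ∃ G' : Finset (κ → S[X]), G'.card ≤ Fintype.card κ + G.card ∧
      Submodule.span S[X] (G' : Set _) = linSol M := by
  classical
  set Δ := (Matrix.of fun a b => M (r a) (c b)).det with hΔ
  have hΔ0 : Δ ≠ 0 := by
    intro h
    rw [h, leadingCoeff_zero] at hdet
    exact not_isUnit_zero hdet
  have hc := injective_of_det_ne_zero hΔ0
  let u : κ → κ → S[X] := cramerVec (fun a => M (r a)) c
  have hu : ∀ j, u j ∈ linSol M := fun j => hr _ fun k => sum_mul_cramerVec _ _ _ _
  let G' := Finset.univ.image u ∪ G.image (ofCoeffs E)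
  refine ⟨G', ?_, ?_⟩
  · refine (Finset.card_union_le _ _).trans (add_le_add ?_ Finset.card_image_le)
    exact Finset.card_image_le.trans (by simp)
  have hu' : ∀ j, u j ∈ Submodule.span S[X] (G' : Set (κ → S[X])) := fun j =>
    Submodule.subset_span (by simp [G'])
  have hlow : ∀ s ∈ linSol M, (∀ j, (s j).degree < E) →
      s ∈ Submodule.span S[X] (G' : Set (κ → S[X])) := by
    intro s hs hdeg
    obtain ⟨t, rfl⟩ := exists_ofCoeffs_eq hdeg
    rw [ofCoeffs_mem_linSol, ← hG] at hs
    have h1 := Submodule.mem_map_of_mem (f := ofCoeffsLin E) hs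
    rw [Submodule.map_span] at h1
    refine Submodule.span_le_restrictScalars S S[X] _ (Submodule.span_mono ?_ h1)
    rintro _ ⟨t, ht, rfl⟩
    rw [Finset.mem_coe]
    exact Finset.mem_union_right _ (Finset.mem_image_of_mem _ ht)
  refine le_antisymm (Submodule.span_le.2 ?_) fun s hs => ?_
  · intro s hs
    rcases Finset.mem_union.1 hs with hs | hs
    · obtain ⟨j, -, rfl⟩ := Finset.mem_image.1 hs
      exact hu j
    · obtain ⟨t, ht, rfl⟩ := Finset.mem_image.1 hs
      rw [SetLike.mem_coe, ofCoeffs_mem_linSol, ← hG]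
      exact Submodule.subset_span ht
  obtain ⟨b, hb⟩ := hdet
  have hdiv : ∀ j, ∃ t : S[X], (s j - t * Δ).degree < Δ.degree := by
    intro j
    have hmon : (C (↑b⁻¹ : S) * Δ).Monic := by
      rw [Monic, leadingCoeff_mul, leadingCoeff_C, ← hb, Units.inv_mul]
    refine ⟨s j /ₘ (C (↑b⁻¹ : S) * Δ) * C (↑b⁻¹ : S), ?_⟩
    have h1 := modByMonic_add_div (s j) (C (↑b⁻¹ : S) * Δ)
    have h2 := degree_modByMonic_lt (s j) hmon
    rw [degree_C_mul b⁻¹.ne_zero] at h2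
    have h3 : s j - s j /ₘ (C (↑b⁻¹ : S) * Δ) * C (↑b⁻¹ : S) * Δ = s j %ₘ (C (↑b⁻¹ : S) * Δ) := by
      linear_combination -h1
    rwa [h3]
  choose t ht using hdiv
  set s' := s - ∑ j, t j • u j with hs'def
  have hs' : s' ∈ linSol M :=
    Submodule.sub_mem _ hs (Submodule.sum_mem _ fun j _ => Submodule.smul_mem _ _ (hu j))
  have hback : s = s' + ∑ j, t j • u j := by rw [hs'def, sub_add_cancel]
  rw [hback]
  refine Submodule.add_mem _ (hlow s' hs' ?_)
    (Submodule.sum_mem _ fun j _ => Submodule.smul_mem _ _ (hu' j))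
  have hΔdeg : Δ.natDegree ≤ ρ * D := natDegree_det_le_of_forall_le fun i j => hD _ _
  have hρD : ρ * D ≤ Fintype.card κ * D := Nat.mul_le_mul_right _ hρ
  have hnot : ∀ j, j ∉ Set.range c → (s' j).degree < Δ.degree := by
    intro j hj
    have huj : ∀ j', u j' j = if j = j' then Δ else 0 := fun j' =>
      cramerVec_apply_of_notMem _ _ _ hj
    convert ht j using 2
    rw [hs'def, Pi.sub_apply, Finset.sum_apply, Finset.sum_eq_single j]
    · rw [Pi.smul_apply, huj j, if_pos rfl, smul_eq_mul]
    · intro j' _ hne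
      rw [Pi.smul_apply, huj j', if_neg hne.symm, smul_zero]
    · simp
  have hlt : Δ.degree < E := by
    rw [degree_eq_natDegree hΔ0]
    exact_mod_cast (by omega : Δ.natDegree < E)
  intro j
  by_cases hj : j ∈ Set.range c
  swap
  · exact (hnot j hj).trans hlt
  obtain ⟨k, rfl⟩ := hj
  by_cases h0 : s' (c k) = 0
  · rw [h0, degree_zero]
    exact WithBot.bot_lt_coe E
  have h1 := congrFun (det_smul_eq_sum_cramerVec (fun a => M (r a)) c fun a => hs' (r a)) (c k)
  rw [Finset.sum_apply, Pi.smul_apply, smul_eq_mul] at h1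
  have h2 : Δ * s' (c k) ∈ degreeLT S (Δ.natDegree + ρ * D) := by
    rw [h1]
    refine Submodule.sum_mem _ fun j _ => ?_
    rw [Pi.smul_apply, smul_eq_mul]
    by_cases hj : j ∈ Set.range c
    · obtain ⟨k', rfl⟩ := hj
      rw [cramerVec_of_mem hc, Pi.zero_apply, mul_zero]
      exact Submodule.zero_mem _
    by_cases hsj : s' j = 0
    · rw [hsj, zero_mul]
      exact Submodule.zero_mem _
    rw [cramerVec_apply_self hc, if_neg fun e => hj ⟨k, e⟩, zero_sub, mem_degreeLT]
    have h3 := natDegree_lt_natDegree hsj (hnot j hj)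
    have h4 : (Matrix.cramer (Matrix.of fun a b => M (r a) (c b))
        (fun l => M (r l) j) k).natDegree ≤ ρ * D := by
      rw [Matrix.cramer_apply]
      refine natDegree_det_le_of_forall_le fun a b => ?_
      rw [Matrix.updateCol_apply]
      split_ifs
      · exact hD _ _
      · exact hD _ _
    refine lt_of_le_of_lt degree_le_natDegree ?_
    have h5 := natDegree_mul_le (p := s' j)
      (q := -(Matrix.cramer (Matrix.of fun a b => M (r a) (c b))
        (fun l => M (r l) j) k))
    rw [natDegree_neg] at h5
    exact_mod_cast (by omega)
  rw [mem_degreeLT, degree_eq_natDegree (mul_ne_zero hΔ0 h0), natDegree_mul hΔ0 h0] at h2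
  have h3 : Δ.natDegree + (s' (c k)).natDegree < Δ.natDegree + ρ * D := by exact_mod_cast h2
  rw [degree_eq_natDegree h0]
  exact_mod_cast (by omega : (s' (c k)).natDegree < E)

end Polynomial

section ChangeOfCoordinates

variable {K : Type*} [Field K]

lemma totalDegree_aeval_le_of_isHomogeneous {σ τ : Type*} (p : MvPolynomial σ K)
    {g : σ → MvPolynomial τ K} (hg : ∀ i, (g i).IsHomogeneous 1) :
    (aeval g p).totalDegree ≤ p.totalDegree := by
  conv_lhs => rw [← sum_homogeneousComponent p, map_sum]
  refine totalDegree_finsetSum_le fun i hi => ?_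
  refine ((homogeneousComponent_isHomogeneous i p).aeval g hg).totalDegree_le.trans ?_
  have := Finset.mem_range.1 hi
  omega

lemma coeff_aeval_C_mul_X {σ : Type*} (b : σ → K) (p : MvPolynomial σ K) (k : ℕ) :
    (aeval (fun i => Polynomial.C (b i) * Polynomial.X) p).coeff k =
      eval b (homogeneousComponent k p) := by
  induction p using MvPolynomial.induction_on' with
  | add p q hp hq => rw [map_add, Polynomial.coeff_add, hp, hq, map_add, map_add]
  | monomial u a =>
    have h1 : aeval (fun i => Polynomial.C (b i) * Polynomial.X) (monomial u a) =
        Polynomial.C (eval b (monomial u a)) * Polynomial.X ^ u.degree := by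
      rw [aeval_monomial, eval_monomial, Finsupp.degree_apply, Finsupp.prod, Finsupp.prod,
        ← Finset.prod_pow_eq_pow_sum]
      simp only [mul_pow, Finset.prod_mul_distrib, map_mul, map_prod, map_pow, mul_assoc]
      rfl
    have h2 : (monomial u a).IsHomogeneous u.degree := isHomogeneous_monomial _ rfl
    rw [h1, Polynomial.coeff_C_mul_X_pow, homogeneousComponent_of_mem h2]
    split_ifs <;> simp

lemma homogeneousComponent_totalDegree_ne_zero {σ : Type*} {p : MvPolynomial σ K} (hp : p ≠ 0) :
    homogeneousComponent p.totalDegree p ≠ 0 := by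
  intro h
  rcases Nat.eq_zero_or_pos p.totalDegree with h0 | h0
  · have h1 := sum_homogeneousComponent p
    rw [h0] at h h1
    rw [Finset.sum_range_one, h] at h1
    exact hp h1.symm
  · have h1 := sum_homogeneousComponent p
    rw [Finset.sum_range_succ, h, add_zero] at h1
    have h2 : p.totalDegree ≤ p.totalDegree - 1 := by
      conv_lhs => rw [← h1]
      refine totalDegree_finsetSum_le fun i hi => ?_
      refine (homogeneousComponent_isHomogeneous i p).totalDegree_le.trans ?_
      have := Finset.mem_range.1 hi
      omega
    omega

/-- The substitution `X i.succ ↦ X i.succ + b i * X 0`. -/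
noncomputable def shear {m : ℕ} (b : Fin m → K) :
    MvPolynomial (Fin (m + 1)) K →ₐ[K] MvPolynomial (Fin (m + 1)) K :=
  aeval (Fin.cases (X 0) fun i => X i.succ + C (b i) * X 0)

lemma shear_comp_neg {m : ℕ} (b : Fin m → K) :
    (shear b).comp (shear (-b)) = AlgHom.id K _ := by
  refine algHom_ext fun i => ?_
  refine Fin.cases ?_ (fun i => ?_) i
  · simp [shear]
  · simp [shear]

/-- `shear` as an automorphism. -/
noncomputable def shearEquiv {m : ℕ} (b : Fin m → K) :
    MvPolynomial (Fin (m + 1)) K ≃ₐ[K] MvPolynomial (Fin (m + 1)) K :=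
  AlgEquiv.ofAlgHom (shear b) (shear (-b)) (shear_comp_neg b) (by
    simpa using shear_comp_neg (-b))

lemma totalDegree_shear_le {m : ℕ} (b : Fin m → K) (p) :
    (shear b p).totalDegree ≤ p.totalDegree := by
  refine totalDegree_aeval_le_of_isHomogeneous p fun i => ?_
  refine Fin.cases (isHomogeneous_X _ _) (fun i => ?_) i
  refine (isHomogeneous_X _ _).add ?_
  simpa using (isHomogeneous_C _ (b i)).mul (isHomogeneous_X K (0 : Fin (m + 1)))

lemma exists_eval_cons_ne_zero [Infinite K] {m δ : ℕ} {p : MvPolynomial (Fin (m + 1)) K}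
    (hp : p.IsHomogeneous δ) (h0 : p ≠ 0) : ∃ b : Fin m → K, eval (Fin.cons 1 b) p ≠ 0 := by
  have h1 : X 0 * p ≠ 0 := mul_ne_zero (X_ne_zero _) h0
  obtain ⟨v, hv⟩ : ∃ v, eval v (X 0 * p) ≠ 0 := by
    by_contra! h
    exact h1 (MvPolynomial.funext fun v => by rw [h v, map_zero])
  rw [map_mul, eval_X] at hv
  have hv0 : v 0 ≠ 0 := left_ne_zero_of_mul hv
  refine ⟨fun i => (v 0)⁻¹ * v i.succ, fun h => right_ne_zero_of_mul hv ?_⟩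
  have h2 : v = fun i => v 0 * (Fin.cons 1 (fun i => (v 0)⁻¹ * v i.succ) : Fin (m + 1) → K) i := by
    funext i
    refine Fin.cases ?_ (fun i => ?_) i
    · simp
    · simp [mul_inv_cancel_left₀ hv0]
  have h3 : eval v p = v 0 ^ δ * eval (Fin.cons 1 (fun i => (v 0)⁻¹ * v i.succ)) p := by
    conv_lhs => rw [h2]
    rw [eval_eq, eval_eq, Finset.mul_sum]
    refine Finset.sum_congr rfl fun d hd => ?_
    have h4 : ∑ i ∈ d.support, d i = δ := by
      rw [← Finsupp.degree_apply, Finsupp.degree_eq_weight_one]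
      exact hp (mem_support_iff.1 hd)
    rw [← h4, ← Finset.prod_pow_eq_pow_sum, mul_left_comm, ← Finset.prod_mul_distrib]
    simp only [mul_pow]
  rw [h3, h, mul_zero]

/-- After a generic shear, a polynomial has unit leading coefficient in the first variable. -/
lemma exists_isUnit_leadingCoeff_finSuccEquiv [Infinite K] {m : ℕ}
    {p : MvPolynomial (Fin (m + 1)) K}
    (hp : p ≠ 0) : ∃ b : Fin m → K, IsUnit (finSuccEquiv K m (shear b p)).leadingCoeff := by
  obtain ⟨b, hb⟩ := exists_eval_cons_ne_zero (homogeneousComponent_isHomogeneous _ p)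
    (homogeneousComponent_totalDegree_ne_zero hp)
  refine ⟨b, ?_⟩
  rw [← coeff_aeval_C_mul_X] at hb
  set P := finSuccEquiv K m (shear b p) with hP
  have h1 : P.map constantCoeff =
      aeval (fun i => Polynomial.C ((Fin.cons 1 b : Fin (m + 1) → K) i) * Polynomial.X) p := by
    have : ((Polynomial.mapRingHom constantCoeff).comp
        ((finSuccEquiv K m).toRingEquiv.toRingHom.comp (shear b).toRingHom)) =
        (aeval (R := K) fun i =>
          Polynomial.C ((Fin.cons 1 b : Fin (m + 1) → K) i) * Polynomial.X).toRingHom := by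
      refine ringHom_ext (fun r => ?_) fun i => ?_
      · simp [shear, finSuccEquiv_apply]
      · refine Fin.cases ?_ (fun i => ?_) i
        · simp [shear, finSuccEquiv_apply]
        · simp [shear, finSuccEquiv_apply]
    exact congrArg (fun f => f p) this
  rw [← h1, Polynomial.coeff_map] at hb
  have h2 : P.coeff p.totalDegree ≠ 0 := fun h => hb (by rw [h, map_zero])
  have h3 := totalDegree_coeff_finSuccEquiv_add_le (shear b p) p.totalDegree h2
  have h4 := totalDegree_shear_le b p
  have h5 : P.natDegree ≤ p.totalDegree := by
    rw [hP, natDegree_finSuccEquiv]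
    exact (degreeOf_le_totalDegree _ _).trans h4
  have h6 := le_antisymm h5 (Polynomial.le_natDegree_of_ne_zero h2)
  have h7 : (P.coeff p.totalDegree).totalDegree = 0 := by
    have h8 : (P.coeff p.totalDegree).totalDegree + p.totalDegree ≤ (shear b p).totalDegree := h3
    omega
  rw [Polynomial.leadingCoeff, h6, totalDegree_eq_zero_iff_eq_C.1 h7]
  refine (IsUnit.mk0 _ ?_).map C
  intro h
  rw [totalDegree_eq_zero_iff_eq_C.1 h7, h, map_zero, map_zero] at hb
  exact hb rfl

end ChangeOfCoordinates

/-- Hermann's bound for the number of generators of the solutions of a linear system in `q`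
unknowns over a polynomial ring in `m` variables, with coefficients of degree at most `D`. -/
def hermannBound : ℕ → ℕ → ℕ → ℕ
  | 0, q, _ => q
  | m + 1, q, D => q + hermannBound m (q * (q * D + 1)) D

section Hermann

/-- Transport of solutions along a ring isomorphism. -/
lemma exists_generators_linSol_of_equiv {A B : Type*} [CommRing A] [CommRing B] (φ : A ≃+* B)
    {ι : Type*} {κ : Type} [Fintype κ] (M : ι → κ → A) {G : Finset (κ → B)}
    (hG : Submodule.span B (G : Set _) = linSol fun i j => φ (M i j)) :
    ∃ G' : Finset (κ → A), G'.card ≤ G.card ∧ Submodule.span A (G' : Set _) = linSol M := by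
  classical
  let e : (κ → B) → (κ → A) := fun s j => φ.symm (s j)
  have hmem : ∀ s : κ → B, e s ∈ linSol M ↔ s ∈ linSol fun i j => φ (M i j) := by
    intro s
    rw [mem_linSol, mem_linSol]
    refine forall_congr' fun i => ?_
    rw [← φ.injective.eq_iff, map_sum, map_zero]
    simp [e]
  refine ⟨G.image e, Finset.card_image_le, le_antisymm (Submodule.span_le.2 ?_) ?_⟩
  · intro s hs
    obtain ⟨s, hsG, rfl⟩ := Finset.mem_image.1 (Finset.mem_coe.1 hs)
    rw [SetLike.mem_coe, hmem, ← hG]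
    exact Submodule.subset_span hsG
  · intro s hs
    have hse : e (fun j => φ (s j)) = s := by simp [e]
    rw [← hse, hmem, ← hG] at hs
    rw [← hse]
    generalize (fun j => φ (s j)) = s' at hs
    induction hs using Submodule.span_induction with
    | mem x hx =>
      exact Submodule.subset_span (Finset.mem_coe.2 (Finset.mem_image_of_mem _ hx))
    | zero =>
      have : e 0 = 0 := by funext j; simp [e]
      rw [this]
      exact Submodule.zero_mem _
    | add x y _ _ hx hy =>
      have : e (x + y) = e x + e y := by funext j; simp [e]
      rw [this]
      exact Submodule.add_mem _ hx hy
    | smul a x _ hx =>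
      have : e (a • x) = φ.symm a • e x := by funext j; simp [e]
      rw [this]
      exact Submodule.smul_mem _ _ hx

variable {K : Type*} [Field K]

theorem exists_generators_linSol_le_hermannBound [Infinite K] (D m : ℕ) :
    ∀ {ι : Type} {κ : Type} [Fintype κ] (M : ι → κ → MvPolynomial (Fin m) K),
      (∀ i j, (M i j).totalDegree ≤ D) →
      ∃ G : Finset (κ → MvPolynomial (Fin m) K), G.card ≤ hermannBound m (Fintype.card κ) D ∧
        Submodule.span _ (G : Set _) = linSol M := by
  classical
  induction m with
  | zero =>
    intro ι κ _ M hM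
    obtain ⟨ρ, r, c, hρ, hdet, hr⟩ := exists_rows_linSol M
    refine ⟨Finset.univ.image (cramerVec (fun a => M (r a)) c), ?_, le_antisymm ?_ ?_⟩
    · exact Finset.card_image_le.trans (by simp [hermannBound])
    · refine Submodule.span_le.2 ?_
      intro s hs
      obtain ⟨j, -, rfl⟩ := Finset.mem_image.1 (Finset.mem_coe.1 hs)
      exact hr _ fun k => sum_mul_cramerVec _ _ _ _
    · intro s hs
      have h1 := det_smul_eq_sum_cramerVec (fun a => M (r a)) c fun a => hs (r a)
      set Δ := (Matrix.of fun a b => M (r a) (c b)).det with hΔ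
      have h2 : IsUnit Δ := by
        rw [eq_C_of_isEmpty Δ] at hdet ⊢
        exact (IsUnit.mk0 _ fun h => hdet (by rw [h, map_zero])).map C
      obtain ⟨u, hu⟩ := h2
      have h3 : s =
          (↑u⁻¹ : MvPolynomial (Fin 0) K) • ∑ j, s j • cramerVec (fun a => M (r a)) c j := by
        rw [← h1, ← hu, smul_smul, Units.inv_mul, one_smul]
      rw [h3]
      refine Submodule.smul_mem _ _ (Submodule.sum_mem _ fun j _ => Submodule.smul_mem _ _ ?_)
      exact Submodule.subset_span (by simp)
  | succ m ih =>
    intro ι κ _ M hM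
    obtain ⟨ρ, r, c, hρ, hdet, hr⟩ := exists_rows_linSol M
    obtain ⟨b, hb⟩ := exists_isUnit_leadingCoeff_finSuccEquiv hdet
    let φ : MvPolynomial (Fin (m + 1)) K ≃+* Polynomial (MvPolynomial (Fin m) K) :=
      ((shearEquiv b).trans (finSuccEquiv K m)).toRingEquiv
    have hφ : ∀ p, φ p = finSuccEquiv K m (shear b p) := fun p => rfl
    have hdeg : ∀ i j, (φ (M i j)).natDegree ≤ D := fun i j => by
      rw [hφ, natDegree_finSuccEquiv]
      exact (degreeOf_le_totalDegree _ _).trans ((totalDegree_shear_le b _).trans (hM i j))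
    have hcoeff : ∀ i j k, ((φ (M i j)).coeff k).totalDegree ≤ D := fun i j k => by
      by_cases h : (φ (M i j)).coeff k = 0
      · rw [h, totalDegree_zero]
        exact Nat.zero_le _
      · have h1 := totalDegree_coeff_finSuccEquiv_add_le (shear b (M i j)) k h
        have h2 := (totalDegree_shear_le b _).trans (hM i j)
        rw [hφ]
        omega
    obtain ⟨G, hGc, hG⟩ := ih (Polynomial.coeffSystem (fun i j => φ (M i j))
        (Fintype.card κ * D + 1)) (fun i j => by
      rw [Polynomial.coeffSystem, Polynomial.coeff_mul_X_pow']
      split_ifs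
      · exact hcoeff _ _ _
      · rw [totalDegree_zero]
        exact Nat.zero_le _)
    obtain ⟨G', hG'c, hG'⟩ := Polynomial.exists_generators_linSol (Nat.lt_succ_self _) hdeg hρ
      (r := r) (c := c) (by
        have : (Matrix.of fun a b => φ (M (r a) (c b))).det =
            φ (Matrix.of fun a b => M (r a) (c b)).det := by
          rw [RingEquiv.map_det]
          rfl
        rw [this]
        exact hb) (fun s hs i => by
          have h1 := hr (fun j => φ.symm (s j)) (fun k => by
            refine φ.injective ?_
            rw [map_sum, map_zero, ← hs k]
            simp) i
          have h2 := congrArg φ h1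
          rw [map_sum, map_zero] at h2
          rw [← h2]
          simp) hG
    obtain ⟨G'', h1, h2⟩ := exists_generators_linSol_of_equiv φ M hG'
    refine ⟨G'', h1.trans (hG'c.trans ?_), h2⟩
    rw [hermannBound]
    refine Nat.add_le_add_left (hGc.trans (le_of_eq ?_)) _
    simp

lemma hermannBound_mono {m q q' D D' : ℕ} (hq : q ≤ q') (hD : D ≤ D') :
    hermannBound m q D ≤ hermannBound m q' D' := by
  induction m generalizing q q' with
  | zero => exact hq
  | succ m ih =>
    rw [hermannBound, hermannBound]
    refine add_le_add hq (ih ?_)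
    gcongr

end Hermann

section FrobeniusTrace

/-- On a finite extension `E / L` of exponential characteristic `p`, the trace of a suitable
`p`-power map is well defined and nonzero. -/
lemma exists_trace_pow {L E : Type*} [Field L] [Field E] [Algebra L E] [FiniteDimensional L E]
    (p : ℕ) [ExpChar L p] :
    ∃ (n : ℕ) (τ : E →+ L), (∀ (l : L) (z : E), τ (l • z) = l ^ p ^ n * τ z) ∧
      (∀ z, ∃ k : ℕ, τ z = k * -(minpoly L (z ^ p ^ n)).nextCoeff) ∧ ∃ z, τ z ≠ 0 := by
  let E' := separableClosure L E
  have : ExpChar E p := expChar_of_injective_algebraMap (algebraMap L E).injective p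
  have : ExpChar E' p := expChar_of_injective_algebraMap (algebraMap L E').injective p
  have : FiniteDimensional E' E := inferInstance
  have : IsPurelyInseparable E' E := separableClosure.isPurelyInseparable L E
  let n := IsPurelyInseparable.exponent E' E
  let Φ : E →+* E' := IsPurelyInseparable.iterateFrobenius E' E p (n := n) le_rfl
  have hΦ : ∀ z, algebraMap E' E (Φ z) = z ^ p ^ n :=
    fun z => IsPurelyInseparable.algebraMap_iterateFrobenius E' p le_rfl z
  have hΦL : ∀ l : L, Φ (algebraMap L E l) = algebraMap L E' (l ^ p ^ n) := fun l => by
    refine (algebraMap E' E).injective ?_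
    rw [hΦ, ← IsScalarTower.algebraMap_apply, map_pow]
  let τ : E →+ L := (Algebra.trace L E').toAddMonoidHom.comp Φ.toAddMonoidHom
  have hτ : ∀ z, τ z = Algebra.trace L E' (Φ z) := fun z => rfl
  refine ⟨n, τ, fun l z => ?_, fun z => ?_, ?_⟩
  · rw [hτ, hτ, Algebra.smul_def, map_mul, hΦL, ← Algebra.smul_def, map_smul, smul_eq_mul]
  · refine ⟨Module.finrank (IntermediateField.adjoin L {Φ z}) E', ?_⟩
    rw [hτ, trace_eq_finrank_mul_minpoly_nextCoeff L, ← hΦ z,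
      minpoly.algebraMap_eq (algebraMap E' E).injective]
  · by_contra! h
    refine Algebra.trace_ne_zero L E' ?_
    have h1 := Field.span_map_pow_expChar_pow_eq_top_of_isSeparable (F := L) (E := E') p n
      (v := id) (by rw [Set.range_id, Submodule.span_univ])
    have h2 : (⊤ : Submodule L E') ≤ LinearMap.ker (Algebra.trace L E') := by
      rw [← h1]
      refine Submodule.span_le.2 ?_
      rintro _ ⟨y, rfl⟩
      have h3 : Φ (algebraMap E' E y) = y ^ p ^ n := by
        refine (algebraMap E' E).injective ?_
        rw [hΦ, map_pow]
      rw [SetLike.mem_coe, LinearMap.mem_ker]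
      change Algebra.trace L E' (y ^ p ^ n) = 0
      rw [← h3, ← hτ, h]
    exact LinearMap.ext fun y => h2 (Submodule.mem_top)

variable {K : Type*} [Field K] {σ : Type*}

open Classical in
/-- The `γ`-component of a polynomial with respect to the basis of monomials over the subring of
`p ^ n`-th powers, followed by the `p ^ n`-th root. -/
noncomputable def frobeniusCoord (p n : ℕ) [ExpChar K p] [PerfectRing K p] (γ : σ →₀ ℕ)
    (f : MvPolynomial σ K) : MvPolynomial σ K :=
  ∑ u ∈ (f.support.preimage (fun u => p ^ n • u + γ) fun u _ v _ h => by
      have h1 : p ^ n ≠ 0 := (expChar_pow_pos K p n).ne'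
      exact smul_right_injective _ h1 (add_right_cancel h)),
    monomial u ((iterateFrobeniusEquiv K p n).symm (coeff (p ^ n • u + γ) f))

variable {p n : ℕ} [ExpChar K p] [PerfectRing K p]

lemma coeff_frobeniusCoord (γ : σ →₀ ℕ) (f : MvPolynomial σ K) (u : σ →₀ ℕ) :
    coeff u (frobeniusCoord p n γ f) =
      (iterateFrobeniusEquiv K p n).symm (coeff (p ^ n • u + γ) f) := by
  classical
  rw [frobeniusCoord, coeff_sum]
  simp only [coeff_monomial, Finset.sum_ite_eq']
  split_ifs with h
  · rfl
  · have h' : p ^ n • u + γ ∉ f.support := fun h' => h (Finset.mem_preimage.2 h')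
    rw [notMem_support_iff.1 h', map_zero]

lemma frobeniusCoord_add (γ : σ →₀ ℕ) (f g : MvPolynomial σ K) :
    frobeniusCoord p n γ (f + g) = frobeniusCoord p n γ f + frobeniusCoord p n γ g := by
  ext u
  simp [coeff_frobeniusCoord]

lemma frobeniusCoord_pow_mul {γ : σ →₀ ℕ} (hγ : ∀ i, γ i < p ^ n) (c f : MvPolynomial σ K) :
    frobeniusCoord p n γ (c ^ p ^ n * f) = c * frobeniusCoord p n γ f := by
  classical
  have : ExpChar (MvPolynomial σ K) p := expChar_of_injective_algebraMap
    (algebraMap K (MvPolynomial σ K)).injective p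
  induction c using MvPolynomial.induction_on' with
  | add c c' hc hc' =>
    rw [add_pow_expChar_pow, add_mul, frobeniusCoord_add, hc, hc', add_mul]
  | monomial v a =>
    ext u
    rw [coeff_frobeniusCoord, monomial_pow, coeff_monomial_mul', coeff_monomial_mul',
      coeff_frobeniusCoord]
    have hiff : p ^ n • v ≤ p ^ n • u + γ ↔ v ≤ u := by
      simp only [Finsupp.le_def, Finsupp.add_apply, Finsupp.smul_apply, smul_eq_mul]
      refine forall_congr' fun i => ⟨fun h => ?_, fun h => ?_⟩
      · by_contra hlt
        have h1 : p ^ n * (u i + 1) ≤ p ^ n * v i := Nat.mul_le_mul_left _ (by omega)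
        have := hγ i
        rw [mul_add] at h1
        omega
      · exact (Nat.mul_le_mul_left _ h).trans (Nat.le_add_right _ _)
    by_cases h : v ≤ u
    · rw [if_pos (hiff.2 h), if_pos h, map_mul]
      congr 1
      · exact (iterateFrobeniusEquiv K p n).symm_apply_apply a
      · congr 2
        obtain ⟨t, rfl⟩ := exists_add_of_le h
        rw [add_tsub_cancel_left, smul_add, add_assoc, add_tsub_cancel_left]
    · rw [if_neg (fun h' => h (hiff.1 h')), if_neg h, map_zero]

lemma totalDegree_frobeniusCoord_le (γ : σ →₀ ℕ) (f : MvPolynomial σ K) :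
    p ^ n * (frobeniusCoord p n γ f).totalDegree ≤ f.totalDegree := by
  have h1 : 0 < p ^ n := expChar_pow_pos K p n
  rw [mul_comm, ← Nat.le_div_iff_mul_le h1, totalDegree, Finset.sup_le_iff]
  intro u hu
  rw [mem_support_iff, coeff_frobeniusCoord] at hu
  have h2 : p ^ n • u + γ ∈ f.support := by
    rw [mem_support_iff]
    intro h
    rw [h, map_zero] at hu
    exact hu rfl
  have h3 := le_totalDegree h2
  rw [Nat.le_div_iff_mul_le h1, mul_comm]
  refine le_trans ?_ h3
  change _ * u.degree ≤ (p ^ n • u + γ).degree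
  rw [map_add, map_nsmul, smul_eq_mul]
  exact Nat.le_add_right _ _

lemma exists_frobeniusCoord_ne_zero {f : MvPolynomial σ K} (hf : f ≠ 0) :
    ∃ γ : σ →₀ ℕ, (∀ i, γ i < p ^ n) ∧ frobeniusCoord p n γ f ≠ 0 := by
  obtain ⟨v, hv⟩ := ne_zero_iff.1 hf
  have h1 : 0 < p ^ n := expChar_pow_pos K p n
  refine ⟨v.mapRange (· % p ^ n) (Nat.zero_mod _), fun i => ?_, ?_⟩
  · rw [Finsupp.mapRange_apply]
    exact Nat.mod_lt _ h1
  · refine ne_zero_iff.2 ⟨v.mapRange (· / p ^ n) (Nat.zero_div _), ?_⟩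
    rw [coeff_frobeniusCoord]
    have h2 : p ^ n • v.mapRange (· / p ^ n) (Nat.zero_div _) +
        v.mapRange (· % p ^ n) (Nat.zero_mod _) = v := by
      ext i
      simp [Nat.div_add_mod]
    rw [h2]
    simpa using hv

end FrobeniusTrace

section Functional

variable {K : Type*} [Field K] [PerfectField K] {m : ℕ}

/-- A nonzero functional on a finite domain over a polynomial ring, of bounded degree. -/
theorem exists_functional {T : Type*} [CommRing T] [IsDomain T] [Algebra (MvPolynomial (Fin m) K) T]
    [FaithfulSMul (MvPolynomial (Fin m) K) T] [Module.Finite (MvPolynomial (Fin m) K) T] :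
    ∃ (q : ℕ) (φ : T →ₗ[MvPolynomial (Fin m) K] MvPolynomial (Fin m) K), 0 < q ∧ φ ≠ 0 ∧
      ∀ z, q * (φ z).totalDegree ≤
        (minpoly (MvPolynomial (Fin m) K) (z ^ q)).nextCoeff.totalDegree := by
  let R := MvPolynomial (Fin m) K
  let L := FractionRing R
  let E := FractionRing T
  obtain ⟨p, hp⟩ := ExpChar.exists K
  have : ExpChar R p := expChar_of_injective_algebraMap (algebraMap K R).injective p
  have : ExpChar L p := expChar_of_injective_algebraMap (IsFractionRing.injective R L) p
  let _ : Algebra L E := FractionRing.liftAlgebra R E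
  have : FiniteDimensional L E := .of_isLocalization R T (nonZeroDivisors R)
  obtain ⟨n, τ, hτ, hτn, z₀, hz₀⟩ := exists_trace_pow (L := L) (E := E) p
  have hint : ∀ z : T, IsIntegral R z := fun z => Algebra.IsIntegral.isIntegral z
  have hg : ∀ z : T, ∃ g : R, algebraMap R L g = τ (algebraMap T E z) ∧
      g.totalDegree ≤ (minpoly R (z ^ p ^ n)).nextCoeff.totalDegree := by
    intro z
    obtain ⟨k, hk⟩ := hτn (algebraMap T E z)
    refine ⟨k * -(minpoly R (z ^ p ^ n)).nextCoeff, ?_, ?_⟩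
    · rw [hk, ← map_pow, minpoly.isIntegrallyClosed_eq_field_fractions L E (hint _),
        Polynomial.nextCoeff_map (IsFractionRing.injective R L), map_mul, map_neg, map_natCast]
    · rw [← map_natCast (C : K →+* MvPolynomial (Fin m) K)]
      refine (totalDegree_mul _ _).trans ?_
      rw [totalDegree_C, zero_add, totalDegree_neg]
  choose g hg hgdeg using hg
  have hinj := IsFractionRing.injective R L
  have hgadd : ∀ z z', g (z + z') = g z + g z' := fun z z' => hinj (by
    rw [map_add, hg, hg, hg, map_add, map_add])
  have hgsmul : ∀ (c : R) z, g (c • z) = c ^ p ^ n * g z := fun c z => hinj (by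
    rw [map_mul, hg, hg, Algebra.smul_def, map_mul, map_pow, ← hτ, Algebra.smul_def,
      ← IsScalarTower.algebraMap_apply, ← IsScalarTower.algebraMap_apply])
  have hne : ∃ z, g z ≠ 0 := by
    obtain ⟨a, b, hb, rfl⟩ := IsFractionRing.div_surjective (A := T) z₀
    obtain ⟨c, e, he, hc⟩ := Algebra.IsAlgebraic.exists_smul_eq_mul (R := R) a
      (nonZeroDivisors.ne_zero hb)
    have hb' : algebraMap T E b ≠ 0 := by
      rw [Ne, map_eq_zero_iff _ (IsFractionRing.injective T E)]
      exact nonZeroDivisors.ne_zero hb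
    have he' : algebraMap R L e ≠ 0 := by
      rwa [Ne, map_eq_zero_iff _ hinj]
    have h1 : algebraMap T E c = algebraMap R L e • (algebraMap T E a / algebraMap T E b) := by
      have h2 := congrArg (algebraMap T E) hc
      rw [Algebra.smul_def, map_mul, map_mul, ← IsScalarTower.algebraMap_apply] at h2
      rw [Algebra.smul_def, ← IsScalarTower.algebraMap_apply, ← mul_div_assoc, h2,
        mul_div_cancel_left₀ _ hb']
    refine ⟨c, fun h => ?_⟩
    have h2 := hg c
    rw [h, map_zero, h1, hτ] at h2
    exact mul_ne_zero (pow_ne_zero _ he') hz₀ h2.symm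
  obtain ⟨z₁, hz₁⟩ := hne
  obtain ⟨γ, hγ, hγ1⟩ := exists_frobeniusCoord_ne_zero (p := p) (n := n) hz₁
  refine ⟨p ^ n, ⟨⟨fun z => frobeniusCoord p n γ (g z), fun z z' => ?_⟩, fun c z => ?_⟩,
    expChar_pow_pos K p n, fun h => hγ1 ?_, fun z => ?_⟩
  · rw [hgadd, frobeniusCoord_add]
  · change frobeniusCoord p n γ (g (c • z)) = c • frobeniusCoord p n γ (g z)
    rw [hgsmul, frobeniusCoord_pow_mul hγ, smul_eq_mul]
  · exact LinearMap.congr_fun h z₁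
  · exact (totalDegree_frobeniusCoord_le γ (g z)).trans (hgdeg z)

end Functional

section RegFam

lemma RegFam.of_castSucc_of_forall_associatedPrimes {A : Type*} [CommRing A] [IsNoetherianRing A]
    {n : ℕ}
    {g : Fin (n + 1) → A} (h : RegFam fun i => g (Fin.castSucc i))
    (hp : ∀ p ∈ associatedPrimes A (A ⧸ Ideal.span (Set.range fun i : Fin n => g i.castSucc)),
      g (Fin.last n) ∉ p) : RegFam g := by
  refine h.of_castSucc fun x hx => ?_
  by_contra hcon
  have h1 : g (Fin.last n) ∈ ⋃ p ∈ associatedPrimes A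
      (A ⧸ Ideal.span (Set.range fun i : Fin n => g i.castSucc)), (p : Set A) := by
    rw [biUnion_associatedPrimes_eq_zero_divisors]
    refine ⟨Ideal.Quotient.mk _ x, fun h => hcon (Ideal.Quotient.eq_zero_iff_mem.1 h), ?_⟩
    rw [Algebra.smul_def, Ideal.Quotient.algebraMap_eq, ← map_mul]
    exact Ideal.Quotient.eq_zero_iff_mem.2 hx
  simp only [Set.mem_iUnion] at h1
  obtain ⟨p, hpp, hm⟩ := h1
  exact hp p hpp hm

lemma RegFam.snoc {A : Type*} [CommRing A] [IsNoetherianRing A] {n : ℕ} {g : Fin n → A}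
    (h : RegFam g) {v : A} (hp : ∀ p ∈ associatedPrimes A (A ⧸ Ideal.span (Set.range g)), v ∉ p) :
    RegFam (Fin.snoc g v : Fin (n + 1) → A) := by
  have h1 : (fun i : Fin n => (Fin.snoc g v : Fin (n + 1) → A) i.castSucc) = g :=
    funext fun i => Fin.snoc_castSucc (α := fun _ => A) v g i
  refine RegFam.of_castSucc_of_forall_associatedPrimes ?_ ?_
  · rwa [h1]
  · rw [h1, Fin.snoc_last]
    exact hp

lemma RegFam.height_ge {A : Type*} [CommRing A] [IsNoetherianRing A] {n : ℕ} {g : Fin n → A}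
    (h : RegFam g)
    {p : Ideal A} [p.IsPrime] (hp : ∀ i, g i ∈ p) : (n : ℕ∞) ≤ p.height := by
  have := LocReg.length_le_height (h.locReg (q := p)) (by simpa [List.mem_ofFn] using hp)
  simpa using this

lemma RegFam.of_forall_mem {A : Type*} [CommRing A] [IsNoetherianRing A] (hA : HasDepth A) {n : ℕ}
    {g g' : Fin n → A} (h : RegFam g)
    (hg : ∀ p : Ideal A, p.IsPrime → ∀ i, g' i ∈ p → g i ∈ p) : RegFam g' := by
  induction n with
  | zero => exact fun k => k.elim0
  | succ n ih =>
    have h1 := ih h.castSucc fun p hp i => hg p hp _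
    refine h1.of_castSucc_of_forall_associatedPrimes fun p hp hlast => ?_
    have hpp := hp.isPrime
    obtain ⟨h2, h3⟩ := mem_associatedPrimes_height_le hA h1 hp
    have h4 := h.height_ge (p := p) fun i => by
      refine Fin.lastCases ?_ (fun i => ?_) i
      · exact hg p hpp _ hlast
      · exact hg p hpp _ (h2 i)
    have h5 := h4.trans h3
    norm_cast at h5
    omega

variable {K : Type*} [Field K] {N : ℕ}

lemma regFam_X : RegFam (X : Fin N → MvPolynomial (Fin N) K) := by
  intro k x hx
  rw [mem_ideal_span_X_image] at hx ⊢
  intro u hu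
  obtain ⟨i, hi, hne⟩ := hx (Finsupp.single k 1 + u) (by
    rw [mem_support_iff, coeff_X_mul]
    exact mem_support_iff.1 hu)
  refine ⟨i, hi, ?_⟩
  have : i ≠ k := ne_of_lt hi
  simpa [Finsupp.single_apply, this.symm] using hne

lemma RegFam.exists_extend [Infinite K] {w : Fin N → ℕ} {W : ℕ} (hW : ∀ i, w i ∣ W) {c : ℕ}
    {b : Fin c → MvPolynomial (Fin N) K} (hb : RegFam b)
    (hhom : ∀ i, IsWeightedHomogeneous w (b i) W) (m : ℕ) (hm : c + m ≤ N) :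
    ∃ g : Fin (c + m) → MvPolynomial (Fin N) K, RegFam g ∧
      (∀ i, IsWeightedHomogeneous w (g i) W) ∧ ∀ i, g (Fin.castAdd m i) = b i := by
  have hA : HasDepth (MvPolynomial (Fin N) K) := (HasDepth.of_field K).mvPolynomial_fin N
  induction m with
  | zero => exact ⟨b, hb, hhom, fun i => rfl⟩
  | succ m ih =>
    obtain ⟨g, hg, hgh, hgb⟩ := ih (by omega)
    obtain ⟨v, hv, hvp⟩ := exists_mem_forall_notMem (weightedHomogeneousSubmodule K w W)
      (associatedPrimes _ (MvPolynomial (Fin N) K ⧸ Ideal.span (Set.range g)))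
      (associatedPrimes.finite _ _) (by
        intro p hp hsub
        have hpp := hp.isPrime
        have h1 := (mem_associatedPrimes_height_le hA hg hp).2
        have h2 := (regFam_X (K := K) (N := N)).height_ge (p := p) fun i => by
          refine hpp.mem_of_pow_mem (W / w i) (hsub ?_)
          have := (isWeightedHomogeneous_X K w i).pow (W / w i)
          rw [smul_eq_mul, Nat.div_mul_cancel (hW i)] at this
          exact this
        have h3 := h2.trans h1
        norm_cast at h3
        omega)
    refine ⟨Fin.snoc g v, ?_, fun i => ?_, fun i => ?_⟩
    · exact hg.snoc hvp
    · refine Fin.lastCases ?_ (fun i => ?_) i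
      · simpa using hv
      · simpa using hgh i
    · have : Fin.castAdd (m + 1) i = Fin.castSucc (Fin.castAdd m i) := rfl
      rw [this, Fin.snoc_castSucc, hgb]

end RegFam

section Hilbert

variable {K : Type*} [Field K] {N : ℕ} {w : Fin N → ℕ}

lemma finite_weightedHomogeneousSubmodule (hw : ∀ i, w i ≠ 0) (n : ℕ) :
    Module.Finite K (weightedHomogeneousSubmodule K w n) := by
  have hfin : {d : Fin N →₀ ℕ | Finsupp.weight w d = n}.Finite :=
    (Finsupp.finite_of_nat_weight_le w hw n).subset fun d hd => le_of_eq hd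
  have : FiniteDimensional K (Submodule.span K
      ((fun d => monomial d (1 : K)) '' {d : Fin N →₀ ℕ | Finsupp.weight w d = n})) :=
    FiniteDimensional.span_of_finite K (hfin.image _)
  refine Submodule.finiteDimensional_of_le (S₂ := Submodule.span K
      ((fun d => monomial d (1 : K)) '' {d : Fin N →₀ ℕ | Finsupp.weight w d = n})) fun p hp => ?_
  rw [p.as_sum]
  refine Submodule.sum_mem _ fun d hd => ?_
  rw [show monomial d (coeff d p) = coeff d p • monomial d (1 : K) by simp [smul_monomial]]
  exact Submodule.smul_mem _ _ (Submodule.subset_span ⟨d, hp (mem_support_iff.1 hd), rfl⟩)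

variable (w) in
/-- The degree `n` part of an ideal. -/
noncomputable def idealPart (J : Ideal (MvPolynomial (Fin N) K)) (n : ℕ) :
    Submodule K (MvPolynomial (Fin N) K) :=
  J.restrictScalars K ⊓ weightedHomogeneousSubmodule K w n

end Hilbert

section

lemma image_Iio_last {A : Type*} {n : ℕ} (g : Fin (n + 1) → A) :
    g '' Set.Iio (Fin.last n) = Set.range fun i : Fin n => g i.castSucc := by
  ext y
  constructor
  · rintro ⟨i, hi, rfl⟩
    obtain ⟨j, rfl⟩ := Fin.exists_castSucc_eq.2 (ne_of_lt hi)
    exact ⟨j, rfl⟩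
  · rintro ⟨j, rfl⟩
    exact ⟨j.castSucc, Fin.castSucc_lt_last j, rfl⟩

variable {A : Type*} [CommRing A]

lemma span_range_eq_sup_last {n : ℕ} (g : Fin (n + 1) → A) :
    Ideal.span (Set.range g) =
      Ideal.span (Set.range fun i : Fin n => g i.castSucc) ⊔ Ideal.span {g (Fin.last n)} := by
  rw [← Ideal.span_union]
  congr 1
  ext y
  constructor
  · rintro ⟨i, rfl⟩
    refine Fin.lastCases (Or.inr rfl) (fun i => Or.inl ⟨i, rfl⟩) i
  · rintro (⟨i, rfl⟩ | rfl)
    exacts [⟨_, rfl⟩, ⟨_, rfl⟩]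

lemma RegFam.mem_of_last {n : ℕ} {g : Fin (n + 1) → A} (h : RegFam g) {x : A}
    (hx : g (Fin.last n) * x ∈ Ideal.span (Set.range fun i : Fin n => g i.castSucc)) :
    x ∈ Ideal.span (Set.range fun i : Fin n => g i.castSucc) := by
  have := h (Fin.last n) x
  rw [image_Iio_last] at this
  exact this hx

end

section Hilbert

variable {K : Type*} [Field K] {N : ℕ} {w : Fin N → ℕ} {W : ℕ}

lemma span_range_ne_top_of_isWeightedHomogeneous (hW : 0 < W) {k : ℕ}
    {g : Fin k → MvPolynomial (Fin N) K} (hg : ∀ i, IsWeightedHomogeneous w (g i) W) :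
    Ideal.span (Set.range g) ≠ ⊤ := by
  intro htop
  have h1 : Ideal.span (Set.range g) ≤ RingHom.ker (constantCoeff (R := K) (σ := Fin N)) := by
    rw [Ideal.span_le]
    rintro _ ⟨i, rfl⟩
    by_contra hne
    have := hg i (d := 0) hne
    rw [map_zero] at this
    omega
  have h2 := h1 (htop ▸ Submodule.mem_top : (1 : MvPolynomial (Fin N) K) ∈ Ideal.span (Set.range g))
  simp [RingHom.mem_ker] at h2

lemma RegFam.last_ne_zero (hW : 0 < W) {k : ℕ}
    {g : Fin (k + 1) → MvPolynomial (Fin N) K} (h : RegFam g)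
    (hg : ∀ i, IsWeightedHomogeneous w (g i) W) : g (Fin.last k) ≠ 0 := by
  intro h0
  refine span_range_ne_top_of_isWeightedHomogeneous (w := w) hW
    (fun i : Fin k => hg i.castSucc) ((Ideal.eq_top_iff_one _).2 (h.mem_of_last ?_))
  rw [h0, zero_mul]
  exact Submodule.zero_mem _

lemma idealPart_span_range_of_lt {k : ℕ} {g : Fin (k + 1) → MvPolynomial (Fin N) K}
    (hg : ∀ i, IsWeightedHomogeneous w (g i) W) {n : ℕ} (hn : n < W) :
    idealPart w (Ideal.span (Set.range g)) n =
      idealPart w (Ideal.span (Set.range fun i : Fin k => g i.castSucc)) n := by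
  apply le_antisymm
  · rintro p ⟨hp, hpn⟩
    refine ⟨?_, hpn⟩
    change p ∈ Ideal.span (Set.range g) at hp
    rw [span_range_eq_sup_last, mem_sup_span_singleton_iff] at hp
    obtain ⟨j, hj, b, rfl⟩ := hp
    have h1 := WHom.span (w := w) (S := Set.range fun i : Fin k => g i.castSucc)
      (by rintro _ ⟨i, rfl⟩; exact ⟨W, hg _⟩) j hj n
    have h2 := weightedHomogeneousComponent_of_mem (m := n) hpn
    rw [if_pos rfl, map_add, mul_comm, weightedHomogeneousComponent_mul_of_right (hg _),
      if_neg (by omega), add_zero] at h2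
    rw [mul_comm, ← h2]
    exact h1
  · rintro p ⟨hp, hpn⟩
    refine ⟨Ideal.span_mono ?_ hp, hpn⟩
    rintro _ ⟨i, rfl⟩
    exact ⟨_, rfl⟩

lemma idealPart_span_range_of_le {k : ℕ} {g : Fin (k + 1) → MvPolynomial (Fin N) K}
    (hg : ∀ i, IsWeightedHomogeneous w (g i) W) (n : ℕ) :
    idealPart w (Ideal.span (Set.range g)) (n + W) =
      idealPart w (Ideal.span (Set.range fun i : Fin k => g i.castSucc)) (n + W) ⊔
        (weightedHomogeneousSubmodule K w n).map (LinearMap.mulLeft K (g (Fin.last k))) := by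
  apply le_antisymm
  · rintro p ⟨hp, hpn⟩
    change p ∈ Ideal.span (Set.range g) at hp
    rw [span_range_eq_sup_last, mem_sup_span_singleton_iff] at hp
    obtain ⟨j, hj, b, rfl⟩ := hp
    have h1 := WHom.span (w := w) (S := Set.range fun i : Fin k => g i.castSucc)
      (by rintro _ ⟨i, rfl⟩; exact ⟨W, hg _⟩) j hj (n + W)
    have h2 := weightedHomogeneousComponent_of_mem (m := n + W) hpn
    rw [if_pos rfl, map_add, mul_comm, weightedHomogeneousComponent_mul_of_right (hg _),
      if_pos (by omega), Nat.add_sub_cancel] at h2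
    rw [mul_comm, ← h2]
    refine Submodule.add_mem_sup ⟨h1, weightedHomogeneousComponent_mem _ _ _⟩
      ⟨_, weightedHomogeneousComponent_mem w b n, ?_⟩
    rw [LinearMap.mulLeft_apply, mul_comm]
  · refine sup_le ?_ ?_
    · rintro p ⟨hp, hpn⟩
      refine ⟨Ideal.span_mono ?_ hp, hpn⟩
      rintro _ ⟨i, rfl⟩
      exact ⟨_, rfl⟩
    · rintro _ ⟨a, ha, rfl⟩
      refine ⟨Ideal.mul_mem_right _ _ (Ideal.subset_span ⟨_, rfl⟩), ?_⟩
      rw [add_comm]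
      exact (hg _).mul ha

lemma RegFam.idealPart_inf {k : ℕ} {g : Fin (k + 1) → MvPolynomial (Fin N) K} (h : RegFam g)
    (hg : ∀ i, IsWeightedHomogeneous w (g i) W) (n : ℕ) :
    idealPart w (Ideal.span (Set.range fun i : Fin k => g i.castSucc)) (n + W) ⊓
        (weightedHomogeneousSubmodule K w n).map (LinearMap.mulLeft K (g (Fin.last k))) =
      (idealPart w (Ideal.span (Set.range fun i : Fin k => g i.castSucc)) n).map
        (LinearMap.mulLeft K (g (Fin.last k))) := by
  apply le_antisymm
  · rintro _ ⟨⟨h1, h2⟩, a, ha, rfl⟩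
    exact ⟨a, ⟨h.mem_of_last h1, ha⟩, rfl⟩
  · rintro _ ⟨a, ⟨h1, ha⟩, rfl⟩
    refine ⟨⟨Ideal.mul_mem_left _ _ h1, ?_⟩, a, ha, rfl⟩
    rw [add_comm]
    exact (hg _).mul ha

/-- The Hilbert function of an ideal generated by a regular sequence depends only on the
degrees. -/
theorem RegFam.finrank_idealPart_eq (hw : ∀ i, w i ≠ 0) (hW : 0 < W) {k : ℕ}
    {g g' : Fin k → MvPolynomial (Fin N) K} (h : RegFam g) (h' : RegFam g')
    (hg : ∀ i, IsWeightedHomogeneous w (g i) W) (hg' : ∀ i, IsWeightedHomogeneous w (g' i) W)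
    (n : ℕ) :
    Module.finrank K (idealPart w (Ideal.span (Set.range g)) n) =
      Module.finrank K (idealPart w (Ideal.span (Set.range g')) n) := by
  induction k generalizing n with
  | zero => rw [Subsingleton.elim g g']
  | succ k ih =>
    have ih' := ih h.castSucc h'.castSucc (fun i => hg _) (fun i => hg' _)
    rcases lt_or_ge n W with hn | hn
    · rw [idealPart_span_range_of_lt hg hn, idealPart_span_range_of_lt hg' hn]
      exact ih' n
    obtain ⟨n, rfl⟩ := Nat.exists_eq_add_of_le' hn
    have key : ∀ {g : Fin (k + 1) → MvPolynomial (Fin N) K}, RegFam g →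
        (∀ i, IsWeightedHomogeneous w (g i) W) →
        Module.finrank K (idealPart w (Ideal.span (Set.range g)) (n + W)) +
          Module.finrank K (idealPart w (Ideal.span (Set.range fun i : Fin k => g i.castSucc)) n) =
        Module.finrank K
          (idealPart w (Ideal.span (Set.range fun i : Fin k => g i.castSucc)) (n + W)) +
          Module.finrank K (weightedHomogeneousSubmodule K w n) := by
      intro g h hg
      have hinj : Function.Injective (LinearMap.mulLeft K (g (Fin.last k))) := fun a b hab =>
        mul_left_cancel₀ (h.last_ne_zero hW hg) hab
      have := finite_weightedHomogeneousSubmodule (K := K) hw n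
      have : FiniteDimensional K
          (idealPart w (Ideal.span (Set.range fun i : Fin k => g i.castSucc)) (n + W)) :=
        have := finite_weightedHomogeneousSubmodule (K := K) hw (n + W)
        Submodule.finiteDimensional_of_le inf_le_right
      rw [idealPart_span_range_of_le hg,
        (Submodule.equivMapOfInjective _ hinj
          (idealPart w (Ideal.span (Set.range fun i : Fin k => g i.castSucc)) n)).finrank_eq,
        (Submodule.equivMapOfInjective _ hinj (weightedHomogeneousSubmodule K w n)).finrank_eq,
        ← h.idealPart_inf hg]
      have : FiniteDimensional K ((weightedHomogeneousSubmodule K w n).map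
        (LinearMap.mulLeft K (g (Fin.last k)))) := inferInstance
      exact Submodule.finrank_sup_add_finrank_inf_eq _ _
    have h1 := key h hg
    have h2 := key h' hg'
    rw [ih' n, ih' (n + W)] at h1
    omega

end Hilbert

section Spanning

variable {K : Type*} [Field K] {N : ℕ} {w : Fin N → ℕ} {W : ℕ}

lemma regFam_X_pow {s : Fin N → ℕ} :
    RegFam fun i : Fin N => (X i : MvPolynomial (Fin N) K) ^ s i :=
  regFam_X.of_forall_mem ((HasDepth.of_field K).mvPolynomial_fin N)
    fun _ hp _ hi => hp.mem_of_pow_mem _ hi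

lemma mem_span_X_pow_of_lt {n : ℕ} (hn : N * W < n)
    {a : MvPolynomial (Fin N) K} (ha : IsWeightedHomogeneous w a n) :
    a ∈ Ideal.span (Set.range fun i : Fin N => (X i : MvPolynomial (Fin N) K) ^ (W / w i)) := by
  rw [a.as_sum]
  refine Ideal.sum_mem _ fun d hd => ?_
  have h1 : Finsupp.weight w d = n := ha (mem_support_iff.1 hd)
  obtain ⟨i, hi⟩ : ∃ i, W ≤ d i * w i := by
    by_contra! hcon
    have h2 : Finsupp.weight w d = ∑ i, d i * w i := by
      rw [Finsupp.weight_apply, Finsupp.sum_fintype _ _ (by simp)]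
      rfl
    have h3 : ∑ i, d i * w i ≤ ∑ _i : Fin N, W := Finset.sum_le_sum fun i _ => (hcon i).le
    simp only [Finset.sum_const, Finset.card_univ, Fintype.card_fin, smul_eq_mul] at h3
    omega
  have h2 : Finsupp.single i (W / w i) ≤ d := by
    rw [Finsupp.single_le_iff]
    exact Nat.div_le_of_le_mul (by rwa [mul_comm])
  rw [← add_tsub_cancel_of_le h2, ← one_mul (coeff _ a), ← monomial_mul, ← X_pow_eq_monomial]
  exact Ideal.mul_mem_right _ _ (Ideal.subset_span ⟨i, rfl⟩)

lemma RegFam.mem_span_of_lt (hw : ∀ i, w i ≠ 0) (hW0 : 0 < W) (hW : ∀ i, w i ∣ W)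
    {g : Fin N → MvPolynomial (Fin N) K} (h : RegFam g)
    (hg : ∀ i, IsWeightedHomogeneous w (g i) W) {n : ℕ} (hn : N * W < n)
    {a : MvPolynomial (Fin N) K} (ha : IsWeightedHomogeneous w a n) :
    a ∈ Ideal.span (Set.range g) := by
  have := finite_weightedHomogeneousSubmodule (K := K) hw n
  have h1 := h.finrank_idealPart_eq hw hW0 (regFam_X_pow (s := fun i => W / w i)) hg (fun i => by
    have := (isWeightedHomogeneous_X K w i).pow (W / w i)
    rwa [smul_eq_mul, Nat.div_mul_cancel (hW i)] at this) n
  have h2 : idealPart w (Ideal.span (Set.range fun i : Fin N =>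
      (X i : MvPolynomial (Fin N) K) ^ (W / w i))) n = weightedHomogeneousSubmodule K w n :=
    le_antisymm inf_le_right fun p hp => ⟨mem_span_X_pow_of_lt hn hp, hp⟩
  rw [h2] at h1
  have h3 := Submodule.eq_of_le_of_finrank_eq
    (inf_le_right : idealPart w (Ideal.span (Set.range g)) n ≤ weightedHomogeneousSubmodule K w n)
      h1
  have h4 : a ∈ idealPart w (Ideal.span (Set.range g)) n := by
    rw [idealPart, h3]
    exact ha
  exact h4.1

/-- The monomial with prescribed, bounded exponents. -/
noncomputable def boxMonomial (K : Type*) [Field K] {N M : ℕ} (l : Fin N → Fin (M + 1)) :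
    MvPolynomial (Fin N) K :=
  monomial (Finsupp.equivFunOnFinite.symm fun i => (l i : ℕ)) 1

lemma exists_boxMonomial {M : ℕ} {d : Fin N →₀ ℕ} (hd : ∀ i, d i ≤ M) (c : K) :
    ∃ l : Fin N → Fin (M + 1), monomial d c = C c * boxMonomial K l := by
  refine ⟨fun i => ⟨d i, Nat.lt_succ_of_le (hd i)⟩, ?_⟩
  rw [boxMonomial, C_mul_monomial, mul_one]
  congr 2
  exact Finsupp.ext fun _ => rfl

lemma isWeightedHomogeneous_boxMonomial {M : ℕ} (l : Fin N → Fin (M + 1)) :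
    IsWeightedHomogeneous w (boxMonomial K l) (∑ i, (l i : ℕ) * w i) := by
  refine isWeightedHomogeneous_monomial _ _ _ ?_
  rw [Finsupp.weight_apply, Finsupp.sum_fintype _ _ (by simp)]
  rfl

/-- Over the polynomial ring in the last `m` parameters, bounded monomials generate the quotient by
the first `c` parameters. -/
theorem RegFam.exists_sub_sum_mem_span {c m : ℕ} (hcm : c + m = N) (hw : ∀ i, w i ≠ 0) (hW0 : 0 < W)
    (hW : ∀ i, w i ∣ W) {g : Fin (c + m) → MvPolynomial (Fin N) K} (h : RegFam g)
    (hg : ∀ i, IsWeightedHomogeneous w (g i) W) (a : MvPolynomial (Fin N) K) :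
    ∃ s : (Fin N → Fin (N * W + 1)) → MvPolynomial (Fin m) K,
      a - ∑ l, aeval (fun j => g (Fin.natAdd c j)) (s l) * boxMonomial K l ∈
        Ideal.span (Set.range fun i => g (Fin.castAdd m i)) := by
  classical
  set I := Ideal.span (Set.range fun i => g (Fin.castAdd m i)) with hI
  set θ : Fin m → MvPolynomial (Fin N) K := fun j => g (Fin.natAdd c j) with hθ
  let Good : MvPolynomial (Fin N) K → Prop := fun a =>
    ∃ s : (Fin N → Fin (N * W + 1)) → MvPolynomial (Fin m) K,
      a - ∑ l, aeval θ (s l) * boxMonomial K l ∈ I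
  change Good a
  have hmem : ∀ a ∈ I, Good a := fun a ha => ⟨0, by simpa using ha⟩
  have hadd : ∀ a b, Good a → Good b → Good (a + b) := by
    rintro a b ⟨s, hs⟩ ⟨t, ht⟩
    refine ⟨s + t, ?_⟩
    have h1 := I.add_mem hs ht
    simp only [Pi.add_apply, map_add, add_mul, Finset.sum_add_distrib]
    rwa [add_sub_add_comm]
  have hmul : ∀ (P : MvPolynomial (Fin m) K) a, Good a →
      Good ((aeval θ P : MvPolynomial (Fin N) K) * a) := by
    rintro P a ⟨s, hs⟩
    refine ⟨fun l => P * s l, ?_⟩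
    have h1 := I.mul_mem_left (aeval θ P) hs
    simp only [map_mul, mul_assoc, ← Finset.mul_sum]
    rwa [← mul_sub]
  have hsum : ∀ {ι : Type} (S : Finset ι) (f : ι → MvPolynomial (Fin N) K),
      (∀ i ∈ S, Good (f i)) → Good (∑ i ∈ S, f i) := by
    intro ι S f
    induction S using Finset.induction_on with
    | empty => intro _; exact hmem _ (by simp)
    | insert i S hi ih =>
      intro hf
      rw [Finset.sum_insert hi]
      exact hadd _ _ (hf _ (Finset.mem_insert_self _ _))
        (ih fun j hj => hf _ (Finset.mem_insert_of_mem hj))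
  have hbox : ∀ l, Good (boxMonomial K l) := fun l => by
    refine ⟨Pi.single l 1, ?_⟩
    rw [Finset.sum_eq_single l (fun b _ hb => by simp [hb]) (by simp)]
    simp
  have key : ∀ n, ∀ a, IsWeightedHomogeneous w a n → Good a := by
    intro n
    induction n using Nat.strong_induction_on with
    | _ n ih =>
    intro a ha
    rcases le_or_gt n (N * W) with hn | hn
    · rw [a.as_sum]
      refine hsum _ _ fun d hd => ?_
      have h1 : Finsupp.weight w d = n := ha (mem_support_iff.1 hd)
      obtain ⟨l, hl⟩ := exists_boxMonomial (K := K) (M := N * W) (d := d) (fun i => by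
        have := Finsupp.le_weight w (hw i) d
        omega) (coeff d a)
      rw [hl, ← algebraMap_eq, ← aeval_C θ]
      exact hmul _ _ (hbox l)
    · have h1 : a ∈ Ideal.span (Set.range g) := by
        subst hcm
        exact h.mem_span_of_lt hw hW0 hW hg hn ha
      obtain ⟨x, hx⟩ := Ideal.mem_span_range_iff_exists_fun.1 h1
      have h2 := weightedHomogeneousComponent_of_mem (m := n) ha
      rw [if_pos rfl, ← hx, map_sum] at h2
      rw [hx] at h2
      rw [← h2]
      refine hsum _ _ fun i _ => ?_
      rw [weightedHomogeneousComponent_mul_of_right (hg i)]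
      split_ifs with hWn
      swap
      · exact hmem _ I.zero_mem
      refine Fin.addCases (fun i => ?_) (fun i => ?_) i
      · exact hmem _ (Ideal.mul_mem_left _ _ (Ideal.subset_span ⟨i, rfl⟩))
      · have h3 := hmul (X i) _ (ih (n - W) (by omega) _
          (weightedHomogeneousComponent_mem w (x (Fin.natAdd c i)) (n - W)))
        rw [aeval_X, mul_comm] at h3
        exact h3
  rw [← sum_weightedHomogeneousComponent w a, finsum_eq_sum _
    (weightedHomogeneousComponent_finsupp a)]
  exact hsum _ _ fun n _ => key n _ (weightedHomogeneousComponent_mem w a n)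

end Spanning

section

variable {K : Type*} [Field K] {N : ℕ} {w : Fin N → ℕ} {W : ℕ} {c m : ℕ}

/-- Setting the first `c` of `c + m` variables to zero. -/
noncomputable def dropFirst (K : Type*) [Field K] (c m : ℕ) :
    MvPolynomial (Fin (c + m)) K →ₐ[K] MvPolynomial (Fin m) K :=
  aeval (Fin.addCases (fun _ => 0) X)

lemma dropFirst_rename (P : MvPolynomial (Fin m) K) :
    dropFirst K c m (rename (Fin.natAdd c) P) = P := by
  rw [dropFirst, aeval_rename]
  have : (Fin.addCases (fun _ => 0) X : Fin (c + m) → MvPolynomial (Fin m) K) ∘ Fin.natAdd c = X :=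
    funext fun i => by simp
  rw [this, aeval_X_left_apply]

lemma dropFirst_eq_zero_of_mem {y : MvPolynomial (Fin (c + m)) K}
    (hy : y ∈ Ideal.span (Set.range fun i => X (Fin.castAdd m i))) : dropFirst K c m y = 0 := by
  have : Ideal.span (Set.range fun i => (X (Fin.castAdd m i) : MvPolynomial (Fin (c + m)) K)) ≤
      RingHom.ker (dropFirst K c m) := by
    rw [Ideal.span_le]
    rintro _ ⟨i, rfl⟩
    simp [RingHom.mem_ker, dropFirst]
  exact this hy

lemma sub_rename_dropFirst_mem (y : MvPolynomial (Fin (c + m)) K) :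
    y - rename (Fin.natAdd c) (dropFirst K c m y) ∈
      Ideal.span (Set.range fun i => X (Fin.castAdd m i)) := by
  induction y using MvPolynomial.induction_on with
  | C a => simp [dropFirst]
  | add p q hp hq =>
    rw [map_add, map_add, add_sub_add_comm]
    exact Ideal.add_mem _ hp hq
  | mul_X p i hp =>
    rw [map_mul, map_mul]
    refine Fin.addCases (fun i => ?_) (fun i => ?_) i
    · have : dropFirst K c m (X (Fin.castAdd m i)) = 0 := by simp [dropFirst]
      rw [this, map_zero, mul_zero, sub_zero]
      exact Ideal.mul_mem_left _ _ (Ideal.subset_span ⟨i, rfl⟩)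
    · have : dropFirst K c m (X (Fin.natAdd c i)) = X i := by simp [dropFirst]
      rw [this, rename_X, ← sub_mul]
      exact Ideal.mul_mem_right _ _ hp

lemma mem_span_X_castAdd_of_rename_mul_mem {P : MvPolynomial (Fin m) K} (hP : P ≠ 0)
    {y : MvPolynomial (Fin (c + m)) K} (h : rename (Fin.natAdd c) P * y ∈
      Ideal.span (Set.range fun i => (X (Fin.castAdd m i) : MvPolynomial (Fin (c + m)) K))) :
    y ∈ Ideal.span (Set.range fun i => (X (Fin.castAdd m i) : MvPolynomial (Fin (c + m)) K)) := by
  have h1 := dropFirst_eq_zero_of_mem h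
  rw [map_mul, dropFirst_rename] at h1
  have h2 := sub_rename_dropFirst_mem y
  rwa [(mul_eq_zero.1 h1).resolve_left hP, map_zero, sub_zero] at h2

attribute [local instance] MvPolynomial.weightedGradedAlgebra

/-- The last parameters are algebraically independent modulo a minimal prime of the ideal
generated by the first ones. -/
theorem RegFam.aeval_notMem (hW0 : 0 < W) {g : Fin (c + m) → MvPolynomial (Fin N) K} (h : RegFam g)
    (hg : ∀ i, IsWeightedHomogeneous w (g i) W) {Q : Ideal (MvPolynomial (Fin N) K)}
    (hQ : Q ∈ (Ideal.span (Set.range fun i => g (Fin.castAdd m i))).minimalPrimes)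
    {P : MvPolynomial (Fin m) K} (hP : P ≠ 0) : aeval (fun j => g (Fin.natAdd c j)) P ∉ Q := by
  intro hmem
  obtain ⟨F⟩ := exists_freeData (weightedHomogeneousSubmodule K w) (e := fun _ => W) hg
    (fun _ => hW0) h
  obtain ⟨hQp, x, hx⟩ := mem_associatedPrimes_quotient.1
    (minimalPrimes_subset_associatedPrimes _ hQ)
  have hI : Ideal.span (Set.range fun i => g (Fin.castAdd m i)) =
      (Ideal.span (Set.range fun i => (X (Fin.castAdd m i) : MvPolynomial (Fin (c + m)) K))).map
        (aeval g : MvPolynomial (Fin (c + m)) K →ₐ[K] MvPolynomial (Fin N) K) := by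
    rw [Ideal.map_span, ← Set.range_comp]
    congr 2
    funext i
    simp
  have h1 := (hx _).1 hmem
  have h2 : aeval (fun j => g (Fin.natAdd c j)) P =
      (aeval g (rename (Fin.natAdd c) P) : MvPolynomial (Fin N) K) := by
    rw [aeval_rename]
    rfl
  have h3 : x ∈ Ideal.span (Set.range fun i => g (Fin.castAdd m i)) := by
    rw [hI, F.mem_map_iff]
    intro l
    rw [hI, h2, F.mem_map_iff] at h1
    have h4 := h1 l
    rw [F.coord_aeval_mul] at h4
    exact mem_span_X_castAdd_of_rename_mul_mem hP h4
  exact hQp.ne_top ((Ideal.eq_top_iff_one _).2 ((hx 1).2 (by rwa [one_mul])))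

end

section

variable {K : Type*} [Field K] {N : ℕ} {w : Fin N → ℕ} {W m : ℕ}

section

attribute [local instance] MvPolynomial.weightedGradedAlgebra

lemma weightedHomogeneousComponent_aeval {θ : Fin m → MvPolynomial (Fin N) K}
    (hθ : ∀ i, IsWeightedHomogeneous w (θ i) W) (k : ℕ) (P : MvPolynomial (Fin m) K) :
    weightedHomogeneousComponent w k (aeval θ P) =
      aeval θ (weightedHomogeneousComponent (fun _ => W) k P) := by
  have h1 := proj_aeval (𝒜 := weightedHomogeneousSubmodule K w) (e := fun _ => W) hθ k P
  rw [GradedRing.proj_apply] at h1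
  rw [← h1]
  exact (weightedDecomposition.decompose'_apply K w _ k).symm

end

lemma mul_totalDegree_le_of_isWeightedHomogeneous {P : MvPolynomial (Fin m) K} {n : ℕ}
    (hP : IsWeightedHomogeneous (fun _ => W) P n) : W * P.totalDegree ≤ n := by
  rcases eq_or_ne P 0 with rfl | hne
  · simp
  obtain ⟨d, hd, h1⟩ := Finset.exists_mem_eq_sup P.support (support_nonempty.2 hne)
    fun s => s.sum fun _ e => e
  have h2 := hP (mem_support_iff.1 hd)
  rw [totalDegree, h1, ← h2, Finsupp.weight_apply, Finsupp.sum, Finsupp.sum, Finset.mul_sum]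
  exact le_of_eq (Finset.sum_congr rfl fun i _ => by rw [smul_eq_mul, mul_comm])

/-- A nonzero functional on a domain which is finite over a polynomial ring separates points. -/
lemma eq_zero_of_forall_functional {T : Type*} [CommRing T] [IsDomain T]
    [Algebra (MvPolynomial (Fin m) K) T] [Module.Finite (MvPolynomial (Fin m) K) T]
    {φ : T →ₗ[MvPolynomial (Fin m) K] MvPolynomial (Fin m) K}
    (hφ : φ ≠ 0) {z : T} (hz : ∀ t, φ (t * z) = 0) : z = 0 := by
  by_contra hne
  obtain ⟨t, ht⟩ : ∃ t, φ t ≠ 0 := by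
    by_contra! h
    exact hφ (LinearMap.ext h)
  obtain ⟨u, e, he, hu⟩ := Algebra.IsAlgebraic.exists_smul_eq_mul (MvPolynomial (Fin m) K) t hne
  have h1 := hz u
  rw [mul_comm, ← hu, map_smul, smul_eq_mul] at h1
  exact (mul_ne_zero he ht) h1

variable {T : Type*} [CommRing T] [IsDomain T] [Algebra (MvPolynomial (Fin m) K) T]
  [FaithfulSMul (MvPolynomial (Fin m) K) T] [Module.Finite (MvPolynomial (Fin m) K) T]

/-- The trace coefficient of the minimal polynomial of a homogeneous element is homogeneous of the
same degree. -/
lemma mul_totalDegree_nextCoeff_minpoly_le {θ : Fin m → MvPolynomial (Fin N) K}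
    (hθ : ∀ i, IsWeightedHomogeneous w (θ i) W) {π : MvPolynomial (Fin N) K →+* T}
    (hπ : ∀ P, algebraMap (MvPolynomial (Fin m) K) T P = π (aeval θ P))
    (hker : WHom w (RingHom.ker π)) {a : MvPolynomial (Fin N) K} {n : ℕ}
    (ha : IsWeightedHomogeneous w a n) :
    W * (minpoly (MvPolynomial (Fin m) K) (π a)).nextCoeff.totalDegree ≤ n := by
  have hint : IsIntegral (MvPolynomial (Fin m) K) (π a) := Algebra.IsIntegral.isIntegral _
  set p := minpoly (MvPolynomial (Fin m) K) (π a) with hp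
  have hmon : p.Monic := minpoly.monic hint
  set D := p.natDegree with hD
  have hDpos : 0 < D := minpoly.natDegree_pos hint
  let r : Polynomial (MvPolynomial (Fin m) K) := ∑ i ∈ Finset.range (D + 1),
    Polynomial.monomial i (weightedHomogeneousComponent (fun _ => W) ((D - i) * n) (p.coeff i))
  have hcoeff : ∀ i, i ≤ D → r.coeff i =
      weightedHomogeneousComponent (fun _ => W) ((D - i) * n) (p.coeff i) := by
    intro i hi
    rw [Polynomial.finsetSum_coeff, Finset.sum_eq_single i]
    · simp
    · intro j _ hj
      rw [Polynomial.coeff_monomial, if_neg hj]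
    · intro h
      simp at h
      omega
  have hr : Polynomial.aeval (π a) r = 0 := by
    have h0 : Polynomial.aeval (π a) p = 0 := minpoly.aeval _ _
    rw [Polynomial.aeval_eq_sum_range] at h0
    have h1 : ∑ i ∈ Finset.range (D + 1), aeval θ (p.coeff i) * a ^ i ∈ RingHom.ker π := by
      rw [RingHom.mem_ker, map_sum, ← h0]
      refine Finset.sum_congr rfl fun i _ => ?_
      rw [map_mul, map_pow, Algebra.smul_def, hπ]
    have h2 := hker _ h1 (D * n)
    rw [RingHom.mem_ker, map_sum, map_sum] at h2
    rw [map_sum, ← h2]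
    refine Finset.sum_congr rfl fun i hi => ?_
    have hi' : i ≤ D := by simp at hi; omega
    have h3 := ha.pow i
    rw [smul_eq_mul] at h3
    rw [weightedHomogeneousComponent_mul_of_right h3, if_pos (Nat.mul_le_mul_right _ hi'),
      ← Nat.sub_mul, weightedHomogeneousComponent_aeval hθ, map_mul, map_pow, ← hπ,
      Polynomial.aeval_monomial]
  have hpr : p - r = 0 := by
    by_contra hne
    refine hmon.not_dvd_of_degree_lt hne ?_ (minpoly.isIntegrallyClosed_dvd hint ?_)
    · rw [Polynomial.degree_eq_natDegree hmon.ne_zero, Polynomial.degree_lt_iff_coeff_zero]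
      intro k hk
      rcases hk.eq_or_lt with rfl | hk
      · rw [Polynomial.coeff_sub, hcoeff _ le_rfl, Nat.sub_self, zero_mul, hmon.coeff_natDegree]
        rw [weightedHomogeneousComponent_of_mem (isWeightedHomogeneous_one K _), if_pos rfl,
          sub_self]
      · rw [Polynomial.coeff_sub, Polynomial.coeff_eq_zero_of_natDegree_lt hk, zero_sub,
          neg_eq_zero, Polynomial.finsetSum_coeff]
        refine Finset.sum_eq_zero fun i hi => ?_
        rw [Polynomial.coeff_monomial, if_neg]
        simp at hi
        omega
    · rw [map_sub, hr, sub_zero]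
      exact minpoly.aeval _ _
  have h1 : p.nextCoeff = weightedHomogeneousComponent (fun _ => W) n (p.coeff (D - 1)) := by
    rw [Polynomial.nextCoeff_of_natDegree_pos hDpos]
    have h2 := hcoeff (D - 1) (by omega)
    rw [← sub_eq_zero.1 hpr, show D - (D - 1) = 1 by omega, one_mul] at h2
    exact h2
  rw [h1]
  exact mul_totalDegree_le_of_isWeightedHomogeneous
    (weightedHomogeneousComponent_isWeightedHomogeneous _ _)

theorem exists_functional_totalDegree_le [PerfectField K]
    {θ : Fin m → MvPolynomial (Fin N) K}
    (hθ : ∀ i, IsWeightedHomogeneous w (θ i) W) {π : MvPolynomial (Fin N) K →+* T}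
    (hπ : ∀ P, algebraMap (MvPolynomial (Fin m) K) T P = π (aeval θ P))
    (hker : WHom w (RingHom.ker π)) :
    ∃ φ : T →ₗ[MvPolynomial (Fin m) K] MvPolynomial (Fin m) K, φ ≠ 0 ∧
      ∀ a n, IsWeightedHomogeneous w a n → W * (φ (π a)).totalDegree ≤ n := by
  obtain ⟨q, φ, hq, hφ, h⟩ := exists_functional (K := K) (m := m) (T := T)
  refine ⟨φ, hφ, fun a n ha => ?_⟩
  have h1 := h (π a)
  rw [← map_pow] at h1
  have h2 := ha.pow q
  rw [smul_eq_mul] at h2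
  have h3 := mul_totalDegree_nextCoeff_minpoly_le hθ hπ hker h2
  refine Nat.le_of_mul_le_mul_left ?_ hq
  calc q * (W * (φ (π a)).totalDegree) = W * (q * (φ (π a)).totalDegree) := by ring
    _ ≤ _ := Nat.mul_le_mul_left _ h1
    _ ≤ _ := h3

end

section

variable {K : Type*} [Field K] {N : ℕ} {w : Fin N → ℕ} {W m c d : ℕ}

lemma weight_boxMonomial_le (hw : ∀ i, w i ≤ d) (l : Fin N → Fin (N * W + 1)) :
    ∑ i, (l i : ℕ) * w i ≤ N * (N * W * d) := by
  calc ∑ i, (l i : ℕ) * w i ≤ ∑ _i : Fin N, N * W * d :=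
        Finset.sum_le_sum fun i _ => Nat.mul_le_mul (Nat.le_of_lt_succ (l i).2) (hw i)
    _ = N * (N * W * d) := by simp

theorem exists_generators_ker [Infinite K] [PerfectField K]
    {T : Type*} [CommRing T] [IsDomain T] [Algebra (MvPolynomial (Fin m) K) T]
    [FaithfulSMul (MvPolynomial (Fin m) K) T] [Module.Finite (MvPolynomial (Fin m) K) T]
    (hW : 0 < W) (hw : ∀ i, w i ≤ d) {θ : Fin m → MvPolynomial (Fin N) K}
    (hθ : ∀ i, IsWeightedHomogeneous w (θ i) W) {π : MvPolynomial (Fin N) K →+* T}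
    (hsurj : Function.Surjective π)
    (hπ : ∀ P, algebraMap (MvPolynomial (Fin m) K) T P = π (aeval θ P))
    (hker : WHom w (RingHom.ker π)) {b : Fin c → MvPolynomial (Fin N) K}
    (hb : ∀ i, b i ∈ RingHom.ker π)
    (hspan : ∀ a, ∃ s : (Fin N → Fin (N * W + 1)) → MvPolynomial (Fin m) K,
      a - ∑ l, aeval θ (s l) * boxMonomial K l ∈ Ideal.span (Set.range b)) :
    ∃ S : Finset (MvPolynomial (Fin N) K),
      S.card ≤ c + hermannBound m ((N * W + 1) ^ N) (2 * N * N * d) ∧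
      Ideal.span (S : Set (MvPolynomial (Fin N) K)) = RingHom.ker π := by
  classical
  obtain ⟨φ, hφ, hdeg⟩ := exists_functional_totalDegree_le hθ hπ hker
  let M : (Fin N → Fin (N * W + 1)) → (Fin N → Fin (N * W + 1)) → MvPolynomial (Fin m) K :=
    fun j l => φ (π (boxMonomial K j * boxMonomial K l))
  have hM : ∀ j l, (M j l).totalDegree ≤ 2 * N * N * d := by
    intro j l
    have h1 := hdeg _ _ ((isWeightedHomogeneous_boxMonomial (K := K) (w := w) j).mul
      (isWeightedHomogeneous_boxMonomial l))
    have h2 := weight_boxMonomial_le hw j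
    have h3 := weight_boxMonomial_le hw l
    refine Nat.le_of_mul_le_mul_left ?_ hW
    calc W * (M j l).totalDegree ≤ _ := h1
      _ ≤ N * (N * W * d) + N * (N * W * d) := Nat.add_le_add h2 h3
      _ = _ := by ring
  obtain ⟨G, hGcard, hG⟩ := exists_generators_linSol_le_hermannBound _ _ M hM
  let Φ : ((Fin N → Fin (N * W + 1)) → MvPolynomial (Fin m) K) → MvPolynomial (Fin N) K :=
    fun s => ∑ l, aeval θ (s l) * boxMonomial K l
  have hπΦ : ∀ s, π (Φ s) = ∑ l, s l • π (boxMonomial K l) := by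
    intro s
    rw [map_sum]
    exact Finset.sum_congr rfl fun l _ => by rw [map_mul, ← hπ, Algebra.smul_def]
  have hIker : Ideal.span (Set.range b) ≤ RingHom.ker π := by
    rw [Ideal.span_le]
    rintro _ ⟨i, rfl⟩
    exact hb i
  have hT : ∀ t : T, ∃ r : (Fin N → Fin (N * W + 1)) → MvPolynomial (Fin m) K,
      t = ∑ l, r l • π (boxMonomial K l) := by
    intro t
    obtain ⟨a, rfl⟩ := hsurj t
    obtain ⟨r, hr⟩ := hspan a
    refine ⟨r, ?_⟩
    rw [← hπΦ, ← sub_eq_zero, ← map_sub]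
    exact hIker hr
  have hsol : ∀ s, s ∈ linSol M ↔ Φ s ∈ RingHom.ker π := by
    intro s
    have hφM : ∀ j, φ (π (boxMonomial K j) * π (Φ s)) = ∑ l, M j l * s l := by
      intro j
      rw [hπΦ, Finset.mul_sum, map_sum]
      refine Finset.sum_congr rfl fun l _ => ?_
      rw [mul_smul_comm, ← map_mul, map_smul, smul_eq_mul, mul_comm]
    rw [mem_linSol, RingHom.mem_ker]
    constructor
    · intro h
      refine eq_zero_of_forall_functional hφ fun t => ?_
      obtain ⟨r, rfl⟩ := hT t
      rw [Finset.sum_mul, map_sum]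
      refine Finset.sum_eq_zero fun j _ => ?_
      rw [smul_mul_assoc, map_smul, hφM, h, smul_zero]
    · intro h j
      rw [← hφM, h, mul_zero, map_zero]
  refine ⟨Finset.univ.image b ∪ G.image Φ, ?_, le_antisymm ?_ ?_⟩
  · refine (Finset.card_union_le _ _).trans (Nat.add_le_add ?_ ?_)
    · exact Finset.card_image_le.trans (by simp)
    · refine Finset.card_image_le.trans (hGcard.trans (le_of_eq ?_))
      simp
  · rw [Ideal.span_le]
    intro x hx
    rw [Finset.mem_coe, Finset.mem_union, Finset.mem_image, Finset.mem_image] at hx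
    rcases hx with ⟨i, -, rfl⟩ | ⟨s, hs, rfl⟩
    · exact hb i
    · exact (hsol s).1 (hG ▸ Submodule.subset_span hs)
  · intro a ha
    set J := Ideal.span ((Finset.univ.image b ∪ G.image Φ : Finset _) :
      Set (MvPolynomial (Fin N) K)) with hJ
    obtain ⟨s, hs⟩ := hspan a
    have h1 : a - Φ s ∈ J := by
      refine Ideal.span_mono ?_ hs
      rintro _ ⟨i, rfl⟩
      simp
    have h2 : s ∈ linSol M := by
      rw [hsol]
      have := (RingHom.ker π).sub_mem ha (hIker hs)
      rwa [sub_sub_cancel] at this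
    have h3 : ∀ s ∈ linSol M, Φ s ∈ J := by
      intro s h
      rw [← hG] at h
      induction h using Submodule.span_induction with
      | mem s hs =>
        refine Ideal.subset_span ?_
        rw [Finset.mem_coe, Finset.mem_union]
        exact Or.inr (Finset.mem_image_of_mem _ hs)
      | zero => simp [Φ]
      | add s t _ _ h h' =>
        have : Φ (s + t) = Φ s + Φ t := by simp [Φ, add_mul, Finset.sum_add_distrib]
        rw [this]
        exact J.add_mem h h'
      | smul r s _ h =>
        have : Φ (r • s) = aeval θ r * Φ s := by simp [Φ, mul_assoc, Finset.mul_sum]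
        rw [this]
        exact J.mul_mem_left _ h
    have := J.add_mem h1 (h3 s h2)
    rwa [sub_add_cancel] at this

end

lemma hermannBound_le_succ (m q D : ℕ) : hermannBound m q D ≤ hermannBound (m + 1) q D := by
  refine le_trans (hermannBound_mono (Nat.le_mul_of_pos_right q (by omega)) le_rfl)
    (Nat.le_add_left _ q)

lemma hermannBound_mono_left {m m' : ℕ} (h : m ≤ m') (q D : ℕ) :
    hermannBound m q D ≤ hermannBound m' q D :=
  monotone_nat_of_le_succ (f := fun m => hermannBound m q D)
    (fun m => hermannBound_le_succ m q D) h

section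

variable {K : Type*} [Field K] {N : ℕ} {w : Fin N → ℕ} {c d : ℕ}

lemma RegFam.card_le {F : Fin c → MvPolynomial (Fin N) K} (h : RegFam F)
    (hne : Ideal.span (Set.range F) ≠ ⊤) : c ≤ N := by
  obtain ⟨p, hp, hle⟩ := Ideal.exists_le_maximal _ hne
  have h1 := h.height_ge (p := p) fun i => hle (Ideal.subset_span ⟨i, rfl⟩)
  have h2 : (p.height : WithBot ℕ∞) ≤ ringKrullDim (MvPolynomial (Fin N) K) :=
    Ideal.height_le_ringKrullDim_of_ne_top hp.ne_top
  rw [MvPolynomial.ringKrullDim_of_isNoetherianRing, ringKrullDim_eq_zero_of_field, zero_add] at h2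
  have h3 : ((c : ℕ∞) : WithBot ℕ∞) ≤ p.height := by exact_mod_cast h1
  have h4 := h3.trans h2
  simpa using h4

theorem exists_generators_ker_of_injective [Infinite K] [PerfectField K] {W m : ℕ}
    {T : Type*} [CommRing T] [IsDomain T]
    (hW : 0 < W) (hw : ∀ i, w i ≤ d) {θ : Fin m → MvPolynomial (Fin N) K}
    (hθ : ∀ i, IsWeightedHomogeneous w (θ i) W) {π : MvPolynomial (Fin N) K →+* T}
    (hsurj : Function.Surjective π) (hinj : ∀ P : MvPolynomial (Fin m) K, P ≠ 0 → π (aeval θ P) ≠ 0)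
    (hker : WHom w (RingHom.ker π)) {b : Fin c → MvPolynomial (Fin N) K}
    (hb : ∀ i, b i ∈ RingHom.ker π)
    (hspan : ∀ a, ∃ s : (Fin N → Fin (N * W + 1)) → MvPolynomial (Fin m) K,
      a - ∑ l, aeval θ (s l) * boxMonomial K l ∈ Ideal.span (Set.range b)) :
    ∃ S : Finset (MvPolynomial (Fin N) K),
      S.card ≤ c + hermannBound m ((N * W + 1) ^ N) (2 * N * N * d) ∧
      Ideal.span (S : Set (MvPolynomial (Fin N) K)) = RingHom.ker π := by
  let _ : Algebra (MvPolynomial (Fin m) K) T := (π.comp (aeval θ).toRingHom).toAlgebra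
  have hπ : ∀ P, algebraMap (MvPolynomial (Fin m) K) T P = π (aeval θ P) := fun P => rfl
  have : FaithfulSMul (MvPolynomial (Fin m) K) T := by
    rw [faithfulSMul_iff_algebraMap_injective, injective_iff_map_eq_zero]
    intro P hP
    by_contra hne
    exact hinj P hne hP
  have : Module.Finite (MvPolynomial (Fin m) K) T := by
    refine Module.Finite.of_surjective
      (Fintype.linearCombination (MvPolynomial (Fin m) K)
        fun l : Fin N → Fin (N * W + 1) => π (boxMonomial K l)) fun t => ?_
    obtain ⟨a, rfl⟩ := hsurj t
    obtain ⟨s, hs⟩ := hspan a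
    refine ⟨s, ?_⟩
    have h1 : π (a - ∑ l, aeval θ (s l) * boxMonomial K l) = 0 := by
      refine (Ideal.span_le.2 ?_ : _ ≤ RingHom.ker π) hs
      rintro _ ⟨i, rfl⟩
      exact hb i
    rw [map_sub, sub_eq_zero] at h1
    rw [h1, map_sum, Fintype.linearCombination_apply]
    exact Finset.sum_congr rfl fun l _ => by rw [map_mul, ← hπ, Algebra.smul_def]
  exact exists_generators_ker hW hw hθ hsurj hπ hker hb hspan

theorem exists_generators_of_minimalPrimes_weighted [IsAlgClosed K] (hw0 : ∀ i, w i ≠ 0)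
    (hwd : ∀ i, w i ≤ d) {F : Fin c → MvPolynomial (Fin N) K} (hF : RegFam F) {e : Fin c → ℕ}
    (hhom : ∀ i, IsWeightedHomogeneous w (F i) (e i)) (he0 : ∀ i, 0 < e i) (hed : ∀ i, e i ≤ d)
    {Q : Ideal (MvPolynomial (Fin N) K)} (hQ : Q ∈ (Ideal.span (Set.range F)).minimalPrimes) :
    ∃ S : Finset (MvPolynomial (Fin N) K),
      S.card ≤ c + hermannBound N ((N * d.factorial + 1) ^ N) (2 * N * N * d) ∧
      Ideal.span (S : Set (MvPolynomial (Fin N) K)) = Q := by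
  have hQp : Q.IsPrime := hQ.1.1
  have hA : HasDepth (MvPolynomial (Fin N) K) := (HasDepth.of_field K).mvPolynomial_fin N
  have : Infinite K := IsAlgClosed.instInfinite
  have hcN : c ≤ N := hF.card_le fun h => hQp.ne_top (top_le_iff.1 (h ▸ hQ.1.2))
  obtain ⟨m, hm⟩ := Nat.exists_eq_add_of_le hcN
  set W := d.factorial with hWdef
  have hW0 : 0 < W := Nat.factorial_pos d
  have hwW : ∀ i, w i ∣ W := fun i => Nat.dvd_factorial (Nat.pos_of_ne_zero (hw0 i)) (hwd i)
  have heW : ∀ i, e i ∣ W := fun i => Nat.dvd_factorial (he0 i) (hed i)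
  have hs0 : ∀ i, W / e i ≠ 0 := fun i => (Nat.div_pos (Nat.le_of_dvd hW0 (heW i)) (he0 i)).ne'
  let b : Fin c → MvPolynomial (Fin N) K := fun i => F i ^ (W / e i)
  have hb : RegFam b := hF.of_forall_mem hA fun _ hp _ hi => hp.mem_of_pow_mem _ hi
  have hbhom : ∀ i, IsWeightedHomogeneous w (b i) W := fun i => by
    have := (hhom i).pow (W / e i)
    rwa [smul_eq_mul, Nat.div_mul_cancel (heW i)] at this
  have hbF : ∀ i, b i ∈ Ideal.span (Set.range F) := fun i =>
    Ideal.pow_mem_of_mem _ (Ideal.subset_span (Set.mem_range_self i)) _ (Nat.pos_of_ne_zero (hs0 i))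
  obtain ⟨g, hg, hghom, hgb⟩ := hb.exists_extend hwW hbhom m hm.ge
  have hrange : (Set.range fun i => g (Fin.castAdd m i)) = Set.range b := by
    congr 1
    exact funext hgb
  have hQb : Q ∈ (Ideal.span (Set.range fun i => g (Fin.castAdd m i))).minimalPrimes := by
    rw [hrange]
    refine ⟨⟨hQp, ?_⟩, fun p hp hpQ => hQ.2 ⟨hp.1, ?_⟩ hpQ⟩
    · rw [Ideal.span_le]
      rintro _ ⟨i, rfl⟩
      exact hQ.1.2 (hbF i)
    · rw [Ideal.span_le]
      rintro _ ⟨i, rfl⟩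
      have := hp.1
      exact hp.1.mem_of_pow_mem _ (hp.2 (Ideal.subset_span ⟨i, rfl⟩))
  have hWQ : WHom w Q := by
    refine WHom.of_mem_minimalPrimes (WHom.span w ?_) hQ
    rintro _ ⟨i, rfl⟩
    exact ⟨_, hhom i⟩
  have hspan := hg.exists_sub_sum_mem_span hm.symm hw0 hW0 hwW hghom
  set θ : Fin m → MvPolynomial (Fin N) K := fun j => g (Fin.natAdd c j) with hθ
  have hker : RingHom.ker (Ideal.Quotient.mk Q) = Q := Ideal.mk_ker
  rw [hrange] at hspan
  obtain ⟨S, hS, hSQ⟩ := exists_generators_ker_of_injective (d := d) (θ := θ) hW0 hwd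
    (fun i => hghom _) Ideal.Quotient.mk_surjective
    (fun P hP h => hg.aeval_notMem hW0 hghom hQb hP (Ideal.Quotient.eq_zero_iff_mem.1 h))
    (by rwa [hker]) (fun i => by rw [hker]; exact hQ.1.2 (hbF i)) hspan
  refine ⟨S, hS.trans (Nat.add_le_add_left (hermannBound_mono_left (by omega) _ _) _), ?_⟩
  rw [hSQ, hker]

end

section

lemma regFam_of_isWeaklyRegular {A : Type*} [CommRing A] {c : ℕ} {f : Fin c → A}
    (h : RingTheory.Sequence.IsWeaklyRegular A (List.ofFn f)) : RegFam f := by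
  intro k x hx
  have h1 := h.regular_mod_prev k (by simp)
  have h2 : Ideal.ofList ((List.ofFn f).take k) = Ideal.span (f '' Set.Iio k) := by
    rw [Ideal.ofList]
    congr 1
    ext y
    simp only [Set.mem_ofPred_eq, List.mem_take_iff_getElem, List.getElem_ofFn, Set.mem_image,
      Set.mem_Iio]
    constructor
    · rintro ⟨j, hj, rfl⟩
      exact ⟨⟨j, by grind⟩, Fin.lt_def.2 (hj.trans_le (min_le_left _ _)), rfl⟩
    · rintro ⟨j, hj, rfl⟩
      exact ⟨j, lt_min (Fin.lt_def.1 hj) (by simp), rfl⟩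
  rw [h2, List.getElem_ofFn, smul_eq_mul, Ideal.mul_top] at h1
  rw [← Ideal.Quotient.eq_zero_iff_mem]
  refine h1 ?_
  simp only [smul_zero]
  change Submodule.Quotient.mk (f k • x) = _
  exact Ideal.Quotient.eq_zero_iff_mem.2 hx

variable {K : Type*} [Field K] {N : ℕ}

attribute [local instance] MvPolynomial.weightedGradedAlgebra

lemma Nice.exists_isWeightedHomogeneous {n : ℕ} {g : Fin n → MvPolynomial (Fin N) K}
    {dg : Fin n → ℕ} (hg : Nice g dg) {f : MvPolynomial (Fin N) K} {e : ℕ} (hf : f.IsHomogeneous e)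
    (hfg : f ∈ Algebra.adjoin K (Set.range g)) :
    ∃ F : MvPolynomial (Fin n) K, IsWeightedHomogeneous dg F e ∧ aeval g F = f := by
  rw [Algebra.adjoin_range_eq_range_aeval] at hfg
  obtain ⟨p, rfl⟩ := hfg
  refine ⟨weightedHomogeneousComponent dg e p,
    weightedHomogeneousComponent_isWeightedHomogeneous _ _, ?_⟩
  have h1 := proj_aeval (𝒜 := weightedHomogeneousSubmodule K (1 : Fin N → ℕ)) (e := dg) hg.hom e p
  rw [← h1]
  have h2 := proj_of_mem (𝒜 := weightedHomogeneousSubmodule K (1 : Fin N → ℕ)) e hf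
  rw [if_pos rfl] at h2
  exact h2

/-- An effective bound for the number of generators of a minimal prime of an ideal generated by a
homogeneous regular sequence. -/
theorem RegFam.exists_generators_of_minimalPrimes [IsAlgClosed K] {c d σ : ℕ} (hc : c ≤ σ)
    {f : Fin c → MvPolynomial (Fin N) K} (hf : RegFam f)
    (hdeg : ∀ i, ∃ e : ℕ, 0 < e ∧ e ≤ d ∧ (f i).IsHomogeneous e)
    {P : Ideal (MvPolynomial (Fin N) K)} (hP : P ∈ (Ideal.span (Set.range f)).minimalPrimes) :
    ∃ B ≤ strongBound d σ, ∃ S : Finset (MvPolynomial (Fin N) K),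
      S.card ≤ c + hermannBound B ((B * d.factorial + 1) ^ B) (2 * B * B * d) ∧
      Ideal.span (S : Set (MvPolynomial (Fin N) K)) = P := by
  classical
  have hPp := hP.1.1
  choose e he0 hed hhom using hdeg
  have hne : ∀ i, f i ≠ 0 := by
    intro i h0
    have h1 : (1 : MvPolynomial (Fin N) K) ∈ Ideal.span (f '' Set.Iio i) :=
      hf i 1 (by rw [h0, zero_mul]; exact Submodule.zero_mem _)
    exact hPp.ne_top ((Ideal.eq_top_iff_one _).2
      (hP.1.2 (Ideal.span_mono (Set.image_subset_range _ _) h1)))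
  have htd : ∀ i, (f i).totalDegree = e i := fun i => (hhom i).totalDegree (hne i)
  obtain ⟨n, g, dg, hn, hg, hdg, hsub⟩ := FormSet.exists_nice (e := d) (m := σ)
    (fun e' _ k => niceCover_strongBound (K := K) (N := N) e' k)
    (S := Finset.univ.image f) (by
      intro s hs
      obtain ⟨i, -, rfl⟩ := Finset.mem_image.1 hs
      rw [htd i]
      exact ⟨hne i, he0 i, hhom i⟩)
    (Finset.card_image_le.trans (by simpa using hc)) (by
      intro s hs
      obtain ⟨i, -, rfl⟩ := Finset.mem_image.1 hs
      exact (htd i).trans_le (hed i))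
  choose F hFhom hFf using fun i => hg.exists_isWeightedHomogeneous (hhom i)
    (hsub (Finset.mem_coe.2 (Finset.mem_image_of_mem f (Finset.mem_univ i))))
  obtain ⟨D⟩ := hg.exists_freeData
  have hmap : ∀ s : Set (Fin c), Ideal.span (f '' s) = (Ideal.span (F '' s)).map
      (aeval g : MvPolynomial (Fin n) K →ₐ[K] MvPolynomial (Fin N) K) := by
    intro s
    rw [Ideal.map_span, ← Set.image_comp]
    congr 2
    exact funext fun i => (hFf i).symm
  have hFreg : RegFam F := by
    intro k x hx
    rw [← D.aeval_mem_map_iff, ← hmap] at hx ⊢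
    refine hf k _ ?_
    rwa [map_mul, hFf] at hx
  have hfP : ∀ i, f i ∈ P := fun i => hP.1.2 (Ideal.subset_span ⟨i, rfl⟩)
  have hQ : P.comap (aeval g : MvPolynomial (Fin n) K →ₐ[K] MvPolynomial (Fin N) K) ∈
      (Ideal.span (Set.range F)).minimalPrimes := by
    refine ⟨⟨Ideal.comap_isPrime _ _, ?_⟩, fun p hp hle x hx => ?_⟩
    · rw [Ideal.span_le]
      rintro _ ⟨i, rfl⟩
      change aeval g (F i) ∈ P
      rw [hFf]
      exact hfP i
    · have h1 := hg.isPrime_map p hp.1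
      have h2 := hP.2 ⟨h1, ?_⟩ (Ideal.map_le_iff_le_comap.2 hle)
      · exact (D.aeval_mem_map_iff p x).1 (h2 hx)
      · rw [← Set.image_univ, hmap, Set.image_univ]
        exact Ideal.map_mono hp.2
  obtain ⟨S, hS, hSQ⟩ := exists_generators_of_minimalPrimes_weighted (d := d)
    (fun i => (hg.pos i).ne') hdg hFreg hFhom he0 hed hQ
  refine ⟨n, hn, S.image (aeval g), Finset.card_image_le.trans hS, ?_⟩
  have h1 := hg.eq_map_of_minimalPrimes (S := Set.range f) (fun x hx => by
    obtain ⟨i, rfl⟩ := hx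
    exact hsub (Finset.mem_coe.2 (Finset.mem_image_of_mem f (Finset.mem_univ i)))) hP
  rw [h1, ← hSQ, Ideal.map_span, Finset.coe_image]

end

section Knuth

lemma knuth_one (a b : ℕ) : knuth a 1 b = a ^ b := by rw [knuth]

lemma knuth_succ_succ (a k b : ℕ) :
    knuth a (k + 2) (b + 1) = knuth a (k + 1) (knuth a (k + 2) b) := by
  rcases b with _ | b
  · rcases k with _ | k <;> simp [knuth]
  · rw [knuth]

variable {a : ℕ}

lemma lt_knuth (ha : 2 ≤ a) (k b : ℕ) : b < knuth a (k + 1) b := by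
  induction k generalizing b with
  | zero => exact knuth_one a b ▸ Nat.lt_pow_self ha
  | succ k ih =>
    induction b with
    | zero => simp [knuth]
    | succ b ihb =>
      rw [knuth_succ_succ]
      exact lt_of_le_of_lt ihb (ih _)

lemma knuth_strictMono (ha : 2 ≤ a) (k : ℕ) : StrictMono (knuth a (k + 1)) := by
  refine strictMono_nat_of_lt_succ fun b => ?_
  rcases k with _ | k
  · simpa [knuth] using Nat.pow_lt_pow_right ha (Nat.lt_succ_self b)
  · rw [knuth_succ_succ]
    exact lt_knuth ha _ _

lemma knuth_le_succ (ha : 2 ≤ a) (k b : ℕ) : knuth a (k + 1) b ≤ knuth a (k + 2) b := by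
  rcases b with _ | b
  · rcases k with _ | k <;> simp [knuth]
  · rw [knuth_succ_succ]
    exact (knuth_strictMono ha k).monotone (lt_knuth ha _ _)

lemma knuth_mono (ha : 2 ≤ a) {k l : ℕ} (h : k ≤ l) (b : ℕ) :
    knuth a (k + 1) b ≤ knuth a (l + 1) b :=
  monotone_nat_of_le_succ (f := fun k => knuth a (k + 1) b) (fun k => knuth_le_succ ha k b) h

lemma pow_le_knuth (ha : 2 ≤ a) (k b : ℕ) : a ^ b ≤ knuth a (k + 1) b :=
  knuth_one a b ▸ knuth_mono ha (Nat.zero_le k) b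

lemma iterate_knuth (a k r b : ℕ) :
    (knuth a (k + 1))^[r] (knuth a (k + 2) b) = knuth a (k + 2) (b + r) := by
  induction r with
  | zero => rfl
  | succ r ih => rw [Function.iterate_succ_apply', ih, ← add_assoc, knuth_succ_succ]

lemma succ_mul_three_le_knuth (ha : 3 ≤ a) (k b : ℕ) :
    3 * (b + 1) ≤ knuth a (k + 1) (knuth a (k + 1) b) := by
  have h1 : 3 * (b + 1) ≤ 3 ^ (b + 1) := by
    rw [pow_succ']
    exact Nat.mul_le_mul_left 3 (Nat.lt_pow_self (by norm_num))
  calc 3 * (b + 1) ≤ 3 ^ (b + 1) := h1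
    _ ≤ a ^ (b + 1) := Nat.pow_le_pow_left ha _
    _ ≤ knuth a (k + 1) (b + 1) := pow_le_knuth (by omega) _ _
    _ ≤ _ := (knuth_strictMono (by omega) k).monotone (lt_knuth (by omega) _ _)

lemma improveBound_le_iterate {F ψ : ℕ → ℕ} (hF : Monotone F) (hF3 : ∀ b, 3 * (b + 1) ≤ F (F b))
    {r : ℕ} (hψ : ∀ m, ψ m ≤ F^[r] m) (hψ' : ∀ m, m ≤ ψ m) (j m : ℕ) :
    improveBound ψ j m ≤ F^[(2 * r + 4) * j + r] m := by
  induction j generalizing m with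
  | zero => simpa [improveBound] using hψ m
  | succ j ih =>
    rw [improveBound, show (2 * r + 4) * (j + 1) + r = ((2 * r + 4) * j + r) + (2 * r + 4) by ring,
      Function.iterate_add_apply]
    refine (ih _).trans (hF.iterate _ ?_)
    have h1 : 3 * ψ m + 1 ≤ F (F (F^[r] m)) :=
      le_trans (by have := hψ m; omega) (hF3 _)
    have h2 : ψ (3 * ψ m + 1) ≤ F^[r] (F (F (F^[r] m))) :=
      (hψ _).trans (hF.iterate r h1)
    have h3 := hψ' (3 * ψ m + 1)
    have h4 : F^[2 * r + 4] m = F (F (F^[r] (F (F (F^[r] m))))) := by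
      rw [show 2 * r + 4 = 1 + (1 + (r + (1 + (1 + r)))) by ring]
      simp only [Function.iterate_add_apply, Function.iterate_one]
    rw [h4]
    exact le_trans (by omega) (hF3 _)

lemma strongBound_le_iterate_knuth (ha : 3 ≤ a) (e m : ℕ) :
    strongBound e m ≤ (knuth a (e + 1))^[4] m := by
  have hid : ∀ k, id ≤ knuth a (k + 1) := fun k b => (lt_knuth (by omega) k b).le
  induction e generalizing m with
  | zero => exact Function.id_le_iterate_of_id_le (hid 0) 4 m
  | succ e ih =>
    have hmono := (knuth_strictMono (show 2 ≤ a by omega) e).monotone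
    have hmono' := (knuth_strictMono (show 2 ≤ a by omega) (e + 1)).monotone
    have h1 := improveBound_le_iterate hmono (succ_mul_three_le_knuth ha e) ih
      (le_strongBound e) m m
    refine h1.trans ((hmono.iterate _ (hid (e + 1) m)).trans ?_)
    rw [iterate_knuth, Function.iterate_succ_apply']
    refine hmono' ?_
    have h2 := succ_mul_three_le_knuth ha (e + 1) m
    have h3 := pow_le_knuth (show 2 ≤ a by omega) (e + 1)
      (knuth a (e + 2) (knuth a (e + 2) m))
    calc m + ((2 * 4 + 4) * m + 4) ≤ 27 * (m + 1) := by omega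
      _ ≤ 27 * 27 ^ m := Nat.mul_le_mul_left _ (Nat.lt_pow_self (by norm_num))
      _ = 3 ^ (3 * (m + 1)) := by rw [pow_mul, pow_succ']; norm_num
      _ ≤ a ^ (3 * (m + 1)) := Nat.pow_le_pow_left ha _
      _ ≤ _ := (Nat.pow_le_pow_right (by omega) h2).trans h3

end Knuth

lemma hermannBound_le_pow {D : ℕ} (hD : 1 ≤ D) (m : ℕ) {q : ℕ} (hq : 1 ≤ q) :
    hermannBound m q D ≤ (m + 1) * (2 * D * q) ^ 2 ^ m := by
  induction m generalizing q with
  | zero =>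
    simp only [hermannBound, pow_zero, pow_one, zero_add, one_mul]
    exact Nat.le_mul_of_pos_left q (by omega)
  | succ m ih =>
    rw [hermannBound]
    have h1 : 1 ≤ q * D := Nat.mul_pos hq hD
    have h2 := ih (q := q * (q * D + 1)) (Nat.mul_pos hq (by omega))
    have h3 : 2 * D * (q * (q * D + 1)) ≤ (2 * D * q) ^ 2 := by
      calc 2 * D * (q * (q * D + 1)) ≤ 2 * D * (q * (q * D + q * D)) := by gcongr
        _ = _ := by ring
    have h4 : q ≤ (2 * D * q) ^ 2 ^ (m + 1) :=
      (Nat.le_mul_of_pos_left q (by omega)).trans (Nat.le_self_pow (by positivity) _)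
    calc q + hermannBound m (q * (q * D + 1)) D
        ≤ (2 * D * q) ^ 2 ^ (m + 1) + (m + 1) * ((2 * D * q) ^ 2) ^ 2 ^ m := by
          refine Nat.add_le_add h4 (h2.trans ?_)
          gcongr
      _ = _ := by rw [← pow_mul, ← pow_succ']; ring

lemma hermannBound_le_two_pow {X d c : ℕ} (hX : 7 ≤ X) (hd : 2 ≤ d) (hdX : d ≤ X) (hcX : c ≤ X) :
    c + hermannBound X ((X * d.factorial + 1) ^ X) (2 * X * X * d) ≤ 2 ^ 2 ^ (3 * X) := by
  have hX2 : X ^ 2 + 2 * X + 8 ≤ 2 ^ X := by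
    clear * - hX
    induction X, hX using Nat.le_induction with
    | base => norm_num
    | succ n hn ih =>
      rw [pow_succ 2 n]
      nlinarith
  have hfac : X * d.factorial + 1 ≤ X ^ (X + 2) := by
    have h1 : d.factorial ≤ X ^ X :=
      (Nat.factorial_le hdX).trans (Nat.factorial_le_pow X)
    have h2 : 1 ≤ X ^ (X + 1) := Nat.one_le_pow _ _ (by omega)
    calc X * d.factorial + 1 ≤ X * X ^ X + X ^ (X + 1) := by gcongr
      _ = 2 * X ^ (X + 1) := by ring
      _ ≤ X * X ^ (X + 1) := by gcongr; omega
      _ = _ := by ring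
  have hu : 2 * (2 * X * X * d) * (X * d.factorial + 1) ^ X ≤ X ^ (X ^ 2 + 2 * X + 4) := by
    calc 2 * (2 * X * X * d) * (X * d.factorial + 1) ^ X
        ≤ 2 * (2 * X * X * X) * (X ^ (X + 2)) ^ X := by gcongr
      _ = 4 * (X ^ 3 * (X ^ (X + 2)) ^ X) := by ring
      _ ≤ X * (X ^ 3 * (X ^ (X + 2)) ^ X) := by gcongr; omega
      _ = _ := by rw [← pow_mul]; ring
  have h1 := hermannBound_le_pow (D := 2 * X * X * d) (by
    have : 0 < 2 * X * X * d := by positivity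
    omega) X (q := (X * d.factorial + 1) ^ X) (Nat.one_le_pow _ _ (by omega))
  have h2 : X ≤ X ^ ((X ^ 2 + 2 * X + 4) * 2 ^ X) :=
    Nat.le_self_pow (by positivity) _
  calc c + hermannBound X ((X * d.factorial + 1) ^ X) (2 * X * X * d)
      ≤ X ^ ((X ^ 2 + 2 * X + 4) * 2 ^ X)
        + (X + 1) * (X ^ (X ^ 2 + 2 * X + 4)) ^ 2 ^ X :=
        Nat.add_le_add (hcX.trans h2) (h1.trans (by gcongr))
    _ = (X + 2) * X ^ ((X ^ 2 + 2 * X + 4) * 2 ^ X) := by rw [← pow_mul]; ring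
    _ ≤ X ^ 2 * X ^ ((X ^ 2 + 2 * X + 4) * 2 ^ X) := by gcongr; nlinarith
    _ = X ^ ((X ^ 2 + 2 * X + 4) * 2 ^ X + 2) := by ring
    _ ≤ X ^ (2 ^ X * 2 ^ X) := by
        refine Nat.pow_le_pow_right (by omega) ?_
        have := Nat.mul_le_mul_right (2 ^ X) hX2
        have h3 : 1 ≤ 2 ^ X := Nat.one_le_two_pow
        nlinarith
    _ ≤ (2 ^ 2 ^ X) ^ (2 ^ X * 2 ^ X) := by
        refine Nat.pow_le_pow_left ?_ _
        exact (Nat.lt_two_pow_self (n := X)).le.trans (Nat.lt_two_pow_self).le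
    _ = 2 ^ 2 ^ (3 * X) := by rw [← pow_mul]; congr 1; ring

/-- If `I ⊆ R = K[x_1,…,x_N]` is generated by a homogeneous regular sequence of
length at most `σ` in degrees at most `d`, then every minimal prime `P` of `I` is
generated by at most `D_d(σ) = d ^ (2 ^ ((d+1) ↑^(d²+d-2) ((d+1)^σ)))` elements. -/
theorem minimal_prime_generators_bound {K : Type*} [Field K] [IsAlgClosed K] {N : ℕ}
    (d σ : ℕ) (hd : 2 ≤ d) (hσ : 2 ≤ σ)
    (c : ℕ) (hc : c ≤ σ) (f : Fin c → MvPolynomial (Fin N) K)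
    (hdeg : ∀ i, ∃ e : ℕ, 0 < e ∧ e ≤ d ∧ (f i).IsHomogeneous e)
    (hreg : RingTheory.Sequence.IsRegular (MvPolynomial (Fin N) K) (List.ofFn f))
    (P : Ideal (MvPolynomial (Fin N) K))
    (hP : P ∈ (Ideal.span (Set.range f)).minimalPrimes) :
    ∃ s : Finset (MvPolynomial (Fin N) K),
      s.card ≤ d ^ (2 ^ knuth (d + 1) (d ^ 2 + d - 2) ((d + 1) ^ σ)) ∧
      Ideal.span (s : Set (MvPolynomial (Fin N) K)) = P := by
  obtain ⟨B, hB, s, hs, hsP⟩ :=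
    (regFam_of_isWeaklyRegular hreg.toIsWeaklyRegular).exists_generators_of_minimalPrimes hc hdeg hP
  refine ⟨s, hs.trans ?_, hsP⟩
  have ha : 2 ≤ d + 1 := by omega
  set X := knuth (d + 1) (d + 2) (σ + 4) with hXdef
  have hσX : σ + 4 < X := lt_knuth ha _ _
  have hdX : d + 1 ≤ X :=
    (Nat.le_self_pow (by omega) _).trans (pow_le_knuth ha (d + 1) (σ + 4))
  have hBX : B ≤ X := by
    refine hB.trans ((strongBound_le_iterate_knuth (a := d + 1) (by omega) d σ).trans ?_)
    rw [hXdef, ← iterate_knuth]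
    exact (knuth_strictMono ha d).monotone.iterate 4 (lt_knuth ha (d + 1) σ).le
  have hT : 3 * X ≤ knuth (d + 1) (d ^ 2 + d - 2) ((d + 1) ^ σ) := by
    have h1 : σ + 5 ≤ (d + 1) ^ σ := by
      refine le_trans ?_ (Nat.pow_le_pow_left (show 3 ≤ d + 1 by omega) σ)
      clear * - hσ
      induction σ, hσ using Nat.le_induction with
      | base => norm_num
      | succ n hn ih => rw [pow_succ]; omega
    obtain ⟨k, hk, hkd⟩ : ∃ k, d + 1 ≤ k ∧ d ^ 2 + d - 2 = k + 1 :=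
      ⟨d ^ 2 + d - 3, by have : 2 * 2 ≤ d ^ 2 := by nlinarith
                         omega, by have : 2 * 2 ≤ d ^ 2 := by nlinarith
                                   omega⟩
    rw [hkd]
    calc 3 * X ≤ 3 ^ X := by
          obtain ⟨Y, hY⟩ : ∃ Y, X = Y + 1 := ⟨X - 1, by omega⟩
          rw [hY, pow_succ']
          exact Nat.mul_le_mul_left 3 (Nat.lt_pow_self (by norm_num))
      _ ≤ (d + 1) ^ X := Nat.pow_le_pow_left (by omega) _
      _ ≤ knuth (d + 1) (d + 1) X := pow_le_knuth ha _ _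
      _ = knuth (d + 1) (d + 2) (σ + 5) := (knuth_succ_succ _ _ _).symm
      _ ≤ knuth (d + 1) (d + 2) ((d + 1) ^ σ) := (knuth_strictMono ha _).monotone h1
      _ ≤ _ := knuth_mono ha hk _
  calc c + hermannBound B ((B * d.factorial + 1) ^ B) (2 * B * B * d)
      ≤ c + hermannBound X ((X * d.factorial + 1) ^ X) (2 * X * X * d) := by
        refine Nat.add_le_add_left ((hermannBound_mono_left hBX _ _).trans
          (hermannBound_mono ?_ (by gcongr))) c
        exact (Nat.pow_le_pow_left (by gcongr) _).trans (Nat.pow_le_pow_right (by omega) hBX)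
    _ ≤ 2 ^ 2 ^ (3 * X) := hermannBound_le_two_pow (by omega) hd (by omega) (by omega)
    _ ≤ d ^ 2 ^ (3 * X) := Nat.pow_le_pow_left hd _
    _ ≤ _ := Nat.pow_le_pow_right (by omega) (Nat.pow_le_pow_right (by norm_num) hT)
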